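/- arXiv:2204.10021 — 2 statements merged into one kernel-verified Lean document; each statement's English description precedes it below -/
import Mathlib

section
/- Every perfect matching of a bridgeless cubic graph can be extended to an S₄-pair: for every perfect matching N of a bridgeless cubic graph G, there exists a perfect matching M of G such that G \ (N ∪ M) is bipartite. -/
namespace CubicDart
open scoped Classical

variable {V : Type*}

/-- The darts leaving the set `X`, where `ε` sends a dart to its reverse. -/
noncomputable def cut (ε : V × Fin 3 → V × Fin 3) (X : Finset V) : Finset (V × Fin 3) :=
  (X ×ˢ Finset.univ).filter (fun d => (ε d).1 ∉ X)

/-- `ε` is the dart reversal of a cubic multigraph on `S`. -/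
structure Rev (S : Finset V) (ε : V × Fin 3 → V × Fin 3) : Prop where
  live : ∀ d, d.1 ∈ S → (ε d).1 ∈ S
  invol : ∀ d, d.1 ∈ S → ε (ε d) = d
  ne_self : ∀ d, d.1 ∈ S → ε d ≠ d

/-- `ε` is the dart reversal of a bridgeless cubic multigraph on `S`. -/
structure Cubic (S : Finset V) (ε : V × Fin 3 → V × Fin 3) : Prop extends Rev S ε where
  bridgeless : ∀ X ⊆ S, (cut ε X).card ≠ 1

/-- `B` marks the edges of a disjoint union of circuits. -/
structure Flags (S : Finset V) (ε : V × Fin 3 → V × Fin 3) (B : V × Fin 3 → Prop) : Prop where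
  symm : ∀ d, d.1 ∈ S → (B (ε d) ↔ B d)
  even : ∀ v ∈ S, ∑ i : Fin 3, (if B (v, i) then (1 : ZMod 2) else 0) = 0

/-- `m` selects at each vertex of `X` a matching dart, and `c` is a colouring which is proper on
the marked edges outside the matching. -/
def Sol (X : Finset V) (ε : V × Fin 3 → V × Fin 3) (B : V × Fin 3 → Prop)
    (m : V → Fin 3) (c : V → Bool) : Prop :=
  ∀ d : V × Fin 3, d.1 ∈ X → (ε d).1 ∈ X →
    (m d.1 = d.2 → m (ε d).1 = (ε d).2) ∧ (B d → m d.1 ≠ d.2 → c d.1 ≠ c (ε d).1)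

/-- `P0`, `P1`, `P2` are the three darts at `p`. -/
structure Tri (p : V) (P0 P1 P2 : V × Fin 3) : Prop where
  e0 : P0.1 = p
  e1 : P1.1 = p
  e2 : P2.1 = p
  n01 : P0 ≠ P1
  n02 : P0 ≠ P2
  n12 : P1 ≠ P2

variable {S X : Finset V} {ε : V × Fin 3 → V × Fin 3} {B : V × Fin 3 → Prop}
  {m : V → Fin 3} {c : V → Bool} {p : V} {P0 P1 P2 : V × Fin 3}

theorem mem_cut {d : V × Fin 3} : d ∈ cut ε X ↔ d.1 ∈ X ∧ (ε d).1 ∉ X := by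
  simp [cut, Finset.mem_product]

namespace Tri

theorem cases (h : Tri p P0 P1 P2) {d : V × Fin 3} (hd : d.1 = p) :
    d = P0 ∨ d = P1 ∨ d = P2 := by
  obtain ⟨h0, h1, h2, h3, h4, h5⟩ := h
  obtain ⟨d, i⟩ := d; obtain ⟨a, i0⟩ := P0; obtain ⟨b, i1⟩ := P1; obtain ⟨e, i2⟩ := P2
  simp only at h0 h1 h2 hd
  subst h0 h1 h2 hd
  simp only [ne_eq, Prod.mk.injEq, true_and] at *
  omega

theorem idx (h : Tri p P0 P1 P2) (i : Fin 3) : i = P0.2 ∨ i = P1.2 ∨ i = P2.2 := by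
  rcases h.cases (d := (p, i)) rfl with h | h | h <;> simp [← h]

theorem idx_ne (h : Tri p P0 P1 P2) : P0.2 ≠ P1.2 ∧ P0.2 ≠ P2.2 ∧ P1.2 ≠ P2.2 :=
  ⟨fun e => h.n01 (Prod.ext (h.e0.trans h.e1.symm) e),
    fun e => h.n02 (Prod.ext (h.e0.trans h.e2.symm) e),
    fun e => h.n12 (Prod.ext (h.e1.trans h.e2.symm) e)⟩

theorem sum_eq (h : Tri p P0 P1 P2) {M : Type*} [AddCommMonoid M] (f : V × Fin 3 → M) :
    ∑ i : Fin 3, f (p, i) = f P0 + f P1 + f P2 := by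
  have huniv : (Finset.univ : Finset (Fin 3)) = {P0.2, P1.2, P2.2} := by
    ext i; simpa using h.idx i
  have hne := h.idx_ne
  have e0 : (p, P0.2) = P0 := Prod.ext h.e0.symm rfl
  have e1 : (p, P1.2) = P1 := Prod.ext h.e1.symm rfl
  have e2 : (p, P2.2) = P2 := Prod.ext h.e2.symm rfl
  rw [huniv, Finset.sum_insert (by simp [hne]), Finset.sum_insert (by simp [hne]),
    Finset.sum_singleton, e0, e1, e2, add_assoc]

theorem swap (h : Tri p P0 P1 P2) : Tri p P0 P2 P1 :=
  ⟨h.e0, h.e2, h.e1, h.n02, h.n01, h.n12.symm⟩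

theorem exists_of_ne {d e : V × Fin 3} (h : d.1 = e.1) (hne : d ≠ e) :
    ∃ f, Tri d.1 d e f := by
  obtain ⟨v, i⟩ := d; obtain ⟨w, j⟩ := e
  simp only at h; subst h
  have hij : i ≠ j := fun h => hne (by rw [h])
  obtain ⟨k, hk⟩ : ∃ k : Fin 3, k ≠ i ∧ k ≠ j := by
    clear hne; revert i j; decide
  refine ⟨(v, k), rfl, rfl, rfl, hne, ?_, ?_⟩ <;> simp [hk.1.symm, hk.2.symm]

theorem exists_left (d : V × Fin 3) : ∃ e f, Tri d.1 d e f := by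
  obtain ⟨v, i⟩ := d
  obtain ⟨f, hf⟩ := exists_of_ne (d := (v, i)) (e := (v, i + 1)) rfl (by simp)
  exact ⟨_, f, hf⟩

end Tri

theorem Flags.tri (hB : Flags S ε B) (hp : p ∈ S) (h : Tri p P0 P1 P2) :
    ((B P0 ∧ B P1 ∧ ¬ B P2) ∨ (B P0 ∧ ¬ B P1 ∧ B P2) ∨ (¬ B P0 ∧ B P1 ∧ B P2)) ∨
      (¬ B P0 ∧ ¬ B P1 ∧ ¬ B P2) := by
  have := hB.even p hp
  rw [h.sum_eq (fun d => if B d then (1 : ZMod 2) else 0)] at this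
  by_cases h0 : B P0 <;> by_cases h1 : B P1 <;> by_cases h2 : B P2 <;>
    simp [h0, h1, h2] at this ⊢
  exact absurd this (by decide)

theorem Flags.of_tri (hs : ∀ d, d.1 ∈ S → (B (ε d) ↔ B d))
    (h : ∀ p ∈ S, ∃ P0 P1 P2, Tri p P0 P1 P2 ∧
      ((B P0 ∧ (B P1 ↔ ¬ B P2)) ∨ (¬ B P0 ∧ (B P1 ↔ B P2)))) : Flags S ε B := by
  refine ⟨hs, fun v hv => ?_⟩
  obtain ⟨P0, P1, P2, ht, hP⟩ := h v hv
  rw [ht.sum_eq (fun d => if B d then (1 : ZMod 2) else 0)]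
  by_cases h0 : B P0 <;> by_cases h1 : B P1 <;> by_cases h2 : B P2 <;> simp_all
  all_goals decide

namespace Rev

theorem inj (h : Rev S ε) {d e : V × Fin 3} (hd : d.1 ∈ S) (he : e.1 ∈ S) (hde : ε d = ε e) :
    d = e := by
  rw [← h.invol d hd, hde, h.invol e he]

theorem card_cut_sdiff (h : Rev S ε) (hX : X ⊆ S) :
    (cut ε (S \ X)).card = (cut ε X).card := by
  refine Finset.card_nbij' ε ε ?_ ?_ ?_ ?_
  · intro d hd
    simp only [Finset.mem_coe, mem_cut, Finset.mem_sdiff] at hd ⊢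
    have := h.live d hd.1.1
    rw [h.invol d hd.1.1]
    tauto
  · intro d hd
    simp only [Finset.mem_coe, mem_cut, Finset.mem_sdiff] at hd ⊢
    have := h.live d (hX hd.1)
    rw [h.invol d (hX hd.1)]
    have := hX hd.1
    tauto
  · intro d hd
    simp only [Finset.mem_coe, mem_cut, Finset.mem_sdiff] at hd
    exact h.invol d hd.1.1
  · intro d hd
    simp only [Finset.mem_coe, mem_cut] at hd
    exact h.invol d (hX hd.1)

theorem parity (h : Rev S ε) (hB : Flags S ε B) (hX : X ⊆ S) :
    ∑ d ∈ cut ε X, (if B d then (1 : ZMod 2) else 0) = 0 := by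
  have h1 : ∑ d ∈ X ×ˢ (Finset.univ : Finset (Fin 3)), (if B d then (1 : ZMod 2) else 0) = 0 := by
    rw [Finset.sum_product]
    exact Finset.sum_eq_zero fun v hv => hB.even v (hX hv)
  rw [← Finset.sum_filter_add_sum_filter_not _ (fun d => (ε d).1 ∉ X)] at h1
  have h2 : ∑ d ∈ (X ×ˢ (Finset.univ : Finset (Fin 3))).filter (fun d => ¬ (ε d).1 ∉ X),
      (if B d then (1 : ZMod 2) else 0) = 0 := by
    refine Finset.sum_involution (fun d _ => ε d) ?_ ?_ ?_ ?_
    · intro d hd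
      simp only [Finset.mem_filter, Finset.mem_product] at hd
      simp only [hB.symm d (hX hd.1.1)]
      exact CharTwo.add_self_eq_zero _
    · intro d hd _
      simp only [Finset.mem_filter, Finset.mem_product] at hd
      exact h.ne_self d (hX hd.1.1)
    · intro d hd
      simp only [Finset.mem_filter, Finset.mem_product, Finset.mem_univ, not_not] at hd ⊢
      rw [h.invol d (hX hd.1.1)]; tauto
    · intro d hd
      simp only [Finset.mem_filter, Finset.mem_product] at hd
      exact h.invol d (hX hd.1.1)
  rw [h2, add_zero] at h1
  exact h1

theorem cubic {v : V} (h : Rev S ε)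
    (hY : ∀ Y ⊆ S, v ∉ Y → (cut ε Y).card ≠ 1) : Cubic S ε := by
  refine ⟨h, fun Y hYS => ?_⟩
  by_cases hvY : v ∈ Y
  · rw [← h.card_cut_sdiff hYS]
    exact hY _ Finset.sdiff_subset (by simp [hvY])
  · exact hY Y hYS hvY

end Rev

namespace Cubic

theorem no_loop (h : Cubic S ε) {d : V × Fin 3} (hd : d.1 ∈ S) : (ε d).1 ≠ d.1 := by
  intro hl
  obtain ⟨f, ht⟩ := Tri.exists_of_ne (d := d) (e := ε d) hl.symm (h.ne_self d hd).symm
  have hf : (ε f).1 ≠ d.1 := by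
    intro hf
    have hfS : f.1 ∈ S := ht.e2 ▸ hd
    rcases ht.cases hf with h1 | h1 | h1
    · exact ht.n12 (by rw [← h1, h.invol f hfS])
    · exact ht.n02 (h.inj hfS hd h1).symm
    · exact h.ne_self f hfS h1
  refine h.bridgeless {d.1} (by simpa using hd) ?_
  rw [Finset.card_eq_one]
  refine ⟨f, ?_⟩
  ext e
  simp only [mem_cut, Finset.mem_singleton]
  constructor
  · rintro ⟨h1, h2⟩
    rcases ht.cases h1 with rfl | rfl | rfl
    · exact absurd hl h2
    · rw [h.invol d hd] at h2; exact absurd rfl h2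
    · rfl
  · rintro rfl
    exact ⟨ht.e2, hf⟩

end Cubic

theorem Sol.anti {B' : V × Fin 3 → Prop} (h : Sol X ε B m c)
    (hB : ∀ d, d.1 ∈ X → B' d → B d) : Sol X ε B' m c :=
  fun d hd hd' => ⟨(h d hd hd').1, fun hb => (h d hd hd').2 (hB d hd hb)⟩

theorem Sol.iff (hε : ∀ d, d.1 ∈ X → ε (ε d) = d) (h : Sol X ε B m c) {d : V × Fin 3}
    (hd : d.1 ∈ X) (hd' : (ε d).1 ∈ X) : m d.1 = d.2 ↔ m (ε d).1 = (ε d).2 := by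
  refine ⟨(h d hd hd').1, fun h' => ?_⟩
  have := (h (ε d) hd' (by rw [hε d hd]; exact hd)).1 h'
  rwa [hε d hd] at this

theorem Sol.flip (h : Sol X ε B m c) (k : Bool) : Sol X ε B m (fun v => xor k (c v)) := by
  intro d hd hd'
  refine ⟨(h d hd hd').1, fun hb hm => ?_⟩
  have := (h d hd hd').2 hb hm
  simpa using this

theorem Sol.glue {mA mB : V → Fin 3} {cA cB : V → Bool} (hε : Rev S ε) (hB : Flags S ε B)
    (hA : Sol X ε B mA cA) (hR : Sol (S \ X) ε B mB cB)
    (hcut : ∀ d ∈ cut ε X, (mA d.1 = d.2 ↔ mB (ε d).1 = (ε d).2) ∧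
      (B d → mA d.1 ≠ d.2 → cA d.1 ≠ cB (ε d).1)) :
    Sol S ε B (fun v => if v ∈ X then mA v else mB v) (fun v => if v ∈ X then cA v else cB v) := by
  intro d hd hd'
  by_cases h1 : d.1 ∈ X <;> by_cases h2 : (ε d).1 ∈ X
  · simp only [h1, h2, if_true]; exact hA d h1 h2
  · have := hcut d (mem_cut.2 ⟨h1, h2⟩)
    simp only [h1, h2, if_true, if_false]
    exact ⟨this.1.1, this.2⟩
  · have := hcut (ε d) (mem_cut.2 ⟨h2, by rw [hε.invol d hd]; exact h1⟩)
    rw [hε.invol d hd, hB.symm d hd] at this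
    simp only [h1, h2, if_true, if_false]
    exact ⟨this.1.2, fun hb hm => (this.2 hb (fun h => hm (this.1.1 h))).symm⟩
  · simp only [h1, h2, if_false]
    exact hR d (by simp [hd, h1]) (by simp [hd', h2])

/-- Every marked bridgeless cubic multigraph on fewer than `n` vertices has a solution through
every prescribed dart. -/
def Solvable (V : Type*) (n : ℕ) : Prop :=
  ∀ (S : Finset V) (ε : V × Fin 3 → V × Fin 3) (B : V × Fin 3 → Prop), S.card < n →
    Cubic S ε → Flags S ε B → ∀ a : V × Fin 3, a.1 ∈ S → ∃ m c, Sol S ε B m c ∧ m a.1 = a.2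

theorem Flags.mono (hB : Flags S ε B) (hX : X ⊆ S) : Flags X ε B :=
  ⟨fun d hd => hB.symm d (hX hd), fun v hv => hB.even v (hX hv)⟩

theorem Rev.mem_cut_sdiff (h : Rev S ε) (hX : X ⊆ S) {d : V × Fin 3} :
    d ∈ cut ε (S \ X) ↔ ∃ e ∈ cut ε X, d = ε e := by
  simp only [mem_cut, Finset.mem_sdiff]
  constructor
  · rintro ⟨⟨h1, h2⟩, h3⟩
    have := h.live d h1
    exact ⟨ε d, ⟨by tauto, by rw [h.invol d h1]; exact h2⟩, (h.invol d h1).symm⟩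
  · rintro ⟨e, ⟨h1, h2⟩, rfl⟩
    exact ⟨⟨h.live e (hX h1), h2⟩, by rw [h.invol e (hX h1)]; tauto⟩

section EmptyCut

theorem Cubic.restrict (hC : Cubic S ε) (hX : X ⊆ S) (h0 : cut ε X = ∅) : Cubic X ε where
  live d hd := by
    by_contra h
    have : d ∈ cut ε X := mem_cut.2 ⟨hd, h⟩
    simp [h0] at this
  invol d hd := hC.invol d (hX hd)
  ne_self d hd := hC.ne_self d (hX hd)
  bridgeless Y hY := hC.bridgeless Y (hY.trans hX)

theorem Solvable.empty_cut (hs : Solvable V S.card) (hC : Cubic S ε) (hB : Flags S ε B)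
    (hX : X ⊆ S) (hne : X.Nonempty) (hne' : (S \ X).Nonempty) (h0 : cut ε X = ∅)
    {a : V × Fin 3} (ha : a.1 ∈ S) : ∃ m c, Sol S ε B m c ∧ m a.1 = a.2 := by
  wlog haX : a.1 ∈ X generalizing X
  · refine this (X := S \ X) Finset.sdiff_subset hne' (by rwa [Finset.sdiff_sdiff_eq_self hX]) ?_
      (by simp [ha, haX])
    rw [← Finset.card_eq_zero, hC.card_cut_sdiff hX, h0, Finset.card_empty]
  have h0' : cut ε (S \ X) = ∅ := by
    rw [← Finset.card_eq_zero, hC.card_cut_sdiff hX, h0, Finset.card_empty]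
  obtain ⟨v, hv⟩ := hne'
  have hc : X.card + (S \ X).card = S.card := by
    rw [add_comm]; exact Finset.card_sdiff_add_card_eq_card hX
  have := Finset.card_pos.2 hne
  have := Finset.card_pos.2 ⟨v, hv⟩
  obtain ⟨mA, cA, hA, hma⟩ := hs X ε B (by omega) (hC.restrict hX h0) (hB.mono hX) a haX
  obtain ⟨mB, cB, hR, -⟩ := hs (S \ X) ε B (by omega) (hC.restrict Finset.sdiff_subset h0')
    (hB.mono Finset.sdiff_subset) (v, 0) hv
  exact ⟨_, _, hA.glue hC.toRev hB hR (by simp [h0]), by simp [haX, hma]⟩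

end EmptyCut

section TwoCut

/-- Joins the two ends `d1` and `d2` of a two-edge cut. -/
noncomputable def join (ε : V × Fin 3 → V × Fin 3) (d1 d2 d : V × Fin 3) : V × Fin 3 :=
  if d = d1 then d2 else if d = d2 then d1 else ε d

variable {d1 d2 : V × Fin 3}

theorem Cubic.join (hC : Cubic S ε) (hX : X ⊆ S) (hne : d1 ≠ d2) (hd : cut ε X = {d1, d2}) :
    Cubic X (join ε d1 d2) := by
  have hm : ∀ d, (d.1 ∈ X ∧ (ε d).1 ∉ X) ↔ d = d1 ∨ d = d2 := fun d => by
    rw [← mem_cut, hd]; simp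
  have m1 := (hm d1).2 (Or.inl rfl)
  have m2 := (hm d2).2 (Or.inr rfl)
  have hl := fun d (h : d.1 ∈ X) => hC.live d (hX h)
  have hi := fun d (h : d.1 ∈ X) => hC.invol d (hX h)
  have hn := fun d (h : d.1 ∈ X) => hC.ne_self d (hX h)
  have hr : Rev X (CubicDart.join ε d1 d2) := by
    refine ⟨fun d h => ?_, fun d h => ?_, fun d h => ?_⟩
    · unfold CubicDart.join
      have := hm d
      split_ifs <;> tauto
    · unfold CubicDart.join
      have e1 := hi d h
      have e2 := hm d
      by_cases h1 : d = d1
      · simp [h1]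
      by_cases h2 : d = d2
      · simp [h2]
      have h3 : ε d ≠ d1 := by rintro h3; rw [h3] at e1; rw [← e1] at h; exact m1.2 h
      have h4 : ε d ≠ d2 := by rintro h3; rw [h3] at e1; rw [← e1] at h; exact m2.2 h
      simp [h1, h2, h3, h4, e1]
    · unfold CubicDart.join
      have := hn d h
      split_ifs with h1 h2
      · rw [h1]; exact hne.symm
      · rw [h2]; exact hne
      · exact this
  refine hr.cubic (v := d1.1) fun Y hY h1 => ?_
  have : cut (CubicDart.join ε d1 d2) Y = cut ε Y := by
    ext d
    simp only [mem_cut, CubicDart.join]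
    refine and_congr_right fun hdY => ?_
    by_cases e1 : d = d1
    · rw [e1] at hdY; exact absurd hdY h1
    by_cases e2 : d = d2
    · subst e2
      simp only [e1, if_false, if_true]
      exact iff_of_true h1 (fun h => m2.2 (hY h))
    · simp [e1, e2]
  rw [this]
  exact hC.bridgeless Y (hY.trans hX)

theorem Flags.join (hC : Rev S ε) (hB : Flags S ε B) (hX : X ⊆ S) (hne : d1 ≠ d2)
    (hd : cut ε X = {d1, d2}) : (B d1 ↔ B d2) ∧ Flags X (join ε d1 d2) B := by
  have h12 : B d1 ↔ B d2 := by
    have := hC.parity hB hX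
    rw [hd, Finset.sum_pair hne] at this
    by_cases b1 : B d1 <;> by_cases b2 : B d2 <;> simp_all
  refine ⟨h12, fun d h => ?_, fun v hv => hB.even v (hX hv)⟩
  have := hB.symm d (hX h)
  unfold CubicDart.join
  split_ifs with h1 h2
  · rw [h1, h12]
  · rw [h2, h12]
  · exact this

theorem Sol.of_join (hne : d1 ≠ d2)
    (hd : cut ε X = {d1, d2}) (h : Sol X (join ε d1 d2) B m c) :
    Sol X ε B m c ∧ (m d1.1 = d1.2 ↔ m d2.1 = d2.2) ∧
      (B d1 → m d1.1 ≠ d1.2 → c d1.1 ≠ c d2.1) := by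
  have hm : ∀ d, (d.1 ∈ X ∧ (ε d).1 ∉ X) ↔ d = d1 ∨ d = d2 := fun d => by
    rw [← mem_cut, hd]; simp
  have m1 := (hm d1).2 (Or.inl rfl)
  have m2 := (hm d2).2 (Or.inr rfl)
  refine ⟨fun d h1 h2 => ?_, ?_⟩
  · have h3 : d ≠ d1 := by rintro rfl; exact m1.2 h2
    have h4 : d ≠ d2 := by rintro rfl; exact m2.2 h2
    have := h d h1
    simp only [CubicDart.join, h3, h4, if_false] at this
    exact this h2
  · have e := h d1 m1.1
    simp only [CubicDart.join, if_true] at e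
    have e' := h d2 m2.1
    simp only [CubicDart.join, if_true, hne.symm, if_false] at e'
    exact ⟨⟨(e m2.1).1, (e' m1.1).1⟩, (e m2.1).2⟩

theorem Solvable.two_cut (hs : Solvable V S.card) (hC : Cubic S ε) (hB : Flags S ε B)
    (hX : X ⊆ S) (h2 : (cut ε X).card = 2)
    {a : V × Fin 3} (ha : a.1 ∈ S) : ∃ m c, Sol S ε B m c ∧ m a.1 = a.2 := by
  wlog haX : a.1 ∈ X generalizing X
  · exact this (X := S \ X) Finset.sdiff_subset (by rwa [hC.card_cut_sdiff hX]) (by simp [ha, haX])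
  obtain ⟨d1, d2, hne, hd⟩ := Finset.card_eq_two.1 h2
  have m1 : d1.1 ∈ X ∧ (ε d1).1 ∉ X := mem_cut.1 (by simp [hd])
  have m2 : d2.1 ∈ X ∧ (ε d2).1 ∉ X := mem_cut.1 (by simp [hd])
  have hne' : ε d1 ≠ ε d2 := fun h => hne (hC.inj (hX m1.1) (hX m2.1) h)
  have hd' : cut ε (S \ X) = {ε d1, ε d2} := by
    ext d; rw [hC.mem_cut_sdiff hX, hd]; simp
  have hsd : S \ X ⊆ S := Finset.sdiff_subset
  have hc : X.card + (S \ X).card = S.card := by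
    rw [add_comm]; exact Finset.card_sdiff_add_card_eq_card hX
  have l1 : (ε d1).1 ∈ S \ X := by simp [m1.2, hC.live d1 (hX m1.1)]
  have l2 : (ε d2).1 ∈ S \ X := by simp [m2.2, hC.live d2 (hX m2.1)]
  have := Finset.card_pos.2 ⟨_, m1.1⟩
  have := Finset.card_pos.2 ⟨_, l1⟩
  have hBd := hB.join hC.toRev hX hne hd
  have s1 := hB.symm d1 (hX m1.1)
  have s2 := hB.symm d2 (hX m2.1)
  obtain ⟨mA, cA, hA, hma⟩ := hs X _ B (by omega) (hC.join hX hne hd) hBd.2 a haX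
  obtain ⟨hA, iA, kA⟩ := hA.of_join hne hd
  have key : ∃ mB cB, Sol (S \ X) (join ε (ε d1) (ε d2)) B mB cB ∧
      (mA d1.1 = d1.2 ↔ mB (ε d1).1 = (ε d1).2) := by
    by_cases hJ : mA d1.1 = d1.2
    · obtain ⟨mB, cB, hR, hm⟩ := hs (S \ X) _ B (by omega) (hC.join hsd hne' hd')
        (hB.join hC.toRev hsd hne' hd').2 (ε d1) l1
      exact ⟨mB, cB, hR, by simp [hJ, hm]⟩
    · obtain ⟨e, f, ht⟩ := Tri.exists_left (ε d1)
      obtain ⟨mB, cB, hR, hm⟩ := hs (S \ X) _ B (by omega) (hC.join hsd hne' hd')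
        (hB.join hC.toRev hsd hne' hd').2 e (by rw [ht.e1]; exact l1)
      refine ⟨mB, cB, hR, iff_of_false hJ ?_⟩
      rw [← ht.e1, hm]
      exact ht.idx_ne.1.symm
  obtain ⟨mB, cB, hR, hm⟩ := key
  obtain ⟨hR, iR, kR⟩ := hR.of_join hne' hd'
  refine ⟨_, _, hA.glue hC.toRev hB (hR.flip (!(xor (cA d1.1) (cB (ε d1).1)))) ?_,
    by simp [haX, hma]⟩
  intro d hdc
  rw [hd] at hdc
  simp only [Finset.mem_insert, Finset.mem_singleton] at hdc
  rcases hdc with rfl | rfl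
  · refine ⟨hm, fun _ _ => ?_⟩
    cases cA d.1 <;> cases cB (ε d).1 <;> simp
  · refine ⟨by rw [← iA, hm, iR], fun hb hmd => ?_⟩
    have k1 := kA (hBd.1.2 hb) (by rwa [ne_eq, iA])
    have k2 := kR (by rw [s1, hBd.1]; exact hb) (by rw [ne_eq, ← hm, iA]; exact hmd)
    revert k1 k2
    generalize cA d1.1 = x, cB (ε d1).1 = y, cA d.1 = z, cB (ε d).1 = t
    revert x y z t; decide

end TwoCut

section ThreeCut

variable {z : V} {dd : Fin 3 → V × Fin 3}

/-- Replaces the far side of a three-edge cut with darts `dd` by the single vertex `z`. -/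
noncomputable def con (ε : V × Fin 3 → V × Fin 3) (z : V) (dd : Fin 3 → V × Fin 3)
    (d : V × Fin 3) : V × Fin 3 :=
  if d.1 = z then dd d.2 else if h : ∃ i, d = dd i then (z, h.choose) else ε d

/-- The marks induced on the contracted graph. -/
def conMark (B : V × Fin 3 → Prop) (z : V) (dd : Fin 3 → V × Fin 3) (d : V × Fin 3) : Prop :=
  if d.1 = z then B (dd d.2) else B d

theorem con_z (i : Fin 3) : con ε z dd (z, i) = dd i := by simp [con]

theorem con_dd (hinj : Function.Injective dd) (i : Fin 3) (hz : (dd i).1 ≠ z) :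
    con ε z dd (dd i) = (z, i) := by
  have h : ∃ j, dd i = dd j := ⟨i, rfl⟩
  simp only [con, hz, if_false, dif_pos h, Prod.mk.injEq, true_and]
  exact (hinj h.choose_spec).symm

theorem con_other {d : V × Fin 3} (hz : d.1 ≠ z) (h : ∀ i, d ≠ dd i) : con ε z dd d = ε d := by
  simp [con, hz, h]

theorem Cubic.con (hC : Cubic S ε) (hX : X ⊆ S) (hz : z ∉ X) (hinj : Function.Injective dd)
    (hdd : ∀ d, d ∈ cut ε X ↔ ∃ i, d = dd i) : Cubic (insert z X) (con ε z dd) := by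
  have m1 : ∀ i, (dd i).1 ∈ X ∧ (ε (dd i)).1 ∉ X := fun i => mem_cut.1 ((hdd _).2 ⟨i, rfl⟩)
  have hzd : ∀ d : V × Fin 3, d.1 ∈ X → d.1 ≠ z := fun d h e => hz (e ▸ h)
  have hcut : ∀ d : V × Fin 3, d.1 ∈ X → (∀ i, d ≠ dd i) → (ε d).1 ∈ X := fun d h hi => by
    by_contra h'
    obtain ⟨i, h⟩ := (hdd d).1 (mem_cut.2 ⟨h, h'⟩)
    exact hi i h
  have cases : ∀ d : V × Fin 3, d.1 ∈ insert z X →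
      (∃ i, d = (z, i)) ∨ (∃ i, d = dd i) ∨ (d.1 ∈ X ∧ ∀ i, d ≠ dd i) := by
    intro d hd
    by_cases h1 : d.1 = z
    · exact Or.inl ⟨d.2, Prod.ext h1 rfl⟩
    · by_cases h2 : ∃ i, d = dd i
      · exact Or.inr (Or.inl h2)
      · push Not at h2
        exact Or.inr (Or.inr ⟨(Finset.mem_insert.1 hd).resolve_left h1, h2⟩)
  have hr : Rev (insert z X) (CubicDart.con ε z dd) := by
    refine ⟨fun d h => ?_, fun d h => ?_, fun d h => ?_⟩
    · rcases cases d h with ⟨i, rfl⟩ | ⟨i, rfl⟩ | ⟨h1, h2⟩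
      · rw [con_z]; exact Finset.mem_insert_of_mem (m1 i).1
      · rw [con_dd hinj i (hzd _ (m1 i).1)]; exact Finset.mem_insert_self _ _
      · rw [con_other (hzd d h1) h2]; exact Finset.mem_insert_of_mem (hcut d h1 h2)
    · rcases cases d h with ⟨i, rfl⟩ | ⟨i, rfl⟩ | ⟨h1, h2⟩
      · rw [con_z, con_dd hinj i (hzd _ (m1 i).1)]
      · rw [con_dd hinj i (hzd _ (m1 i).1), con_z]
      · rw [con_other (hzd d h1) h2, con_other (hzd _ (hcut d h1 h2)), hC.invol d (hX h1)]
        intro i hi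
        apply (m1 i).2
        rw [← hi, hC.invol d (hX h1)]; exact h1
    · rcases cases d h with ⟨i, rfl⟩ | ⟨i, rfl⟩ | ⟨h1, h2⟩
      · rw [con_z]; exact fun e => hzd _ (m1 i).1 (by rw [e])
      · rw [con_dd hinj i (hzd _ (m1 i).1)]; exact fun e => hzd _ (m1 i).1 (by rw [← e])
      · rw [con_other (hzd d h1) h2]; exact hC.ne_self d (hX h1)
  refine hr.cubic (v := z) fun Y hY h1 => ?_
  have hYX : Y ⊆ X := fun v hv => (Finset.mem_insert.1 (hY hv)).resolve_left
    (fun e => h1 (e ▸ hv))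
  have : cut (CubicDart.con ε z dd) Y = cut ε Y := by
    ext d
    simp only [mem_cut]
    refine and_congr_right fun hdY => ?_
    by_cases h2 : ∃ i, d = dd i
    · obtain ⟨i, rfl⟩ := h2
      rw [con_dd hinj i (hzd _ (m1 i).1)]
      exact iff_of_true h1 (fun h => (m1 i).2 (hYX h))
    · push Not at h2
      rw [con_other (hzd d (hYX hdY)) h2]
  rw [this]
  exact hC.bridgeless Y (hYX.trans hX)

theorem sum_cut (hinj : Function.Injective dd) (hdd : ∀ d, d ∈ cut ε X ↔ ∃ i, d = dd i)
    {M : Type*} [AddCommMonoid M] (f : V × Fin 3 → M) :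
    ∑ d ∈ cut ε X, f d = ∑ i, f (dd i) := by
  rw [← Finset.sum_image (s := Finset.univ) (g := dd) (fun _ _ _ _ h => hinj h)]
  congr 1
  ext d
  simp [hdd, eq_comm]

theorem Flags.con (hC : Rev S ε) (hB : Flags S ε B) (hX : X ⊆ S) (hz : z ∉ X)
    (hinj : Function.Injective dd) (hdd : ∀ d, d ∈ cut ε X ↔ ∃ i, d = dd i) :
    Flags (insert z X) (con ε z dd) (conMark B z dd) := by
  have m1 : ∀ i, (dd i).1 ∈ X ∧ (ε (dd i)).1 ∉ X := fun i => mem_cut.1 ((hdd _).2 ⟨i, rfl⟩)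
  have hzd : ∀ d : V × Fin 3, d.1 ∈ X → d.1 ≠ z := fun d h e => hz (e ▸ h)
  refine ⟨fun d hd => ?_, fun v hv => ?_⟩
  · by_cases h1 : d.1 = z
    · obtain ⟨v, i⟩ := d
      simp only at h1; subst h1
      rw [con_z]
      simp [conMark, hzd _ (m1 i).1]
    · have hdX := (Finset.mem_insert.1 hd).resolve_left h1
      by_cases h2 : ∃ i, d = dd i
      · obtain ⟨i, rfl⟩ := h2
        rw [con_dd hinj i h1]
        simp [conMark, h1]
      · push Not at h2
        rw [con_other h1 h2]
        have : (ε d).1 ∈ X := by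
          by_contra h'
          obtain ⟨i, h⟩ := (hdd d).1 (mem_cut.2 ⟨hdX, h'⟩)
          exact h2 i h
        simp [conMark, h1, hzd _ this, hB.symm d (hX hdX)]
  · by_cases h1 : v = z
    · subst h1
      simp only [conMark, if_true]
      rw [← sum_cut hinj hdd (fun d => if B d then (1 : ZMod 2) else 0)]
      exact hC.parity hB hX
    · have hvX := (Finset.mem_insert.1 hv).resolve_left h1
      simp only [conMark, h1, if_false]
      exact hB.even v (hX hvX)

/-- A solution on one side `X` of a three-edge cut using the cut edge `k`, to be completed by a
solution in which the far side of the cut behaves like a vertex of colour `col`. -/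
structure Side (ε : V × Fin 3 → V × Fin 3) (B : V × Fin 3 → Prop) (X : Finset V)
    (dd : Fin 3 → V × Fin 3) (m : V → Fin 3) (c : V → Bool) (k : Fin 3) (col : Bool) : Prop where
  sol : Sol X ε B m c
  used : ∀ i, m (dd i).1 = (dd i).2 ↔ k = i
  proper : ∀ i, B (dd i) → k ≠ i → c (dd i).1 ≠ col

theorem Sol.side (hz : z ∉ X) (hinj : Function.Injective dd)
    (hdd : ∀ d, d ∈ cut ε X ↔ ∃ i, d = dd i)
    (h : Sol (insert z X) (CubicDart.con ε z dd) (conMark B z dd) m c) :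
    Side ε B X dd m c (m z) (c z) := by
  have m1 : ∀ i, (dd i).1 ∈ X ∧ (ε (dd i)).1 ∉ X := fun i => mem_cut.1 ((hdd _).2 ⟨i, rfl⟩)
  have hzd : ∀ d : V × Fin 3, d.1 ∈ X → d.1 ≠ z := fun d h e => hz (e ▸ h)
  have hza : ∀ i, _ := fun i => h (z, i) (Finset.mem_insert_self _ _)
    (by rw [con_z]; exact Finset.mem_insert_of_mem (m1 i).1)
  have hzb : ∀ i, _ := fun i => h (dd i) (Finset.mem_insert_of_mem (m1 i).1)
    (by rw [con_dd hinj i (hzd _ (m1 i).1)]; exact Finset.mem_insert_self _ _)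
  simp only [con_z, conMark, if_true] at hza
  refine ⟨fun d hd hd' => ?_, fun i => ⟨fun hi => ?_, (hza i).1⟩, fun i hb hk => ?_⟩
  · have h2 : ∀ i, d ≠ dd i := by rintro i rfl; exact (m1 i).2 hd'
    have := h d (Finset.mem_insert_of_mem hd)
      (by rw [con_other (hzd d hd) h2]; exact Finset.mem_insert_of_mem hd')
    rw [con_other (hzd d hd) h2] at this
    simpa [conMark, hzd d hd] using this
  · have := (hzb i).1 hi
    rwa [con_dd hinj i (hzd _ (m1 i).1)] at this
  · exact ((hza i).2 hb hk).symm

variable {n : ℕ}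

theorem Solvable.side_of_dart (hs : Solvable V n) (hC : Cubic S ε) (hB : Flags S ε B) (hX : X ⊆ S)
    (hn : X.card + 1 < n) (hz : z ∉ X) (hinj : Function.Injective dd)
    (hdd : ∀ d, d ∈ cut ε X ↔ ∃ i, d = dd i) {a : V × Fin 3} (ha : a.1 ∈ X) :
    ∃ m c k col, Side ε B X dd m c k col ∧ m a.1 = a.2 := by
  obtain ⟨m, c, h, hm⟩ := hs (insert z X) _ _ (by rwa [Finset.card_insert_of_notMem hz])
    (hC.con hX hz hinj hdd) (hB.con hC.toRev hX hz hinj hdd) a (Finset.mem_insert_of_mem ha)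
  exact ⟨m, c, _, _, h.side hz hinj hdd, hm⟩

theorem Solvable.side_of_index (hs : Solvable V n) (hC : Cubic S ε) (hB : Flags S ε B)
    (hX : X ⊆ S) (hn : X.card + 1 < n) (hz : z ∉ X) (hinj : Function.Injective dd)
    (hdd : ∀ d, d ∈ cut ε X ↔ ∃ i, d = dd i) (k : Fin 3) (col : Bool) :
    ∃ m c, Side ε B X dd m c k col := by
  obtain ⟨m, c, h, hm⟩ := hs (insert z X) _ _ (by rwa [Finset.card_insert_of_notMem hz])
    (hC.con hX hz hinj hdd) (hB.con hC.toRev hX hz hinj hdd) (z, k) (Finset.mem_insert_self _ _)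
  have := h.side hz hinj hdd
  simp only at hm
  refine ⟨m, fun v => xor (xor col (c z)) (c v), this.sol.flip _, fun i => ?_, fun i hb hk => ?_⟩
  · rw [this.used, hm]
  · have := this.proper i hb (by rwa [hm])
    revert this
    generalize c (dd i).1 = x, c z = y
    revert x y col; decide

theorem exists_dd (h : (cut ε X).card = 3) : ∃ dd : Fin 3 → V × Fin 3,
    Function.Injective dd ∧ ∀ d, d ∈ cut ε X ↔ ∃ i, d = dd i := by
  let e := (Finset.equivFinOfCardEq h).symm
  refine ⟨fun i => (e i).1, fun i j hij => e.injective (Subtype.ext hij), fun d => ?_⟩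
  constructor
  · intro hd
    exact ⟨e.symm ⟨d, hd⟩, by simp⟩
  · rintro ⟨i, rfl⟩
    exact (e i).2

theorem dd_sdiff (hC : Rev S ε) (hX : X ⊆ S) (hinj : Function.Injective dd)
    (hdd : ∀ d, d ∈ cut ε X ↔ ∃ i, d = dd i) :
    Function.Injective (fun i => ε (dd i)) ∧
      ∀ d, d ∈ cut ε (S \ X) ↔ ∃ i, d = ε (dd i) := by
  refine ⟨fun i j hij => hinj (hC.inj ?_ ?_ hij), fun d => ?_⟩
  · exact hX (mem_cut.1 ((hdd _).2 ⟨i, rfl⟩)).1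
  · exact hX (mem_cut.1 ((hdd _).2 ⟨j, rfl⟩)).1
  · rw [hC.mem_cut_sdiff hX]
    constructor
    · rintro ⟨e, he, rfl⟩
      obtain ⟨i, rfl⟩ := (hdd e).1 he
      exact ⟨i, rfl⟩
    · rintro ⟨i, rfl⟩
      exact ⟨dd i, (hdd _).2 ⟨i, rfl⟩, rfl⟩

theorem Solvable.three_cut (hs : Solvable V S.card) (hC : Cubic S ε) (hB : Flags S ε B)
    (hX : X ⊆ S) (h2 : (cut ε X).card = 3) (hc1 : 2 ≤ X.card) (hc2 : 2 ≤ (S \ X).card)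
    {a : V × Fin 3} (ha : a.1 ∈ S) : ∃ m c, Sol S ε B m c ∧ m a.1 = a.2 := by
  wlog haX : a.1 ∈ X generalizing X
  · exact this (X := S \ X) Finset.sdiff_subset (by rwa [hC.card_cut_sdiff hX]) hc2
      (by rwa [Finset.sdiff_sdiff_eq_self hX]) (by simp [ha, haX])
  have hc : X.card + (S \ X).card = S.card := by
    rw [add_comm]; exact Finset.card_sdiff_add_card_eq_card hX
  obtain ⟨dd, hinj, hdd⟩ := exists_dd h2
  obtain ⟨hinj', hdd'⟩ := dd_sdiff hC.toRev hX hinj hdd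
  obtain ⟨z, hz⟩ := Finset.card_pos.1 (show 0 < (S \ X).card by omega)
  obtain ⟨z', hz'⟩ := Finset.card_pos.1 (show 0 < X.card by omega)
  obtain ⟨mA, cA, k, col, hA, hma⟩ := hs.side_of_dart hC hB hX (by omega)
    (Finset.mem_sdiff.1 hz).2 hinj hdd haX
  obtain ⟨mB, cB, hR⟩ := hs.side_of_index (z := z') hC hB (Finset.sdiff_subset (s := S) (t := X))
    (by omega) (by simp [hz']) hinj' hdd' k (!col)
  refine ⟨_, _, hA.sol.glue hC.toRev hB hR.sol ?_, by simp [haX, hma]⟩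
  intro d hd
  obtain ⟨i, rfl⟩ := (hdd d).1 hd
  refine ⟨(hA.used i).trans (hR.used i).symm, fun hb hk => ?_⟩
  have hk' : k ≠ i := fun h => hk ((hA.used i).2 h)
  have h1 := hA.proper i hb hk'
  have h2 := hR.proper i ((hB.symm _ (hX (mem_cut.1 hd).1)).2 hb) hk'
  revert h1 h2
  generalize cA (dd i).1 = x, cB (ε (dd i)).1 = y
  cases x <;> cases y <;> cases col <;> simp

end ThreeCut

/-- The properties of a graph in which no reduction along a small cut applies. -/
structure Irred (S : Finset V) (ε : V × Fin 3 → V × Fin 3) : Prop extends Cubic S ε where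
  three_le : ∀ X ⊆ S, X.Nonempty → (S \ X).Nonempty → 3 ≤ (cut ε X).card
  three : ∀ X ⊆ S, (cut ε X).card = 3 → X.card ≤ 1 ∨ (S \ X).card ≤ 1

theorem Solvable.of_irred (hs : Solvable V S.card) (hC : Cubic S ε) (hB : Flags S ε B)
    {a : V × Fin 3} (ha : a.1 ∈ S)
    (h : Irred S ε → ∃ m c, Sol S ε B m c ∧ m a.1 = a.2) :
    ∃ m c, Sol S ε B m c ∧ m a.1 = a.2 := by
  by_contra hcon
  refine hcon (h ⟨hC, fun X hX h1 h2 => ?_, fun X hX h3 => ?_⟩)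
  · by_contra hlt
    have := hC.bridgeless X hX
    have h02 : (cut ε X).card = 0 ∨ (cut ε X).card = 2 := by omega
    rcases h02 with h0 | h0
    · exact hcon (hs.empty_cut hC hB hX h1 h2 (Finset.card_eq_zero.1 h0) ha)
    · exact hcon (hs.two_cut hC hB hX h0 ha)
  · by_contra hlt
    exact hcon (hs.three_cut hC hB hX h3 (by omega) (by omega) ha)

/-- The darts at the two ends `p` and `q` of an edge which is to be deleted, paired for the
suppression of `p` and `q`. -/
structure Frink (S : Finset V) (ε : V × Fin 3 → V × Fin 3) (p q : V)
    (P0 P1 P2 Q0 Q1 Q2 : V × Fin 3) : Prop where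
  tp : Tri p P0 P1 P2
  tq : Tri q Q0 Q1 Q2
  e0 : ε P0 = Q0
  pS : p ∈ S
  h12 : ε P1 ≠ Q2
  h21 : ε P2 ≠ Q1

/-- The dart reversal after deleting an edge and joining the remaining darts in pairs. -/
noncomputable def fr (ε : V × Fin 3 → V × Fin 3) (P1 P2 Q1 Q2 d : V × Fin 3) : V × Fin 3 :=
  if ε d = P1 then ε Q1 else if ε d = Q1 then ε P1 else
    if ε d = P2 then ε Q2 else if ε d = Q2 then ε P2 else ε d

/-- The darts leaving `X`, apart from those ending in `K`. -/
noncomputable def base (ε : V × Fin 3 → V × Fin 3) (X K : Finset V) : Finset (V × Fin 3) :=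
  (X ×ˢ Finset.univ).filter (fun d => (ε d).1 ∉ X ∧ (ε d).1 ∉ K)

theorem mem_base {K : Finset V} {d : V × Fin 3} :
    d ∈ base ε X K ↔ d.1 ∈ X ∧ (ε d).1 ∉ X ∧ (ε d).1 ∉ K := by
  simp [base, Finset.mem_product]

namespace Frink

variable {q : V} {Q0 Q1 Q2 : V × Fin 3}

theorem qS (F : Frink S ε p q P0 P1 P2 Q0 Q1 Q2) (hC : Cubic S ε) : q ∈ S := by
  have := hC.live P0 (by rw [F.tp.e0]; exact F.pS)
  rwa [F.e0, F.tq.e0] at this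

theorem ne (F : Frink S ε p q P0 P1 P2 Q0 Q1 Q2) (hC : Cubic S ε) : q ≠ p := by
  have := hC.no_loop (d := P0) (by rw [F.tp.e0]; exact F.pS)
  rwa [F.e0, F.tq.e0, F.tp.e0] at this

theorem live_iff (F : Frink S ε p q P0 P1 P2 Q0 Q1 Q2) (d : V × Fin 3) :
    d.1 ∈ S \ {p, q} ↔ d.1 ∈ S ∧ d ≠ P0 ∧ d ≠ P1 ∧ d ≠ P2 ∧ d ≠ Q0 ∧ d ≠ Q1 ∧ d ≠ Q2 := by
  have h1 : d.1 = p ↔ d = P0 ∨ d = P1 ∨ d = P2 := ⟨F.tp.cases, by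
    rintro (rfl | rfl | rfl)
    exacts [F.tp.e0, F.tp.e1, F.tp.e2]⟩
  have h2 : d.1 = q ↔ d = Q0 ∨ d = Q1 ∨ d = Q2 := ⟨F.tq.cases, by
    rintro (rfl | rfl | rfl)
    exacts [F.tq.e0, F.tq.e1, F.tq.e2]⟩
  simp only [Finset.mem_sdiff, Finset.mem_insert, Finset.mem_singleton, h1, h2]
  tauto

theorem facts (F : Frink S ε p q P0 P1 P2 Q0 Q1 Q2) (hC : Cubic S ε) :
    (ε Q0 = P0 ∧ ε (ε P1) = P1 ∧ ε (ε P2) = P2 ∧ ε (ε Q1) = Q1 ∧ ε (ε Q2) = Q2) ∧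
    (P0.1 ∈ S ∧ P1.1 ∈ S ∧ P2.1 ∈ S ∧ Q0.1 ∈ S ∧ Q1.1 ∈ S ∧ Q2.1 ∈ S) ∧
    ((ε P1).1 ∈ S ∧ (ε P2).1 ∈ S ∧ (ε Q1).1 ∈ S ∧ (ε Q2).1 ∈ S) ∧
    ((ε P1).1 ≠ P1.1 ∧ (ε P2).1 ≠ P2.1 ∧ (ε Q1).1 ≠ Q1.1 ∧ (ε Q2).1 ≠ Q2.1) := by
  have p0 : P0.1 ∈ S := by rw [F.tp.e0]; exact F.pS
  have p1 : P1.1 ∈ S := by rw [F.tp.e1]; exact F.pS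
  have p2 : P2.1 ∈ S := by rw [F.tp.e2]; exact F.pS
  have q0 : Q0.1 ∈ S := by rw [F.tq.e0]; exact F.qS hC
  have q1 : Q1.1 ∈ S := by rw [F.tq.e1]; exact F.qS hC
  have q2 : Q2.1 ∈ S := by rw [F.tq.e2]; exact F.qS hC
  exact ⟨⟨by rw [← F.e0, hC.invol _ p0], hC.invol _ p1, hC.invol _ p2, hC.invol _ q1,
    hC.invol _ q2⟩, ⟨p0, p1, p2, q0, q1, q2⟩,
    ⟨hC.live _ p1, hC.live _ p2, hC.live _ q1, hC.live _ q2⟩,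
    ⟨hC.no_loop p1, hC.no_loop p2, hC.no_loop q1, hC.no_loop q2⟩⟩

theorem rev (F : Frink S ε p q P0 P1 P2 Q0 Q1 Q2) (hC : Cubic S ε) :
    Rev (S \ {p, q}) (fr ε P1 P2 Q1 Q2) := by
  have lv := F.live_iff
  have hne := F.ne hC
  obtain ⟨⟨i0, i1, i2, j1, j2⟩, ⟨p0, p1, p2, q0, q1, q2⟩, ⟨s1, s2, t1, t2⟩, k1, k2, l1, l2⟩ :=
    F.facts hC
  have hi := hC.invol
  have hlv := hC.live
  obtain ⟨a0, a1, a2, a3, a4, a5⟩ := F.tp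
  obtain ⟨b0, b1, b2, b3, b4, b5⟩ := F.tq
  have e0 := F.e0
  have := F.h12
  have := F.h21
  refine ⟨fun d h => ?_, fun d h => ?_, fun d h => ?_⟩
  · rw [lv] at h ⊢
    have hid := hi d h.1
    have hld := hlv d h.1
    unfold fr
    split_ifs <;> grind
  · rw [lv] at h
    have hid := hi d h.1
    unfold fr
    split_ifs <;> grind
  · rw [lv] at h
    have hid := hi d h.1
    have := hC.ne_self d h.1
    unfold fr
    split_ifs <;> grind

/-- The four edges around the deleted one contribute to a cut avoiding `p` and `q`. -/
theorem card_cut (F : Frink S ε p q P0 P1 P2 Q0 Q1 Q2) (hC : Cubic S ε) (hX : X ⊆ S \ {p, q}) :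
    (cut ε X).card = (base ε X {p, q}).card + ((if (ε P1).1 ∈ X then 1 else 0) +
      ((if (ε P2).1 ∈ X then 1 else 0) + ((if (ε Q1).1 ∈ X then 1 else 0) +
        (if (ε Q2).1 ∈ X then 1 else 0)))) ∧
    (cut (fr ε P1 P2 Q1 Q2) X).card = (base ε X {p, q}).card +
      ((if (ε P1).1 ∈ X ∧ (ε Q1).1 ∉ X then 1 else 0) +
      ((if (ε P2).1 ∈ X ∧ (ε Q2).1 ∉ X then 1 else 0) +
      ((if (ε Q1).1 ∈ X ∧ (ε P1).1 ∉ X then 1 else 0) +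
        (if (ε Q2).1 ∈ X ∧ (ε P2).1 ∉ X then 1 else 0)))) := by
  have lv := fun (d : V × Fin 3) (h : d.1 ∈ X) => (F.live_iff d).1 (hX h)
  have hne := F.ne hC
  obtain ⟨⟨i0, i1, i2, j1, j2⟩, ⟨p0, p1, p2, q0, q1, q2⟩, ⟨s1, s2, t1, t2⟩, k1, k2, l1, l2⟩ :=
    F.facts hC
  have e0 := F.e0
  have hp : ∀ d : V × Fin 3, d.1 = p ↔ d = P0 ∨ d = P1 ∨ d = P2 := fun d => ⟨F.tp.cases, by
    rintro (rfl | rfl | rfl)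
    exacts [F.tp.e0, F.tp.e1, F.tp.e2]⟩
  have hq : ∀ d : V × Fin 3, d.1 = q ↔ d = Q0 ∨ d = Q1 ∨ d = Q2 := fun d => ⟨F.tq.cases, by
    rintro (rfl | rfl | rfl)
    exacts [F.tq.e0, F.tq.e1, F.tq.e2]⟩
  have hi := hC.invol
  have hpX : p ∉ X := fun h => by simpa using hX h
  have hqX : q ∉ X := fun h => by simpa using hX h
  obtain ⟨a0, a1, a2, a3, a4, a5⟩ := F.tp
  obtain ⟨b0, b1, b2, b3, b4, b5⟩ := F.tq
  have hcard : ∀ (P : V × Fin 3 → Prop) [DecidablePred P],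
      (({ε P1, ε P2, ε Q1, ε Q2} : Finset (V × Fin 3)).filter P).card =
        (if P (ε P1) then 1 else 0) + ((if P (ε P2) then 1 else 0) +
          ((if P (ε Q1) then 1 else 0) + (if P (ε Q2) then 1 else 0))) := fun P _ => by
    rw [Finset.card_filter, Finset.sum_insert, Finset.sum_insert, Finset.sum_insert,
      Finset.sum_singleton]
    all_goals simp only [Finset.mem_insert, Finset.mem_singleton]
    all_goals grind
  have f1 : fr ε P1 P2 Q1 Q2 (ε P1) = ε Q1 := by unfold fr; grind
  have f2 : fr ε P1 P2 Q1 Q2 (ε P2) = ε Q2 := by unfold fr; grind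
  have f3 : fr ε P1 P2 Q1 Q2 (ε Q1) = ε P1 := by unfold fr; grind
  have f4 : fr ε P1 P2 Q1 Q2 (ε Q2) = ε P2 := by unfold fr; grind
  have c1 : cut ε X = base ε X {p, q} ∪
      ({ε P1, ε P2, ε Q1, ε Q2} : Finset (V × Fin 3)).filter (fun d => d.1 ∈ X) := by
    ext d
    simp only [mem_cut, mem_base, Finset.mem_union, Finset.mem_filter, Finset.mem_insert,
      Finset.mem_singleton, hp, hq]
    have h1 := lv d
    have h2 := hi d
    have h3 := hp (ε d)
    have h4 := hq (ε d)
    grind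
  have c2 : cut (fr ε P1 P2 Q1 Q2) X = base ε X {p, q} ∪
      ({ε P1, ε P2, ε Q1, ε Q2} : Finset (V × Fin 3)).filter
        (fun d => d.1 ∈ X ∧ (fr ε P1 P2 Q1 Q2 d).1 ∉ X) := by
    ext d
    simp only [mem_cut, mem_base, Finset.mem_union, Finset.mem_filter, Finset.mem_insert,
      Finset.mem_singleton, hp, hq]
    by_cases hd : d.1 ∈ X
    · have h1 := lv d hd
      have h2 := hi d h1.1
      by_cases hd4 : d = ε P1 ∨ d = ε P2 ∨ d = ε Q1 ∨ d = ε Q2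
      · grind
      · have : fr ε P1 P2 Q1 Q2 d = ε d := by unfold fr; grind
        rw [this]
        grind
    · simp [hd]
  constructor
  · rw [c1, Finset.card_union_of_disjoint, hcard]
    rw [Finset.disjoint_left]
    intro d
    simp only [mem_base, Finset.mem_filter, Finset.mem_insert, Finset.mem_singleton]
    grind
  · rw [c2, Finset.card_union_of_disjoint, hcard]
    · simp only [f1, f2, f3, f4]
    rw [Finset.disjoint_left]
    intro d
    simp only [mem_base, Finset.mem_filter, Finset.mem_insert, Finset.mem_singleton]
    grind

theorem _root_.CubicDart.Rev.card_base_sdiff (hC : Rev S ε) {K : Finset V} (hX : X ⊆ S \ K) :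
    (base ε ((S \ K) \ X) K).card = (base ε X K).card := by
  have hXS : ∀ v ∈ X, v ∈ S ∧ v ∉ K := fun v hv => by simpa using hX hv
  refine Finset.card_nbij' ε ε ?_ ?_ ?_ ?_
  · intro d hd
    simp only [Finset.mem_coe, mem_base, Finset.mem_sdiff] at hd ⊢
    have := hC.live d hd.1.1.1
    rw [hC.invol d hd.1.1.1]
    tauto
  · intro d hd
    simp only [Finset.mem_coe, mem_base, Finset.mem_sdiff] at hd ⊢
    have h1 := hXS _ hd.1
    have := hC.live d h1.1
    rw [hC.invol d h1.1]
    tauto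
  · intro d hd
    simp only [Finset.mem_coe, mem_base, Finset.mem_sdiff] at hd
    exact hC.invol d hd.1.1.1
  · intro d hd
    simp only [Finset.mem_coe, mem_base] at hd
    exact hC.invol d (hXS _ hd.1).1

theorem symm (F : Frink S ε p q P0 P1 P2 Q0 Q1 Q2) (hC : Cubic S ε) :
    Frink S ε q p Q0 Q1 Q2 P0 P1 P2 := by
  obtain ⟨⟨i0, i1, i2, j1, j2⟩, -⟩ := F.facts hC
  exact ⟨F.tq, F.tp, i0, F.qS hC, fun h => F.h21 (by rw [← h, j1]),
    fun h => F.h12 (by rw [← h, j2])⟩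

theorem swap (F : Frink S ε p q P0 P1 P2 Q0 Q1 Q2) : Frink S ε p q P0 P2 P1 Q0 Q2 Q1 :=
  ⟨F.tp.swap, F.tq.swap, F.e0, F.pS, F.h21, F.h12⟩

theorem deg (F : Frink S ε p q P0 P1 P2 Q0 Q1 Q2) (hC : Cubic S ε) :
    (ε P1).1 = q ↔ ε P1 = Q1 := by
  obtain ⟨⟨i0, i1, i2, j1, j2⟩, -⟩ := F.facts hC
  refine ⟨fun h => ?_, fun h => by rw [h, F.tq.e1]⟩
  rcases F.tq.cases h with h | h | h
  · exact absurd (by rw [← i0, ← h, i1]) F.tp.n01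
  · exact h
  · exact absurd h F.h12

theorem deg_iff (F : Frink S ε p q P0 P1 P2 Q0 Q1 Q2) (hC : Cubic S ε) :
    (ε P1).1 = q ↔ (ε Q1).1 = p := by
  obtain ⟨⟨i0, i1, i2, j1, j2⟩, -⟩ := F.facts hC
  rw [F.deg hC, (F.symm hC).deg hC]
  exact ⟨fun h => by rw [← h, i1], fun h => by rw [← h, j1]⟩

/-- If the reduced graph has a bridge, then that bridge separates the two joined pairs. -/
theorem bridging (F : Frink S ε p q P0 P1 P2 Q0 Q1 Q2) (hC : Cubic S ε)
    (h : ¬ Cubic (S \ {p, q}) (fr ε P1 P2 Q1 Q2)) :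
    ∃ X ⊆ S \ {p, q}, (base ε X {p, q}).card = 1 ∧ (cut ε X).card = 3 ∧
      (cut ε ((S \ {p, q}) \ X)).card = 3 ∧ (ε P1).1 ∈ X ∧ (ε Q1).1 ∈ X ∧
      (ε P2).1 ∈ (S \ {p, q}) \ X ∧ (ε Q2).1 ∈ (S \ {p, q}) \ X := by
  have hr := F.rev hC
  obtain ⟨X, hX, h1⟩ : ∃ X ⊆ S \ {p, q}, (cut (fr ε P1 P2 Q1 Q2) X).card = 1 := by
    by_contra hcon
    push Not at hcon
    exact h ⟨hr, hcon⟩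
  have hXS : X ⊆ S := hX.trans Finset.sdiff_subset
  have hYS : (S \ {p, q}) \ X ⊆ S := Finset.sdiff_subset.trans Finset.sdiff_subset
  have hx := hC.bridgeless X hXS
  have hy := hC.bridgeless _ hYS
  have hb := hC.card_base_sdiff hX
  obtain ⟨x1, x2⟩ := F.card_cut hC hX
  obtain ⟨y1, -⟩ := F.card_cut hC (X := (S \ {p, q}) \ X) Finset.sdiff_subset
  obtain ⟨-, -, ⟨s1, s2, t1, t2⟩, k1, k2, l1, l2⟩ := F.facts hC
  have key : ((ε P1).1 ∈ X ∧ (ε Q1).1 ∈ X ∧ (ε P2).1 ∈ (S \ {p, q}) \ X ∧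
      (ε Q2).1 ∈ (S \ {p, q}) \ X ∨ (ε P1).1 ∈ (S \ {p, q}) \ X ∧ (ε Q1).1 ∈ (S \ {p, q}) \ X ∧
      (ε P2).1 ∈ X ∧ (ε Q2).1 ∈ X) ∧ (base ε X {p, q}).card = 1 := by
    have hpX : p ∉ X := fun h => by simpa using hX h
    have hqX : q ∉ X := fun h => by simpa using hX h
    rw [F.tp.e1] at k1
    rw [F.tp.e2] at k2
    rw [F.tq.e1] at l1
    rw [F.tq.e2] at l2
    have deg1 : (ε P1).1 = q ↔ (ε Q1).1 = p := F.deg_iff hC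
    have deg2 : (ε P2).1 = q ↔ (ε Q2).1 = p := F.swap.deg_iff hC
    have r1 : (ε Q1).1 = p → (ε Q1).1 ∉ X ∧ (ε P1).1 ∉ X := fun e => ⟨e ▸ hpX, deg1.2 e ▸ hqX⟩
    have r2 : (ε Q2).1 = p → (ε Q2).1 ∉ X ∧ (ε P2).1 ∉ X := fun e => ⟨e ▸ hpX, deg2.2 e ▸ hqX⟩
    have m1 : (ε P1).1 ∈ (S \ {p, q}) \ X ↔ (ε Q1).1 ≠ p ∧ (ε P1).1 ∉ X := by
      simp [s1, k1, deg1]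
    have m2 : (ε P2).1 ∈ (S \ {p, q}) \ X ↔ (ε Q2).1 ≠ p ∧ (ε P2).1 ∉ X := by
      simp [s2, k2, deg2]
    have m3 : (ε Q1).1 ∈ (S \ {p, q}) \ X ↔ (ε Q1).1 ≠ p ∧ (ε Q1).1 ∉ X := by
      simp [t1, l1]
    have m4 : (ε Q2).1 ∈ (S \ {p, q}) \ X ↔ (ε Q2).1 ≠ p ∧ (ε Q2).1 ∉ X := by
      simp [t2, l2]
    rw [h1] at x2
    rw [y1, hb] at hy
    rw [x1] at hx
    simp only [m1, m2, m3, m4] at hy ⊢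
    clear x1 y1 hb m1 m2 m3 m4 h1 h deg1 deg2 hqX hX hXS hYS
    generalize (base ε X {p, q}).card = n at *
    by_cases d1 : (ε Q1).1 = p <;> by_cases d2 : (ε Q2).1 = p <;>
      by_cases u1 : (ε P1).1 ∈ X <;> by_cases u2 : (ε P2).1 ∈ X <;>
      by_cases v1 : (ε Q1).1 ∈ X <;> by_cases v2 : (ε Q2).1 ∈ X <;>
      simp [d1, d2, u1, u2, v1, v2, hpX] at hx hy x2 r1 r2 ⊢ <;> omega
  obtain ⟨key, hb1⟩ := key
  have hc3 : (cut ε X).card = 3 ∧ (cut ε ((S \ {p, q}) \ X)).card = 3 := by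
    rw [x1, y1, hb, hb1]
    rcases key with ⟨u1, u2, u3, u4⟩ | ⟨u1, u2, u3, u4⟩ <;> simp only [u1, u2, u3, u4, if_true]
    · have v3 := (Finset.mem_sdiff.1 u3).2
      have v4 := (Finset.mem_sdiff.1 u4).2
      simp [u1, u2, v3, v4]
    · have v1 := (Finset.mem_sdiff.1 u1).2
      have v2 := (Finset.mem_sdiff.1 u2).2
      simp [u3, u4, v1, v2]
  rcases key with key | key
  · exact ⟨X, hX, hb1, hc3.1, hc3.2, key⟩
  · refine ⟨_, Finset.sdiff_subset, hb.trans hb1, hc3.2, ?_, key.1, key.2.1, ?_⟩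
    · rw [Finset.sdiff_sdiff_eq_self hX]; exact hc3.1
    · rw [Finset.sdiff_sdiff_eq_self hX]; exact key.2.2

theorem flags (F : Frink S ε p q P0 P1 P2 Q0 Q1 Q2) (hC : Cubic S ε) (hB : Flags S ε B)
    (h1 : B P1 ↔ B Q1) (h2 : B P2 ↔ B Q2) : Flags (S \ {p, q}) (fr ε P1 P2 Q1 Q2) B := by
  refine ⟨fun d hd => ?_, fun v hv => hB.even v (Finset.mem_sdiff.1 hv).1⟩
  have hdS := (Finset.mem_sdiff.1 hd).1
  obtain ⟨-, ⟨-, p1, p2, -, q1, q2⟩, -⟩ := F.facts hC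
  have := hB.symm d hdS
  have b1 := hB.symm _ p1
  have b2 := hB.symm _ p2
  have b3 := hB.symm _ q1
  have b4 := hB.symm _ q2
  unfold fr
  split_ifs with g1 g2 g3 g4
  · rw [b3, ← h1, ← this, g1]
  · rw [b1, h1, ← this, g2]
  · rw [b4, ← h2, ← this, g3]
  · rw [b2, h2, ← this, g4]
  · exact this

theorem lift (F : Frink S ε p q P0 P1 P2 Q0 Q1 Q2) (hC : Cubic S ε) (hB : Flags S ε B)
    (h : Sol (S \ {p, q}) (fr ε P1 P2 Q1 Q2) B m c)
    (hm : (ε P1).1 = q ∨ m (ε P1).1 ≠ (ε P1).2) (h1 : B P1 ↔ B Q1) (h2 : B P2 ↔ B Q2)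
    (h0 : B P0 ∨ (¬ B P1 ∧ ¬ B P2)) :
    ∃ m' c', Sol S ε B m' c' ∧ (∀ v, v ≠ p → v ≠ q → m' v = m v) ∧
      ((m' p = P0.2 ∧ m' q = Q0.2) ∨ ((ε P2).1 ≠ q ∧ m' p = P2.2 ∧ m' q = Q2.2)) := by
  have hne := F.ne hC
  have lv := F.live_iff
  obtain ⟨⟨i0, i1, i2, j1, j2⟩, ⟨p0, p1, p2, q0, q1, q2⟩, ⟨s1, s2, t1, t2⟩, k1, k2, l1, l2⟩ :=
    F.facts hC
  have e0 := F.e0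
  have b0 := hB.symm _ p0
  have b1 := hB.symm _ p1
  have b2 := hB.symm _ p2
  have b3 := hB.symm _ q1
  have b4 := hB.symm _ q2
  have hno : ¬ (B P1 ∧ B P2) := by
    have := hB.tri F.pS F.tp
    clear * - this h0
    tauto
  have nP := F.tp.idx_ne
  have nQ := F.tq.idx_ne
  let M2 : Prop := (ε P2).1 ≠ q ∧ m (ε P2).1 = (ε P2).2
  let z := if B P1 then (ε P1).1 else (ε P2).1
  let m' : V → Fin 3 := fun v => if v = p then (if M2 then P2.2 else P0.2) else
    if v = q then (if M2 then Q2.2 else Q0.2) else m v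
  let c' : V → Bool := fun v => if v = p then !(c z) else if v = q then c z else c v
  have hmo : ∀ v, v ≠ p → v ≠ q → m' v = m v := fun v hp hq => by simp [m', hp, hq]
  have hco : ∀ v, v ≠ p → v ≠ q → c' v = c v := fun v hp hq => by simp [c', hp, hq]
  have hmp : m' p = if M2 then P2.2 else P0.2 := by simp [m']
  have hmq : m' q = if M2 then Q2.2 else Q0.2 := by simp [m', hne]
  have hcp : c' p = !(c z) := by simp [c']
  have hcq : c' q = c z := by simp [c', hne]
  let E : V × Fin 3 → Prop := fun d => (m' d.1 = d.2 ↔ m' (ε d).1 = (ε d).2) ∧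
    (B d → m' d.1 ≠ d.2 → c' d.1 ≠ c' (ε d).1)
  have Esymm : ∀ d, d.1 ∈ S → E (ε d) → E d := by
    intro d hd hE
    simp only [E, hC.invol d hd, hB.symm d hd] at hE ⊢
    grind
  suffices hE : ∀ d, d.1 ∈ S → E d from
    ⟨m', c', fun d hd _ => ⟨(hE d hd).1.1, (hE d hd).2⟩, hmo, by
      rw [hmp, hmq]
      by_cases hM : M2
      · exact Or.inr ⟨hM.1, if_pos hM, if_pos hM⟩
      · exact Or.inl ⟨if_neg hM, if_neg hM⟩⟩
  have hpq : ∀ v, v ∈ S \ {p, q} ↔ v ∈ S ∧ v ≠ p ∧ v ≠ q := fun v => by simp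
  have deg1 := F.deg hC
  have deg2 := F.swap.deg hC
  have deg3 := (F.symm hC).deg hC
  have deg4 := (F.symm hC).swap.deg hC
  have a0 := F.tp.e0
  have a1 := F.tp.e1
  have a2 := F.tp.e2
  have c0 := F.tq.e0
  have c1 := F.tq.e1
  have c2 := F.tq.e2
  have f1 : fr ε P1 P2 Q1 Q2 (ε P1) = ε Q1 := by simp [fr, i1]
  have f2 : fr ε P1 P2 Q1 Q2 (ε P2) = ε Q2 := by
    have n1 : P2 ≠ P1 := F.tp.n12.symm
    have n2 : P2 ≠ Q1 := fun e => hne (by rw [← c1, ← e, a2])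
    simp [fr, i2, n1, n2]
  have g1 := F.deg_iff hC
  have g2 := F.swap.deg_iff hC
  have hs1 : (ε P1).1 ≠ q → _ := fun e => h (ε P1)
    (by rw [hpq]; exact ⟨s1, a1 ▸ k1, e⟩)
    (by rw [f1, hpq]; exact ⟨t1, fun e' => e (g1.2 e'), c1 ▸ l1⟩)
  have hs2 : (ε P2).1 ≠ q → _ := fun e => h (ε P2)
    (by rw [hpq]; exact ⟨s2, a2 ▸ k2, e⟩)
    (by rw [f2, hpq]; exact ⟨t2, fun e' => e (g2.2 e'), c2 ▸ l2⟩)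
  rw [f1] at hs1
  rw [f2] at hs2
  have E0 : E P0 := by
    simp only [E]
    rw [e0, a0, c0, hmp, hmq, hcp, hcq]
    by_cases hM : M2 <;> simp [hM, nP.2.1.symm, nQ.2.1.symm]
  have ho1 : (ε P1).1 ≠ q → (m' (ε P1).1 = m (ε P1).1 ∧ c' (ε P1).1 = c (ε P1).1) ∧
      (m' (ε Q1).1 = m (ε Q1).1 ∧ c' (ε Q1).1 = c (ε Q1).1) := fun e =>
    ⟨⟨hmo _ (a1 ▸ k1) e, hco _ (a1 ▸ k1) e⟩, hmo _ (fun h => e (g1.2 h)) (c1 ▸ l1),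
      hco _ (fun h => e (g1.2 h)) (c1 ▸ l1)⟩
  have ho2 : (ε P2).1 ≠ q → (m' (ε P2).1 = m (ε P2).1 ∧ c' (ε P2).1 = c (ε P2).1) ∧
      (m' (ε Q2).1 = m (ε Q2).1 ∧ c' (ε Q2).1 = c (ε Q2).1) := fun e =>
    ⟨⟨hmo _ (a2 ▸ k2) e, hco _ (a2 ▸ k2) e⟩, hmo _ (fun h => e (g2.2 h)) (c2 ▸ l2),
      hco _ (fun h => e (g2.2 h)) (c2 ▸ l2)⟩
  have hit1 : (ε P1).1 ≠ q → (m (ε P1).1 = (ε P1).2 ↔ m (ε Q1).1 = (ε Q1).2) := fun e => by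
    have := h.iff (d := ε P1) (F.rev hC).invol
      (by rw [hpq]; exact ⟨s1, a1 ▸ k1, e⟩)
      (by rw [f1, hpq]; exact ⟨t1, fun e' => e (g1.2 e'), c1 ▸ l1⟩)
    rwa [f1] at this
  have hit2 : (ε P2).1 ≠ q → (m (ε P2).1 = (ε P2).2 ↔ m (ε Q2).1 = (ε Q2).2) := fun e => by
    have := h.iff (d := ε P2) (F.rev hC).invol
      (by rw [hpq]; exact ⟨s2, a2 ▸ k2, e⟩)
      (by rw [f2, hpq]; exact ⟨t2, fun e' => e (g2.2 e'), c2 ▸ l2⟩)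
    rwa [f2] at this
  have hz1 : B P1 → z = (ε P1).1 := fun hb => if_pos hb
  have hz2 : B P2 → z = (ε P2).1 := fun hb => if_neg (fun hb1 => hno ⟨hb1, hb⟩)
  have hp1 : m' p ≠ P1.2 := by
    rw [hmp]; split_ifs
    exacts [nP.2.2.symm, nP.1]
  have hq1 : m' q ≠ Q1.2 := by
    rw [hmq]; split_ifs
    exacts [nQ.2.2.symm, nQ.1]
  have hp2 : m' p = P2.2 ↔ M2 := by
    rw [hmp]; split_ifs with hM <;> simp [hM, nP.2.1]
  have hq2 : m' q = Q2.2 ↔ M2 := by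
    rw [hmq]; split_ifs with hM <;> simp [hM, nQ.2.1]
  have hM2 : (ε P2).1 ≠ q → (M2 ↔ m (ε P2).1 = (ε P2).2) := fun e => by simp [M2, e]
  have hM2' : (ε P2).1 = q → ¬ M2 := fun e => by simp [M2, e]
  clear_value m' c' z
  have E1 : E P1 := by
    simp only [E, a1]
    by_cases hq : (ε P1).1 = q
    · rw [deg1.1 hq, c1, hcp, hcq]
      simp [hp1, hq1]
    · have hm := hm.resolve_left hq
      rw [(ho1 hq).1.1, (ho1 hq).1.2, hcp]
      refine ⟨by simp [hp1, hm], fun hb _ => ?_⟩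
      rw [hz1 hb]; simp
  have F1 : E Q1 := by
    simp only [E, c1]
    by_cases hq : (ε P1).1 = q
    · rw [deg3.1 (g1.1 hq), a1, hcp, hcq]
      simp [hp1, hq1]
    · have hm := hm.resolve_left hq
      rw [(ho1 hq).2.1, (ho1 hq).2.2, hcq]
      refine ⟨by simp [hq1, ← hit1 hq, hm], fun hb _ => ?_⟩
      rw [hz1 (h1.2 hb)]
      exact (hs1 hq).2 (b1.2 (h1.2 hb)) hm
  have E2 : E P2 := by
    simp only [E, a2]
    by_cases hq : (ε P2).1 = q
    · rw [deg2.1 hq, c2, hcp, hcq]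
      simp [hp2, hq2]
    · rw [(ho2 hq).1.1, (ho2 hq).1.2, hcp]
      refine ⟨by rw [hp2, hM2 hq], fun hb _ => ?_⟩
      rw [hz2 hb]; simp
  have F2 : E Q2 := by
    simp only [E, c2]
    by_cases hq : (ε P2).1 = q
    · rw [deg4.1 (g2.1 hq), a2, hcp, hcq]
      simp [hp2, hq2]
    · rw [(ho2 hq).2.1, (ho2 hq).2.2, hcq]
      refine ⟨by rw [hq2, hM2 hq, hit2 hq], fun hb hn => ?_⟩
      rw [hz2 (h2.2 hb)]
      exact (hs2 hq).2 (b2.2 (h2.2 hb)) (fun h => hn (hq2.2 ((hM2 hq).2 h)))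
  intro d hd
  have F0 : E Q0 := Esymm _ q0 (by rwa [i0])
  by_cases hl : d.1 ∈ S \ {p, q}
  · by_cases he : (ε d).1 ∈ S \ {p, q}
    · have hfr : fr ε P1 P2 Q1 Q2 d = ε d := by
        have := (lv (ε d)).1 he
        simp [fr, this]
      have hh := h d hl (by rwa [hfr])
      have hi := h.iff (F.rev hC).invol hl (by rwa [hfr])
      rw [hfr] at hh hi
      rw [hpq] at hl he
      simp only [E]
      rw [hmo _ hl.2.1 hl.2.2, hmo _ he.2.1 he.2.2, hco _ hl.2.1 hl.2.2, hco _ he.2.1 he.2.2]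
      exact ⟨hi, hh.2⟩
    · apply Esymm d hd
      have := hC.live d hd
      simp only [lv, this, true_and, not_and_or, not_not, ne_eq] at he
      rcases he with he | he | he | he | he | he <;> rw [he]
      exacts [E0, E1, E2, F0, F1, F2]
  · simp only [lv, hd, true_and, not_and_or, not_not, ne_eq] at hl
    rcases hl with rfl | rfl | rfl | rfl | rfl | rfl
    exacts [E0, E1, E2, F0, F1, F2]

end Frink

theorem Irred.simple (hI : Irred S ε) (hS : 2 < S.card) {d e : V × Fin 3} (hd : d.1 ∈ S)
    (he : d.1 = e.1) (hde : (ε d).1 = (ε e).1) : d = e := by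
  by_contra hne
  have heS : e.1 ∈ S := he ▸ hd
  obtain ⟨f, hf⟩ := Tri.exists_of_ne he hne
  obtain ⟨g, hg⟩ := Tri.exists_of_ne hde (fun h => hne (hI.inj hd heS h))
  have hX : ({d.1, (ε d).1} : Finset V) ⊆ S := by
    intro v; simp only [Finset.mem_insert, Finset.mem_singleton]
    rintro (rfl | rfl)
    exacts [hd, hI.live d hd]
  have hcut : cut ε {d.1, (ε d).1} ⊆ {f, g} := by
    intro x hx
    simp only [mem_cut, Finset.mem_insert, Finset.mem_singleton] at hx ⊢
    obtain ⟨hx1 | hx1, hx2⟩ := hx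
    · rcases hf.cases hx1 with rfl | rfl | rfl
      · simp at hx2
      · rw [hde] at hx2; simp at hx2
      · simp
    · rcases hg.cases hx1 with rfl | rfl | rfl
      · rw [hI.invol d hd] at hx2; simp at hx2
      · rw [hI.invol e heS] at hx2; simp [he] at hx2
      · simp
  have h3 := hI.three_le _ hX ⟨d.1, by simp⟩ (by
    rw [← Finset.card_pos, Finset.card_sdiff_of_subset hX]
    have := Finset.card_le_two (a := d.1) (b := (ε d).1)
    omega)
  have h4 := Finset.card_le_card hcut
  have h5 := Finset.card_le_two (a := f) (b := g)
  omega

theorem Frink.cubic_or_card {q : V} {Q0 Q1 Q2 : V × Fin 3}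
    (F : Frink S ε p q P0 P1 P2 Q0 Q1 Q2) (hI : Irred S ε) :
    Cubic (S \ {p, q}) (fr ε P1 P2 Q1 Q2) ∨ S.card = 4 := by
  by_contra! hcon
  obtain ⟨X, hX, -, h1, h2, h3, -, h4, -⟩ := F.bridging hI.toCubic hcon.1
  refine hcon.2 ?_
  have hne := F.ne hI.toCubic
  have hsub : ({p, q} : Finset V) ⊆ S := by
    intro v; simp only [Finset.mem_insert, Finset.mem_singleton]
    rintro (rfl | rfl)
    exacts [F.pS, F.qS hI.toCubic]
  have hpq : ({p, q} : Finset V).card = 2 := Finset.card_pair hne.symm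
  have hbig : ∀ Y ⊆ S \ {p, q}, Y.Nonempty → (cut ε Y).card = 3 → Y.card = 1 := by
    intro Y hY hYn hY3
    have hYS : Y ⊆ S := hY.trans Finset.sdiff_subset
    have := Finset.card_pos.2 hYn
    rcases hI.three Y hYS hY3 with h | h
    · omega
    · have : ({p, q} : Finset V) ⊆ S \ Y := fun v hv =>
        Finset.mem_sdiff.2 ⟨hsub hv, fun h => (Finset.mem_sdiff.1 (hY h)).2 hv⟩
      have := Finset.card_le_card this
      omega
  have e1 := hbig X hX ⟨_, h3⟩ h1
  have e2 := hbig _ Finset.sdiff_subset ⟨_, h4⟩ h2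
  have e3 := Finset.card_sdiff_add_card_eq_card hX
  have e4 := Finset.card_sdiff_add_card_eq_card hsub
  omega

theorem Cubic.solve_two (hC : Cubic S ε) (hS : S.card = 2) {a : V × Fin 3} (ha : a.1 ∈ S) :
    ∃ m c, Sol S ε B m c ∧ m a.1 = a.2 := by
  have hne := hC.no_loop ha
  have hmem : ∀ v ∈ S, v = a.1 ∨ v = (ε a).1 := by
    have : ({a.1, (ε a).1} : Finset V) = S := by
      apply Finset.eq_of_subset_of_card_le
      · intro v; simp only [Finset.mem_insert, Finset.mem_singleton]
        rintro (rfl | rfl)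
        exacts [ha, hC.live a ha]
      · rw [hS, Finset.card_pair hne.symm]
    intro v hv
    rw [← this] at hv
    simpa using hv
  refine ⟨fun v => if v = a.1 then a.2 else (ε a).2, fun v => decide (v = a.1), ?_, by simp⟩
  intro d hd hd'
  have hl := hC.no_loop hd
  rcases hmem _ hd with h1 | h1
  · have h2 : (ε d).1 ≠ a.1 := h1 ▸ hl
    simp only [h1, h2, if_true, if_false]
    refine ⟨fun h => ?_, by simp⟩
    have : d = a := Prod.ext h1 h.symm
    rw [this]
  · have h2 : (ε d).1 = a.1 := (hmem _ hd').resolve_right (fun h => hl (h.trans h1.symm))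
    simp only [h1, h2, if_true, hne, if_false]
    refine ⟨fun h => ?_, by simp⟩
    have : d = ε a := Prod.ext h1 h.symm
    rw [this, hC.invol a ha]

theorem Irred.solve_four (hI : Irred S ε) (hS : S.card = 4) {a : V × Fin 3} (ha : a.1 ∈ S) :
    ∃ m c, Sol S ε B m c ∧ m a.1 = a.2 := by
  have hsim := fun {d e : V × Fin 3} => hI.simple (d := d) (e := e) (by omega)
  obtain ⟨u, v, ht⟩ := Tri.exists_left a
  have huS : u.1 ∈ S := by rw [ht.e1]; exact ha
  have hvS : v.1 ∈ S := by rw [ht.e2]; exact ha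
  have hla := hI.live a ha
  have hlu := hI.live u huS
  have hlv := hI.live v hvS
  have n1 := hI.no_loop ha
  have n2 := hI.no_loop huS
  have n3 := hI.no_loop hvS
  rw [ht.e1] at n2
  rw [ht.e2] at n3
  have n4 : (ε a).1 ≠ (ε u).1 := fun h => ht.n01 (hsim ha ht.e1.symm h)
  have n5 : (ε a).1 ≠ (ε v).1 := fun h => ht.n02 (hsim ha ht.e2.symm h)
  have n6 : (ε u).1 ≠ (ε v).1 := fun h => ht.n12 (hsim huS (ht.e1.trans ht.e2.symm) h)
  generalize hw' : (ε a).1 = w', hb : (ε u).1 = b, hc : (ε v).1 = c' at *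
  generalize hw : a.1 = w at *
  have hSeq : S = {w, w', b, c'} := by
    symm
    apply Finset.eq_of_subset_of_card_le
    · intro x; simp only [Finset.mem_insert, Finset.mem_singleton]
      rintro (rfl | rfl | rfl | rfl) <;> assumption
    · rw [hS, Finset.card_insert_of_notMem, Finset.card_insert_of_notMem, Finset.card_pair n6] <;>
        simp [*, n1.symm, n2.symm, n3.symm]
  have hmem : ∀ x, x ∈ S ↔ x = w ∨ x = w' ∨ x = b ∨ x = c' := by simp [hSeq]
  let g : V → V := fun x => if x = w then w' else if x = w' then w else if x = b then c' else b
  have hg : ∀ x ∈ S, g x ∈ S ∧ g x ≠ x ∧ g (g x) = x := by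
    intro x hx
    simp only [g]
    grind
  have hex : ∀ x ∈ S, ∀ y ∈ S, y ≠ x → ∃ i, (ε (x, i)).1 = y := by
    intro x hx y hy hyx
    have himg : (Finset.univ : Finset (Fin 3)).image (fun i => (ε (x, i)).1) = S.erase x := by
      apply Finset.eq_of_subset_of_card_le
      · intro z hz
        obtain ⟨i, -, rfl⟩ := Finset.mem_image.1 hz
        exact Finset.mem_erase.2 ⟨hI.no_loop (d := (x, i)) hx, hI.live (x, i) hx⟩
      · rw [Finset.card_erase_of_mem hx, hS, Finset.card_image_of_injective]
        · simp
        · intro i j hij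
          exact congrArg Prod.snd (hsim (d := (x, i)) (e := (x, j)) hx rfl hij)
    have : y ∈ S.erase x := Finset.mem_erase.2 ⟨hyx, hy⟩
    rw [← himg] at this
    obtain ⟨i, -, hi⟩ := Finset.mem_image.1 this
    exact ⟨i, hi⟩
  have hm : ∀ x, ∃ i, x ∈ S → (ε (x, i)).1 = g x := fun x => by
    by_cases hx : x ∈ S
    · obtain ⟨i, hi⟩ := hex x hx (g x) (hg x hx).1 (hg x hx).2.1
      exact ⟨i, fun _ => hi⟩
    · exact ⟨0, fun h => absurd h hx⟩
  choose m hm using hm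
  have hmd : ∀ d : V × Fin 3, d.1 ∈ S → (m d.1 = d.2 ↔ (ε d).1 = g d.1) := by
    intro d hd
    constructor
    · intro h
      rw [← hm d.1 hd, h]
    · intro h
      exact congrArg Prod.snd (hsim (d := (d.1, m d.1)) (e := d) hd rfl ((hm d.1 hd).trans h.symm))
  refine ⟨m, fun x => decide (x = w ∨ x = w'), fun d hd hd' => ⟨fun h => ?_, fun _ h => ?_⟩, ?_⟩
  · rw [hmd d hd] at h
    rw [hmd _ hd', hI.invol d hd, h, (hg _ hd).2.2]
  · rw [ne_eq, hmd d hd] at h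
    have h1 := hI.no_loop hd
    rw [hmem] at hd hd'
    simp only [g] at h
    generalize d.1 = x, (ε d).1 = y at *
    have : (x = w ∨ x = w') ↔ ¬ (y = w ∨ y = w') := by grind
    simp only [this, ne_eq, decide_eq_decide]
    tauto
  · have := (hmd a (by rw [hw]; exact ha)).2 (by rw [hw']; simp [g, hw])
    rwa [hw] at this

/-- Prescribing `a` is possible if some edge at distance one from the end of `a` lies in a marked
circuit or avoids all of them. -/
theorem Solvable.of_edge (hs : Solvable V S.card) (hI : Irred S ε) (hB : Flags S ε B)
    (h2 : 2 < S.card) (h4 : S.card ≠ 4) {a u e : V × Fin 3} (ha : a.1 ∈ S) (hu : u.1 = a.1)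
    (hua : u ≠ a) (he : e.1 = (ε u).1) (heu : e ≠ ε u)
    (hc : B e ∨ ∀ d : V × Fin 3, d.1 = (ε u).1 ∨ d.1 = (ε e).1 → ¬ B d) :
    ∃ m c, Sol S ε B m c ∧ m a.1 = a.2 := by
  have huS : u.1 ∈ S := hu ▸ ha
  have huL := hI.live u huS
  have heS : e.1 ∈ S := he ▸ huL
  have heL := hI.live e heS
  have hui := hI.invol u huS
  obtain ⟨f, hf⟩ := Tri.exists_of_ne he heu
  have hwy : (ε e).1 ≠ u.1 := fun h => heu (hI.simple h2 heS he (by rw [hui, h]))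
  obtain ⟨g1, g2, hg, b1, b2, b0⟩ : ∃ g1 g2, Tri (ε e).1 (ε e) g1 g2 ∧ (B (ε u) ↔ B g1) ∧
      (B f ↔ B g2) ∧ (B e ∨ (¬ B (ε u) ∧ ¬ B f)) := by
    obtain ⟨g1, g2, hg⟩ := Tri.exists_left (ε e)
    rcases hc with hc | hc
    · have t1 := hB.tri heS hf
      have t2 := hB.tri heL hg
      have := hB.symm e heS
      by_cases h : B (ε u) ↔ B g1
      · exact ⟨g1, g2, hg, by tauto⟩
      · exact ⟨g2, g1, hg.swap, by tauto⟩
    · refine ⟨g1, g2, hg, ?_⟩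
      have n1 := hc (ε u) (Or.inl rfl)
      have n2 := hc f (Or.inl (hf.e2.trans he))
      have n3 := hc g1 (Or.inr hg.e1)
      have n4 := hc g2 (Or.inr hg.e2)
      tauto
  have F : Frink S ε e.1 (ε e).1 e (ε u) f (ε e) g1 g2 := by
    refine ⟨hf, hg, rfl, heS, fun h => ?_, fun h => ?_⟩
    · rw [hui] at h
      exact hwy (by rw [h, hg.e2])
    · have := hI.simple h2 (d := f) (e := e) (by rw [hf.e2]; exact heS) hf.e2 (by rw [h, hg.e1])
      exact hf.n02 this.symm
  have hC' := (F.cubic_or_card hI).resolve_right h4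
  have haS : a.1 ∈ S \ {e.1, (ε e).1} := by
    have := hI.no_loop huS
    simp only [Finset.mem_sdiff, Finset.mem_insert, Finset.mem_singleton, not_or]
    rw [← hu]
    exact ⟨huS, by rw [he]; exact this.symm, hwy.symm⟩
  have hcard : (S \ {e.1, (ε e).1}).card < S.card :=
    Finset.card_lt_card ⟨Finset.sdiff_subset, fun h => by simpa using h heS⟩
  obtain ⟨m, c, hm, hma⟩ := hs _ _ B hcard hC' (F.flags hI.toCubic hB b1 b2) a haS
  obtain ⟨m', c', h', ho, -⟩ := F.lift hI.toCubic hB hm (Or.inr (by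
    rw [hui, hu, hma]
    exact fun h => hua (Prod.ext hu h.symm))) b1 b2 b0
  refine ⟨m', c', h', ?_⟩
  simp only [Finset.mem_sdiff, Finset.mem_insert, Finset.mem_singleton, not_or] at haS
  rw [ho _ haS.2.1 haS.2.2, hma]

/-- A circuit of length `n` of marked edges: it passes from its `i`-th vertex to the next one along
the dart `R i`, whose reverse is `L (i + 1)`. -/
structure Circ (S : Finset V) (ε : V × Fin 3 → V × Fin 3) (B : V × Fin 3 → Prop)
    (R L : ℕ → V × Fin 3) (n : ℕ) : Prop where
  pos : 0 < n
  live : ∀ i, (R i).1 ∈ S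
  vertex : ∀ i, (L i).1 = (R i).1
  ne : ∀ i, L i ≠ R i
  step : ∀ i, ε (R i) = L (i + 1)
  markR : ∀ i, B (R i)
  markL : ∀ i, B (L i)
  per : ∀ i, R (i + n) = R i
  inj : ∀ i j, (R i).1 = (R j).1 → i ≡ j [MOD n]

theorem Flags.exists_other (hB : Flags S ε B) {d : V × Fin 3} (hd : d.1 ∈ S) (h : B d) :
    ∃ e : V × Fin 3, e.1 = d.1 ∧ e ≠ d ∧ B e := by
  obtain ⟨e, f, ht⟩ := Tri.exists_left d
  have := hB.tri hd ht
  by_cases he : B e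
  · exact ⟨e, ht.e1, ht.n01.symm, he⟩
  · exact ⟨f, ht.e2, ht.n02.symm, by tauto⟩

theorem Flags.other_unique (hB : Flags S ε B) {d e f : V × Fin 3} (hd : d.1 ∈ S) (h : B d)
    (he : e.1 = d.1) (hf : f.1 = d.1) (hed : e ≠ d) (hfd : f ≠ d) (hbe : B e) (hbf : B f) :
    e = f := by
  obtain ⟨g, ht⟩ := Tri.exists_of_ne he.symm hed.symm
  have := hB.tri hd ht
  rcases ht.cases hf with rfl | rfl | rfl
  · exact absurd rfl hfd
  · rfl
  · tauto

theorem Flags.exists_circ (hC : Rev S ε) (hB : Flags S ε B) {d : V × Fin 3} (hd : d.1 ∈ S)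
    (h : B d) : ∃ R L n, Circ S ε B R L n ∧ R 0 = d := by
  let T := {x : V × Fin 3 // x ∈ (S ×ˢ (Finset.univ : Finset (Fin 3))).filter B}
  have hT : ∀ x : V × Fin 3, x ∈ (S ×ˢ (Finset.univ : Finset (Fin 3))).filter B ↔
      x.1 ∈ S ∧ B x := by simp
  have tl : ∀ x : T, x.1.1 ∈ S := fun x => ((hT _).1 x.2).1
  have tb : ∀ x : T, B x.1 := fun x => ((hT _).1 x.2).2
  have h1 : ∀ x : T, ∃ y : T, y.1.1 = x.1.1 ∧ y ≠ x := fun x => by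
    obtain ⟨e, he, hne, hb⟩ := hB.exists_other (tl x) (tb x)
    exact ⟨⟨e, (hT _).2 ⟨he ▸ tl x, hb⟩⟩, he, fun h => hne (congrArg Subtype.val h)⟩
  choose τ τ1 τ2 using h1
  have uniq : ∀ x y z : T, y.1.1 = x.1.1 → z.1.1 = x.1.1 → y ≠ x → z ≠ x → y = z :=
    fun x y z hy hz hyx hzx => Subtype.ext (hB.other_unique (tl x) (tb x) hy hz
      (fun h => hyx (Subtype.ext h)) (fun h => hzx (Subtype.ext h)) (tb y) (tb z))
  have τi : ∀ x, τ (τ x) = x := fun x => uniq (τ x) _ _ (τ1 _) (τ1 x).symm (τ2 _) (τ2 x).symm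
  let η : T → T := fun x => ⟨ε x.1, (hT _).2 ⟨hC.live _ (tl x), (hB.symm _ (tl x)).2 (tb x)⟩⟩
  have ηi : ∀ x, η (η x) = x := fun x => Subtype.ext (hC.invol _ (tl x))
  have ηn : ∀ x, η x ≠ x := fun x h => hC.ne_self _ (tl x) (congrArg Subtype.val h)
  let φ : T → T := fun x => τ (η x)
  have φinj : Function.Injective φ := fun x y hxy => by
    have := congrArg τ hxy
    simp only [φ, τi] at this
    rw [← ηi x, this, ηi]
  let d0 : T := ⟨d, (hT _).2 ⟨hd, h⟩⟩
  have hper : d0 ∈ Function.periodicPts φ := by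
    obtain ⟨i, j, hij, he⟩ := Finite.exists_ne_map_eq_of_infinite (fun n => φ^[n] d0)
    wlog hlt : i < j generalizing i j
    · exact this j i hij.symm he.symm (by omega)
    · exact Function.mk_mem_periodicPts (n := j - i) (by omega)
        (Function.iterate_cancel φinj he.symm)
  have step : ∀ i, η (φ^[i] d0) = τ (φ^[i + 1] d0) := fun i => by
    rw [Function.iterate_succ_apply']; exact (τi _).symm
  have swap : ∀ i j, φ^[i] d0 = τ (φ^[j] d0) → φ^[j] d0 = τ (φ^[i] d0) := fun i j e => by
    rw [e, τi]
  have shift : ∀ i j, φ^[i] d0 = τ (φ^[j + 1] d0) → φ^[i + 1] d0 = τ (φ^[j] d0) := fun i j e => by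
    rw [← step] at e
    rw [Function.iterate_succ_apply', e]
    simp only [φ, ηi]
  have key : ∀ k i, φ^[i] d0 ≠ τ (φ^[i + k] d0) := fun k => by
    induction k using Nat.strong_induction_on with
    | _ k ih =>
      intro i e
      match k with
      | 0 => exact τ2 _ e.symm
      | 1 => exact ηn _ ((step i).trans e.symm)
      | k + 2 =>
        refine ih k (by omega) (i + 1) ?_
        have := shift i (i + (k + 1)) e
        rwa [show i + (k + 1) = i + 1 + k by omega] at this
  refine ⟨fun i => (φ^[i] d0).1, fun i => (τ (φ^[i] d0)).1, Function.minimalPeriod φ d0,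
    ⟨Function.minimalPeriod_pos_of_mem_periodicPts hper, fun i => tl _, fun i => τ1 _,
      fun i e => τ2 _ (Subtype.ext e), fun i => congrArg Subtype.val (step i), fun i => tb _,
      fun i => tb _, fun i => ?_, fun i j hij => ?_⟩, rfl⟩
  · show (φ^[i + Function.minimalPeriod φ d0] d0).1 = _
    rw [Function.iterate_add_minimalPeriod_eq]
  · have hn := Function.minimalPeriod_pos_of_mem_periodicPts hper
    have heq : φ^[i] d0 = φ^[j] d0 := by
      by_contra hne
      have h1 : φ^[i] d0 = τ (φ^[j] d0) := uniq _ _ _ hij (τ1 _) hne (τ2 _)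
      rcases le_total i j with hle | hle
      · exact key (j - i) i (by rwa [Nat.add_sub_cancel' hle])
      · exact key (i - j) j (by rw [Nat.add_sub_cancel' hle]; exact swap _ _ h1)
    rw [← Function.iterate_mod_minimalPeriod_eq (n := i),
      ← Function.iterate_mod_minimalPeriod_eq (n := j)] at heq
    exact Function.iterate_injOn_Iio_minimalPeriod (Nat.mod_lt _ hn) (Nat.mod_lt _ hn) heq

namespace Circ

variable {R L : ℕ → V × Fin 3} {n : ℕ}

theorem vertex_mod (K : Circ S ε B R L n) (i : ℕ) : R (i % n) = R i := by
  have : ∀ k i, R (i + n * k) = R i := fun k => by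
    induction k with
    | zero => simp
    | succ k ih => intro i; rw [Nat.mul_succ, ← add_assoc, K.per, ih]
  conv_rhs => rw [← Nat.mod_add_div i n]
  rw [this]

theorem shift (K : Circ S ε B R L n) (j : ℕ) :
    Circ S ε B (fun i => R (i + j)) (fun i => L (i + j)) n :=
  ⟨K.pos, fun i => K.live _, fun i => K.vertex _, fun i => K.ne _,
    fun i => by rw [K.step, add_right_comm], fun i => K.markR _, fun i => K.markL _,
    fun i => by rw [add_right_comm, K.per],
    fun i k h => Nat.ModEq.add_right_cancel' _ (K.inj _ _ h)⟩

/-- The vertices of a circuit. -/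
noncomputable def verts (R : ℕ → V × Fin 3) (n : ℕ) : Finset V :=
  (Finset.range n).image (fun i => (R i).1)

theorem mem_verts (K : Circ S ε B R L n) {v : V} : v ∈ verts R n ↔ ∃ i, (R i).1 = v := by
  simp only [verts, Finset.mem_image, Finset.mem_range]
  constructor
  · rintro ⟨i, -, h⟩; exact ⟨i, h⟩
  · rintro ⟨i, h⟩; exact ⟨i % n, Nat.mod_lt _ K.pos, by rw [K.vertex_mod, h]⟩

theorem perL (K : Circ S ε B R L n) (hB : Flags S ε B) (i : ℕ) : L (i + n) = L i :=
  hB.other_unique (K.live i) (K.markR i) (by rw [K.vertex, K.per]) (K.vertex i)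
    (by rw [← K.per i]; exact K.ne _) (K.ne i) (K.markL _) (K.markL _)

theorem cases (K : Circ S ε B R L n) (hB : Flags S ε B) {d : V × Fin 3} (h : B d)
    (hd : d.1 ∈ verts R n) : ∃ i, d = R i ∨ d = L i := by
  obtain ⟨i, hi⟩ := K.mem_verts.1 hd
  refine ⟨i, ?_⟩
  by_contra! hc
  exact hc.2 (hB.other_unique (K.live i) (K.markR i) hi.symm (K.vertex i) hc.1 (K.ne i) h
    (K.markL i))

theorem epsL (K : Circ S ε B R L n) (hC : Rev S ε) (i : ℕ) : ε (L (i + 1)) = R i := by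
  rw [← K.step, hC.invol _ (K.live i)]

theorem closed (K : Circ S ε B R L n) (hC : Rev S ε) (hB : Flags S ε B) {d : V × Fin 3} (h : B d)
    (hd : d.1 ∈ verts R n) : (ε d).1 ∈ verts R n := by
  obtain ⟨i, rfl | rfl⟩ := K.cases hB h hd
  · exact K.mem_verts.2 ⟨i + 1, by rw [K.step, K.vertex]⟩
  · obtain ⟨k, hk⟩ := Nat.exists_eq_succ_of_ne_zero (show i + n ≠ 0 by have := K.pos; omega)
    refine K.mem_verts.2 ⟨k, ?_⟩
    rw [← K.perL hB i, hk, K.epsL hC]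

theorem closed_iff (K : Circ S ε B R L n) (hC : Rev S ε) (hB : Flags S ε B) {d : V × Fin 3}
    (hS : d.1 ∈ S) (h : B d) : (ε d).1 ∈ verts R n ↔ d.1 ∈ verts R n := by
  refine ⟨fun h' => ?_, K.closed hC hB h⟩
  have := K.closed hC hB ((hB.symm d hS).2 h) h'
  rwa [hC.invol d hS] at this

/-- Forgetting the circuit leaves a disjoint union of circuits. -/
theorem erase (K : Circ S ε B R L n) (hC : Rev S ε) (hB : Flags S ε B) :
    Flags S ε (fun d => B d ∧ d.1 ∉ verts R n) := by
  refine ⟨fun d hd => ?_, fun v hv => ?_⟩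
  · by_cases h : B d
    · simp only [hB.symm d hd, K.closed_iff hC hB hd h]
    · simp only [hB.symm d hd, h, false_and]
  · by_cases h : v ∈ verts R n
    · simp [h]
    · simpa [h] using hB.even v hv

theorem recolour (K : Circ S ε B R L n) (hC : Rev S ε) (hB : Flags S ε B)
    (h : Sol S ε (fun d => B d ∧ d.1 ∉ verts R n) m c)
    (hn : Even n ∨ ∃ i, m (R i).1 = (R i).2) : ∃ c', Sol S ε B m c' := by
  obtain ⟨R', L', K', hv, hn'⟩ : ∃ R' L', Circ S ε B R' L' n ∧ verts R' n = verts R n ∧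
      (Even n ∨ m (R' (n - 1)).1 = (R' (n - 1)).2) := by
    rcases hn with hn | ⟨i, hi⟩
    · exact ⟨R, L, K, rfl, Or.inl hn⟩
    · refine ⟨_, _, K.shift (i + 1), ?_, Or.inr ?_⟩
      · ext v
        rw [(K.shift (i + 1)).mem_verts, K.mem_verts]
        refine ⟨fun ⟨j, hj⟩ => ⟨_, hj⟩, fun ⟨j, hj⟩ => ⟨j + (i + 1) * (n - 1), ?_⟩⟩
        rw [← hj, ← K.vertex_mod, ← K.vertex_mod j]
        have := K.pos
        obtain ⟨k, rfl⟩ : ∃ k, n = k + 1 := ⟨n - 1, by omega⟩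
        rw [show j + (i + 1) * (k + 1 - 1) + (i + 1) = j + (i + 1) * (k + 1) by
          rw [Nat.add_sub_cancel]; ring, Nat.add_mul_mod_self_right]
      · have := K.pos
        simp only [show n - 1 + (i + 1) = i + n by omega, K.per, hi]
  rw [← hv] at h
  clear hn hv K
  have hlt : ∀ i < n, ∀ j < n, (R' i).1 = (R' j).1 → i = j := fun i hi j hj e => by
    have := K'.inj i j e
    rwa [Nat.ModEq, Nat.mod_eq_of_lt hi, Nat.mod_eq_of_lt hj] at this
  let c' : V → Bool := fun v =>
    if v ∈ verts R' n then decide (∃ i < n, (R' i).1 = v ∧ Even i) else c v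
  have hcp : ∀ i < n, c' (R' i).1 = decide (Even i) := fun i hi => by
    have : (R' i).1 ∈ verts R' n := K'.mem_verts.2 ⟨i, rfl⟩
    simp only [c', this, if_true, decide_eq_decide]
    refine ⟨fun ⟨j, hj, he, hev⟩ => ?_, fun hev => ⟨i, hi, rfl, hev⟩⟩
    rwa [← hlt j hj i hi he]
  have hR : ∀ i < n, m (R' i).1 ≠ (R' i).2 → c' (R' i).1 ≠ c' (ε (R' i)).1 := by
    intro i hi hm
    rw [K'.step, K'.vertex, hcp i hi]
    by_cases hi' : i + 1 < n
    · rw [hcp _ hi']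
      simp only [ne_eq, decide_eq_decide]
      grind
    · obtain rfl : i = n - 1 := by omega
      have hp := K'.pos
      have h0 := K'.per 0
      rw [show n - 1 + 1 = 0 + n by omega, h0, hcp 0 hp]
      rcases hn' with hn' | hn'
      · simp only [ne_eq, decide_eq_decide]
        grind
      · exact absurd hn' hm
  have hiff := fun (d : V × Fin 3) (hd : d.1 ∈ S) => h.iff hC.invol hd (hC.live d hd)
  refine ⟨c', fun d hd hd' => ⟨(h d hd hd').1, fun hb hm => ?_⟩⟩
  by_cases hv : d.1 ∈ verts R' n
  · obtain ⟨i, hi⟩ := K'.cases hB hb hv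
    rcases hi with hi | hi
    · rw [← K'.vertex_mod] at hi
      rw [hi] at hm ⊢
      exact hR _ (Nat.mod_lt _ K'.pos) hm
    · obtain ⟨k, hk⟩ := Nat.exists_eq_succ_of_ne_zero (show i + n ≠ 0 by have := K'.pos; omega)
      rw [← K'.perL hB i, hk, Nat.succ_eq_add_one, ← K'.step, ← K'.vertex_mod] at hi
      have hl := K'.live (k % n)
      rw [hi] at hm ⊢
      rw [hC.invol _ hl]
      refine (hR _ (Nat.mod_lt _ K'.pos) fun h' => hm ?_).symm
      exact (hiff _ hl).1 h'
  · have hv' : (ε d).1 ∉ verts R' n := fun h' => hv ((K'.closed_iff hC hB hd hb).1 h')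
    simp only [c', hv, hv', if_false]
    exact (h d hd hd').2 ⟨hb, hv⟩ hm

end Circ

/-- Restricting a solution to a part of a reduction which is not bridgeless: the edge deleted is
`P0`, the darts `P1` and `Q1` lead to `X`, and `P2` and `Q2` lead to the rest. -/
theorem Frink.split {q : V} {Q0 Q1 Q2 f a : V × Fin 3} (hs : Solvable V S.card)
    (F : Frink S ε p q P0 P1 P2 Q0 Q1 Q2) (hC : Cubic S ε) (hB : Flags S ε B)
    (hX : X ⊆ S \ {p, q}) (hf : base ε X {p, q} = {f}) (h3 : (cut ε X).card = 3)
    (h3' : (cut ε ((S \ {p, q}) \ X)).card = 3) (hP1 : (ε P1).1 ∈ X) (hQ1 : (ε Q1).1 ∈ X)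
    (hP2 : (ε P2).1 ∈ (S \ {p, q}) \ X) (hQ2 : (ε Q2).1 ∈ (S \ {p, q}) \ X)
    (hp : ∀ i, ¬ B (p, i)) (hq : ∀ i, ¬ B (q, i)) (ha : a.1 ∈ X) (hPa : (ε P1).1 = a.1)
    (hPa' : ε P1 ≠ a) :
    ∃ m c, Sol S ε B m c ∧ m a.1 = a.2 ∧ (m p = P0.2 ∨ m q = Q1.2) := by
  have hne := F.ne hC
  have nP := F.tp.idx_ne
  have nQ := F.tq.idx_ne
  obtain ⟨⟨i0, i1, i2, j1, j2⟩, ⟨p0, p1, p2, q0, q1, q2⟩, ⟨s1, s2, t1, t2⟩, -⟩ := F.facts hC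
  have hBP : ∀ d : V × Fin 3, d.1 = p → ¬ B d := fun d h => by
    have := hp d.2; rwa [← h] at this
  have hBQ : ∀ d : V × Fin 3, d.1 = q → ¬ B d := fun d h => by
    have := hq d.2; rwa [← h] at this
  have memD : ∀ v, v ∈ (S \ {p, q}) \ X ↔ v ∈ S ∧ v ≠ p ∧ v ≠ q ∧ v ∉ X := fun v => by
    simp [and_assoc]
  have memX : ∀ v ∈ X, v ∈ S ∧ v ≠ p ∧ v ≠ q := fun v hv => by simpa using hX hv
  have hXS : X ⊆ S := fun v hv => (memX v hv).1
  have hDS : (S \ {p, q}) \ X ⊆ S := Finset.sdiff_subset.trans Finset.sdiff_subset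
  have hfb : ∀ d, d.1 ∈ X ∧ (ε d).1 ∉ X ∧ (ε d).1 ≠ p ∧ (ε d).1 ≠ q ↔ d = f := fun d => by
    have := congrArg (d ∈ ·) hf
    simpa [mem_base, not_or] using this
  have hf1 := (hfb f).2 rfl
  have hfS := hXS hf1.1
  have hcutX : ∀ d : V × Fin 3, d.1 ∈ X → (ε d).1 ∉ X → d = ε P1 ∨ d = ε Q1 ∨ d = f := by
    intro d hd hd'
    have hid := hC.invol d (hXS hd)
    by_cases h1 : (ε d).1 = p
    · rcases F.tp.cases h1 with h | h | h <;> rw [h] at hid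
      · rw [← hid, F.e0, F.tq.e0] at hd
        exact absurd rfl (memX _ hd).2.2
      · exact Or.inl hid.symm
      · rw [← hid] at hd
        exact absurd hd ((memD _).1 hP2).2.2.2
    by_cases h2 : (ε d).1 = q
    · rcases F.tq.cases h2 with h | h | h <;> rw [h] at hid
      · rw [← hid, i0, F.tp.e0] at hd
        exact absurd rfl (memX _ hd).2.1
      · exact Or.inr (Or.inl hid.symm)
      · rw [← hid] at hd
        exact absurd hd ((memD _).1 hQ2).2.2.2
    exact Or.inr (Or.inr ((hfb d).1 ⟨hd, hd', h1, h2⟩))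
  have hcutD : ∀ d : V × Fin 3, d.1 ∈ (S \ {p, q}) \ X → (ε d).1 ∉ (S \ {p, q}) \ X →
      d = ε P2 ∨ d = ε Q2 ∨ d = ε f := by
    intro d hd hd'
    have hd1 := (memD _).1 hd
    have hid := hC.invol d hd1.1
    by_cases h1 : (ε d).1 = p
    · rcases F.tp.cases h1 with h | h | h <;> rw [h] at hid
      · rw [← hid, F.e0, F.tq.e0] at hd1
        exact absurd rfl hd1.2.2.1
      · rw [← hid] at hd1
        exact absurd hP1 hd1.2.2.2
      · exact Or.inl hid.symm
    by_cases h2 : (ε d).1 = q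
    · rcases F.tq.cases h2 with h | h | h <;> rw [h] at hid
      · rw [← hid, i0, F.tp.e0] at hd1
        exact absurd rfl hd1.2.1
      · rw [← hid] at hd1
        exact absurd hQ1 hd1.2.2.2
      · exact Or.inr (Or.inl hid.symm)
    have h3 : (ε d).1 ∈ X := by
      by_contra h
      exact hd' ((memD _).2 ⟨hC.live d hd1.1, h1, h2, h⟩)
    right; right
    rw [← (hfb (ε d)).1 ⟨h3, by rw [hid]; exact ⟨hd1.2.2.2, hd1.2.1, hd1.2.2.1⟩⟩, hid]
  have bP1 : ¬ B (ε P1) := by rw [hB.symm _ p1]; exact hBP _ F.tp.e1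
  have bQ1 : ¬ B (ε Q1) := by rw [hB.symm _ q1]; exact hBQ _ F.tq.e1
  have bP2 : ¬ B (ε P2) := by rw [hB.symm _ p2]; exact hBP _ F.tp.e2
  have bQ2 : ¬ B (ε Q2) := by rw [hB.symm _ q2]; exact hBQ _ F.tq.e2
  have bf : ¬ B f := fun hb => by
    have := hC.parity hB hXS
    rw [Finset.sum_eq_single_of_mem f (mem_cut.2 ⟨hf1.1, hf1.2.1⟩), if_pos hb] at this
    · exact absurd this (by decide)
    · intro d hd hdf
      rw [mem_cut] at hd
      rcases hcutX d hd.1 hd.2 with rfl | rfl | rfl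
      exacts [if_neg bP1, if_neg bQ1, absurd rfl hdf]
  have bf' : ¬ B (ε f) := by rwa [hB.symm _ hfS]
  obtain ⟨dd, hinj, hdd⟩ := exists_dd h3
  obtain ⟨dd', hinj', hdd'⟩ := exists_dd h3'
  have hcd : ∀ Y ⊆ S \ {p, q}, Y.card + 1 < S.card := fun Y hY => by
    have e1 := Finset.card_le_card hY
    have e2 : ({p, q} : Finset V) ⊆ S := by
      intro v; simp only [Finset.mem_insert, Finset.mem_singleton]
      rintro (rfl | rfl)
      exacts [F.pS, F.qS hC]
    have e3 := Finset.card_sdiff_add_card_eq_card e2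
    have e4 : ({p, q} : Finset V).card = 2 := Finset.card_pair hne.symm
    omega
  obtain ⟨mA, cA, k, col, hA, hma⟩ := hs.side_of_dart (z := p) hC hB hXS (hcd _ hX)
    (fun h => (memX _ h).2.1 rfl) hinj hdd ha
  have hused : ∀ d ∈ cut ε X, (mA d.1 = d.2 ↔ d = dd k) := fun d hd => by
    obtain ⟨i, rfl⟩ := (hdd d).1 hd
    rw [hA.used, hinj.eq_iff, eq_comm]
  have hP1X : (ε P1).1 ∈ X ∧ (ε (ε P1)).1 ∉ X :=
    ⟨hP1, by rw [i1, F.tp.e1]; exact fun h => (memX _ h).2.1 rfl⟩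
  have hQ1X : (ε Q1).1 ∈ X ∧ (ε (ε Q1)).1 ∉ X :=
    ⟨hQ1, by rw [j1, F.tq.e1]; exact fun h => (memX _ h).2.2 rfl⟩
  have aP1 : mA (ε P1).1 ≠ (ε P1).2 := fun h => hPa' (Prod.ext hPa (by rw [← h, hPa, hma]))
  have aQ1 : mA (ε Q1).1 = (ε Q1).2 ↔ ¬ mA f.1 = f.2 := by
    have u1 := hused _ (mem_cut.2 hP1X)
    have u2 := hused _ (mem_cut.2 hQ1X)
    have u3 := hused f (mem_cut.2 ⟨hf1.1, hf1.2.1⟩)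
    rw [u2, u3]
    have hdk := mem_cut.1 ((hdd (dd k)).2 ⟨k, rfl⟩)
    have nf : ε Q1 ≠ f := fun h => by
      have := hf1.2.2.2
      rw [← h, j1, F.tq.e1] at this
      exact this rfl
    rcases hcutX _ hdk.1 hdk.2 with h | h | h
    · exact absurd (u1.2 h.symm) aP1
    · rw [← h]; simp [h, nf.symm]
    · rw [h]; simp [nf]
  obtain ⟨h, aQ⟩ : ∃ h : Prop, mA (ε Q1).1 = (ε Q1).2 ↔ h := ⟨_, Iff.rfl⟩
  let g := if h then ε P2 else ε f
  have hfD : (ε f).1 ∈ (S \ {p, q}) \ X :=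
    (memD _).2 ⟨hC.live f hfS, hf1.2.2.1, hf1.2.2.2, hf1.2.1⟩
  have cP2 : ε P2 ∈ cut ε ((S \ {p, q}) \ X) :=
    mem_cut.2 ⟨hP2, by rw [i2, F.tp.e2]; simp⟩
  have cQ2 : ε Q2 ∈ cut ε ((S \ {p, q}) \ X) :=
    mem_cut.2 ⟨hQ2, by rw [j2, F.tq.e2]; simp⟩
  have cf : ε f ∈ cut ε ((S \ {p, q}) \ X) :=
    mem_cut.2 ⟨hfD, by rw [hC.invol f hfS]; simp [hf1.1]⟩
  have hg : g ∈ cut ε ((S \ {p, q}) \ X) := by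
    simp only [g]; split_ifs
    exacts [cP2, cf]
  obtain ⟨k', hk'⟩ := (hdd' g).1 hg
  obtain ⟨mB, cB, hD⟩ := hs.side_of_index (z := p) hC hB hDS (hcd _ Finset.sdiff_subset)
    (by simp) hinj' hdd' k' true
  have hused' : ∀ d ∈ cut ε ((S \ {p, q}) \ X), (mB d.1 = d.2 ↔ d = g) := fun d hd => by
    obtain ⟨i, rfl⟩ := (hdd' d).1 hd
    rw [hD.used, hk', hinj'.eq_iff, eq_comm]
  have n1 : ε P2 ≠ ε f := fun e => (memX _ (F.tp.e2 ▸ hC.inj p2 hfS e ▸ hf1.1)).2.1 rfl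
  have n2 : ε Q2 ≠ ε f := fun e => (memX _ (F.tq.e2 ▸ hC.inj q2 hfS e ▸ hf1.1)).2.2 rfl
  have n3 : ε P2 ≠ ε Q2 := fun e => hne (by rw [← F.tp.e2, ← F.tq.e2, hC.inj p2 q2 e])
  have dP2 : mB (ε P2).1 = (ε P2).2 ↔ h := by
    rw [hused' _ cP2]; simp only [g]; split_ifs with hh <;> simp [hh, n1]
  have dQ2 : mB (ε Q2).1 ≠ (ε Q2).2 := by
    rw [ne_eq, hused' _ cQ2]; simp only [g]; split_ifs
    exacts [n3.symm, n2]
  have df : mB (ε f).1 = (ε f).2 ↔ ¬ h := by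
    rw [hused' _ cf]; simp only [g]; split_ifs with hh <;> simp [hh, n1.symm]
  have af : mA f.1 = f.2 ↔ ¬ h := by
    rw [← aQ, aQ1, not_not]
  let m : V → Fin 3 := fun v => if v = p then (if h then P2.2 else P0.2) else
    if v = q then (if h then Q1.2 else Q0.2) else if v ∈ X then mA v else mB v
  let c : V → Bool := fun v => if v ∈ X then cA v else cB v
  have mp : m p = if h then P2.2 else P0.2 := by simp [m]
  have mq : m q = if h then Q1.2 else Q0.2 := by simp [m, hne]
  have mX : ∀ v ∈ X, m v = mA v ∧ c v = cA v := fun v hv => by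
    simp [m, c, hv, (memX v hv).2]
  have mD : ∀ v ∈ (S \ {p, q}) \ X, m v = mB v ∧ c v = cB v := fun v hv => by
    simp [m, c, (memD v).1 hv]
  clear_value m c g
  let E : V × Fin 3 → Prop := fun d => (m d.1 = d.2 ↔ m (ε d).1 = (ε d).2) ∧
    (B d → m d.1 ≠ d.2 → c d.1 ≠ c (ε d).1)
  have Esymm : ∀ d, d.1 ∈ S → E (ε d) → E d := by
    intro d hd hE
    simp only [E, hC.invol d hd, hB.symm d hd] at hE ⊢
    exact ⟨hE.1.symm, fun hb hm => (hE.2 hb (fun h => hm (hE.1.1 h))).symm⟩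
  have E0 : E P0 := by
    refine ⟨?_, fun hb => absurd hb (hBP _ F.tp.e0)⟩
    rw [F.e0, F.tp.e0, F.tq.e0, mp, mq]
    split_ifs <;> simp [nP.2.1.symm, nQ.1.symm]
  have E1 : E (ε P1) := by
    refine ⟨?_, fun hb => absurd hb bP1⟩
    rw [i1, F.tp.e1, mp, (mX _ hP1).1]
    split_ifs <;> simp [nP.1, nP.2.2.symm, aP1]
  have E2 : E (ε P2) := by
    refine ⟨?_, fun hb => absurd hb bP2⟩
    rw [i2, F.tp.e2, mp, (mD _ hP2).1, dP2]
    split_ifs with hh <;> simp [nP.2.1, hh]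
  have F1 : E (ε Q1) := by
    refine ⟨?_, fun hb => absurd hb bQ1⟩
    rw [j1, F.tq.e1, mq, (mX _ hQ1).1, aQ]
    split_ifs with hh <;> simp [nQ.1, hh]
  have F2 : E (ε Q2) := by
    refine ⟨?_, fun hb => absurd hb bQ2⟩
    rw [j2, F.tq.e2, mq, (mD _ hQ2).1]
    split_ifs with hh <;> simp [nQ.2.1, nQ.2.2, dQ2]
  have Ef : E f := by
    refine ⟨?_, fun hb => absurd hb bf⟩
    rw [(mX _ hf1.1).1, (mD _ hfD).1, af, df]
  refine ⟨m, c, fun d hd _ => ?_, by rw [(mX _ ha).1, hma], ?_⟩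
  · suffices hE : E d from ⟨hE.1.1, hE.2⟩
    have g0 : E Q0 := Esymm _ q0 (by rwa [i0])
    by_cases hdp : d.1 = p
    · rcases F.tp.cases hdp with rfl | rfl | rfl
      exacts [E0, Esymm _ hd E1, Esymm _ hd E2]
    by_cases hdq : d.1 = q
    · rcases F.tq.cases hdq with rfl | rfl | rfl
      exacts [g0, Esymm _ hd F1, Esymm _ hd F2]
    by_cases hdX : d.1 ∈ X
    · by_cases hdX' : (ε d).1 ∈ X
      · have h1 := hA.sol d hdX hdX'
        have h2 := hA.sol.iff (fun x hx => hC.invol x (hXS hx)) hdX hdX'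
        simp only [E, (mX _ hdX).1, (mX _ hdX').1, (mX _ hdX).2, (mX _ hdX').2]
        exact ⟨h2, h1.2⟩
      · rcases hcutX d hdX hdX' with rfl | rfl | rfl
        exacts [E1, F1, Ef]
    · have hdD : d.1 ∈ (S \ {p, q}) \ X := (memD _).2 ⟨hd, hdp, hdq, hdX⟩
      by_cases hdD' : (ε d).1 ∈ (S \ {p, q}) \ X
      · have h1 := hD.sol d hdD hdD'
        have h2 := hD.sol.iff (fun x hx => hC.invol x (hDS hx)) hdD hdD'
        simp only [E, (mD _ hdD).1, (mD _ hdD').1, (mD _ hdD).2, (mD _ hdD').2]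
        exact ⟨h2, h1.2⟩
      · rcases hcutD d hdD hdD' with rfl | rfl | rfl
        · exact E2
        · exact F2
        · exact Esymm _ hd (by rwa [hC.invol f hfS])
  · rw [mp, mq]
    split_ifs <;> simp

/-- A path of `N` vertices off the marked circuits, entered from the end of `a` along the
dart `u ≠ a`. -/
structure Chain (S : Finset V) (ε : V × Fin 3 → V × Fin 3) (B : V × Fin 3 → Prop)
    (a u : V × Fin 3) (R L : ℕ → V × Fin 3) (N : ℕ) : Prop where
  aS : a.1 ∈ S
  ua : u.1 = a.1
  une : u ≠ a
  live : ∀ i < N, (R i).1 ∈ S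
  vertex : ∀ i < N, (L i).1 = (R i).1
  ne : ∀ i < N, L i ≠ R i
  unmarked : ∀ i < N, ∀ j, ¬ B ((R i).1, j)
  inj : ∀ i < N, ∀ j < N, (R i).1 = (R j).1 → i = j
  na : ∀ i < N, (R i).1 ≠ a.1
  first : ε u = L 0
  step : ∀ i, i + 1 < N → ε (R i) = L (i + 1)
  last : ∀ i < N, (ε (R (N - 1))).1 ≠ (R i).1
  wide : ∀ X ⊆ S, a.1 ∈ X → (ε (R (N - 1))).1 ∉ X → (∀ i < N, (R i).1 ∉ X) →
    2 ≤ (base ε X (Circ.verts R N)).card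

theorem mem_base_verts {R : ℕ → V × Fin 3} {N : ℕ} {d : V × Fin 3} :
    d ∈ base ε X (Circ.verts R N) ↔ d.1 ∈ X ∧ (ε d).1 ∉ X ∧ ∀ i < N, (ε d).1 ≠ (R i).1 := by
  simp [mem_base, Circ.verts, eq_comm]

theorem fr_of_ne {P1 P2 Q1 Q2 d : V × Fin 3} (h1 : ε d ≠ P1) (h2 : ε d ≠ Q1) (h3 : ε d ≠ P2)
    (h4 : ε d ≠ Q2) : fr ε P1 P2 Q1 Q2 d = ε d := by
  simp [fr, h1, h2, h3, h4]

theorem Solvable.mono {n k : ℕ} (h : Solvable V n) (hk : k ≤ n) : Solvable V k :=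
  fun S ε B hS => h S ε B (hS.trans_le hk)

namespace Chain

variable {a u : V × Fin 3} {R L : ℕ → V × Fin 3} {N : ℕ}

theorem frink (K : Chain S ε B a u R L (N + 3)) {P Q : V × Fin 3} (hP : Tri (R 0).1 (R 0) (L 0) P)
    (hQ : Tri (L 1).1 (L 1) (R 1) Q) (hC : Rev S ε) :
    Frink S ε (R 0).1 (L 1).1 (R 0) (L 0) P (L 1) (R 1) Q := by
  have h2 := K.live 1 (by omega)
  refine ⟨hP, hQ, K.step 0 (by omega), K.live 0 (by omega), fun h => ?_, fun h => ?_⟩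
  · rw [← K.first, hC.invol u (K.ua ▸ K.aS)] at h
    have := K.na 1 (by omega)
    rw [← K.ua, h, hQ.e2, K.vertex 1 (by omega)] at this
    exact this rfl
  · have h1 := K.step 1 (by omega)
    rw [← h, hC.invol P (by rw [hP.e2]; exact K.live 0 (by omega))] at h1
    have := K.vertex 2 (by omega)
    rw [← h1, hP.e2] at this
    have := K.inj 0 (by omega) 2 (by omega) this
    omega

theorem frink_chain (K : Chain S ε B a u R L (N + 3)) {P Q : V × Fin 3}
    (hP : Tri (R 0).1 (R 0) (L 0) P) (hQ : Tri (L 1).1 (L 1) (R 1) Q) :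
    Chain (S \ {(R 0).1, (L 1).1}) (fr ε (L 0) P (R 1) Q) B a u (fun i => R (i + 2))
      (fun i => L (i + 2)) (N + 1) := by
  have hv := K.vertex 1 (by omega)
  rw [hv] at hQ ⊢
  have hfr : ∀ d, (ε d).1 ≠ (R 0).1 → (ε d).1 ≠ (R 1).1 → fr ε (L 0) P (R 1) Q d = ε d :=
    fun d h0 h1 => fr_of_ne (fun e => h0 (e ▸ hP.e1)) (fun e => h1 (e ▸ rfl))
      (fun e => h0 (e ▸ hP.e2)) (fun e => h1 (e ▸ hQ.e2))
  have hlast : fr ε (L 0) P (R 1) Q (R (N + 2)) = ε (R (N + 2)) :=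
    hfr _ (K.last 0 (by omega)) (K.last 1 (by omega))
  have hn : ∀ i < N + 1, (R (i + 2)).1 ≠ (R 0).1 ∧ (R (i + 2)).1 ≠ (R 1).1 := fun i hi =>
    ⟨fun h => by have := K.inj _ (by omega) _ (by omega) h; omega,
      fun h => by have := K.inj _ (by omega) _ (by omega) h; omega⟩
  refine ⟨?_, K.ua, K.une, fun i hi => ?_, fun i hi => K.vertex _ (by omega),
    fun i hi => K.ne _ (by omega), fun i hi => K.unmarked _ (by omega), fun i hi j hj h => ?_,
    fun i hi => K.na _ (by omega), ?_, fun i hi => ?_, fun i hi => ?_, fun X hX h1 h2 h3 => ?_⟩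
  · simp [K.aS, (K.na 0 (by omega)).symm, (K.na 1 (by omega)).symm]
  · simp [K.live (i + 2) (by omega), hn i hi]
  · have := K.inj _ (by omega) _ (by omega) h
    omega
  · show fr ε (L 0) P (R 1) Q u = L 2
    rw [← K.step 1 (by omega)]
    simp [fr, K.first]
  · have hs := K.step (i + 2) (by omega)
    have hv := K.vertex (i + 2 + 1) (by omega)
    rw [hfr, hs, add_right_comm]
    · rw [hs, hv]
      exact (hn (i + 1) hi).1
    · rw [hs, hv]
      exact (hn (i + 1) hi).2
  · show (fr ε (L 0) P (R 1) Q (R (N + 2))).1 ≠ _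
    rw [hlast]
    exact K.last _ (by omega)
  · change (fr ε (L 0) P (R 1) Q (R (N + 2))).1 ∉ X at h2
    rw [hlast] at h2
    have hX' : ∀ v ∈ X, v ∈ S ∧ v ≠ (R 0).1 ∧ v ≠ (R 1).1 := fun v hv => by simpa using hX hv
    refine (K.wide X (hX.trans Finset.sdiff_subset) h1 h2 fun i hi h => ?_).trans
      (Finset.card_le_card fun d hd => ?_)
    · match i with
      | 0 => exact (hX' _ h).2.1 rfl
      | 1 => exact (hX' _ h).2.2 rfl
      | i + 2 => exact h3 i (by omega) h
    · rw [mem_base_verts] at hd ⊢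
      rw [hfr d (hd.2.2 0 (by omega)) (hd.2.2 1 (by omega))]
      exact ⟨hd.1, hd.2.1, fun i hi => hd.2.2 _ (by omega)⟩

/-- The case of a path with two vertices. -/
theorem hit_two (K : Chain S ε B a u R L 2) (hs : Solvable V S.card) (hC : Cubic S ε)
    (hB : Flags S ε B) :
    ∃ m c, Sol S ε B m c ∧ m a.1 = a.2 ∧ ∃ i < 2, m (R i).1 = (R i).2 := by
  have l0 := K.live 0 (by omega)
  have l1 := K.live 1 (by omega)
  have v0 := K.vertex 0 (by omega)
  have v1 := K.vertex 1 (by omega)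
  have n01 : (R 0).1 ≠ (R 1).1 := fun h => by
    have := K.inj 0 (by omega) 1 (by omega) h; omega
  obtain ⟨P, hP⟩ := Tri.exists_of_ne v0.symm (K.ne 0 (by omega)).symm
  obtain ⟨Q, hQ⟩ := Tri.exists_of_ne v1 (K.ne 1 (by omega))
  rw [v1] at hQ
  have uS : u.1 ∈ S := K.ua ▸ K.aS
  have hu : ε (L 0) = u := by rw [← K.first, hC.invol u uS]
  have hb : ∀ i < 2, ∀ d : V × Fin 3, d.1 = (R i).1 → ¬ B d := fun i hi d h => by
    have := K.unmarked i hi d.2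
    rwa [← h] at this
  have haS : a.1 ∈ S \ {(R 0).1, (R 1).1} := by
    simp [K.aS, (K.na 0 (by omega)).symm, (K.na 1 (by omega)).symm]
  have hcard : (S \ {(R 0).1, (R 1).1}).card < S.card :=
    Finset.card_lt_card ⟨Finset.sdiff_subset, fun h => by simpa using h l0⟩
  have hstep := K.step 0 (by omega)
  have core : ∀ Q1 Q2, (F : Frink S ε (R 0).1 (R 1).1 (R 0) (L 0) P (L 1) Q1 Q2) →
      Cubic (S \ {(R 0).1, (R 1).1}) (fr ε (L 0) P Q1 Q2) →
      ((ε P).1 = (R 1).1 ∨ Q2 = R 1) →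
      ∃ m c, Sol S ε B m c ∧ m a.1 = a.2 ∧ ∃ i < 2, m (R i).1 = (R i).2 := by
    intro Q1 Q2 F hC' hor
    have b1 : ∀ d : V × Fin 3, d.1 = (R 0).1 → ¬ B d := hb 0 (by omega)
    have b2 : ∀ d : V × Fin 3, d.1 = (R 1).1 → ¬ B d := hb 1 (by omega)
    have c1 : B (L 0) ↔ B Q1 := iff_of_false (b1 _ v0) (b2 _ F.tq.e1)
    have c2 : B P ↔ B Q2 := iff_of_false (b1 _ F.tp.e2) (b2 _ F.tq.e2)
    obtain ⟨m, c, hm, hma⟩ := hs _ _ B hcard hC' (F.flags hC hB c1 c2) a haS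
    obtain ⟨m', c', h', ho, hpq⟩ := F.lift hC hB hm (Or.inr (by
      rw [hu, K.ua, hma]
      exact fun h => K.une (Prod.ext K.ua h.symm))) c1 c2 (Or.inr ⟨b1 _ v0, b1 _ F.tp.e2⟩)
    refine ⟨m', c', h', ?_, ?_⟩
    · rw [ho _ (K.na 0 (by omega)).symm (K.na 1 (by omega)).symm, hma]
    · rcases hpq with h | h
      · exact ⟨0, by omega, h.1⟩
      · rcases hor with hor | hor
        · exact absurd hor h.1
        · exact ⟨1, by omega, by rw [h.2.2, hor]⟩
  have hu1 : u.1 ≠ (R 1).1 := fun h => K.na 1 (by omega) (by rw [← K.ua, h])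
  by_cases hPQ : ε P = Q
  · have F : Frink S ε (R 0).1 (R 1).1 (R 0) (L 0) P (L 1) (R 1) Q :=
      ⟨hP, hQ, hstep, l0, fun h => hu1 (by rw [← hu, h, hQ.e2]),
        fun h => hQ.n12 (by rw [← h, hPQ])⟩
    refine core _ _ F ?_ (Or.inl (by rw [hPQ, hQ.e2]))
    by_contra hcon
    obtain ⟨X, hX, -, -, -, -, -, h, -⟩ := F.bridging hC hcon
    rw [hPQ, hQ.e2] at h
    simp at h
  · have F : Frink S ε (R 0).1 (R 1).1 (R 0) (L 0) P (L 1) Q (R 1) :=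
      ⟨hP, hQ.swap, hstep, l0, fun h => hu1 (by rw [← hu, h]), hPQ⟩
    refine core _ _ F ?_ (Or.inr rfl)
    by_contra hcon
    obtain ⟨X, hX, h1, -, -, h2, h3, h4, h5⟩ := F.bridging hC hcon
    have := K.wide X (hX.trans Finset.sdiff_subset) (by rwa [hu, K.ua] at h2)
      (Finset.mem_sdiff.1 h5).2 fun i hi h => by
        have := hX h
        interval_cases i <;> simp at this
    have he : Circ.verts R 2 = {(R 0).1, (R 1).1} := by
      ext v; simp [Circ.verts, Finset.range_add_one]; tauto
    rw [he, h1] at this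
    omega

/-- There is a solution using a prescribed dart and a dart of the path. -/
theorem hit {k : ℕ} (K : Chain S ε B a u R L (2 * k + 2)) (hs : Solvable V S.card)
    (hC : Cubic S ε) (hB : Flags S ε B) :
    ∃ m c, Sol S ε B m c ∧ m a.1 = a.2 ∧ ∃ i < 2 * k + 2, m (R i).1 = (R i).2 := by
  induction k generalizing S ε R L with
  | zero => exact K.hit_two hs hC hB
  | succ k ih =>
    have l0 := K.live 0 (by omega)
    have v0 := K.vertex 0 (by omega)
    have v1 := K.vertex 1 (by omega)
    obtain ⟨P, hP⟩ := Tri.exists_of_ne v0.symm (K.ne 0 (by omega)).symm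
    obtain ⟨Q, hQ⟩ := Tri.exists_of_ne (v1.trans rfl) (K.ne 1 (by omega))
    have F := frink (N := 2 * k + 1) K hP hQ hC.toRev
    have uS : u.1 ∈ S := K.ua ▸ K.aS
    have hu : ε (L 0) = u := by rw [← K.first, hC.invol u uS]
    have hb : ∀ i < 2 * (k + 1) + 2, ∀ d : V × Fin 3, d.1 = (R i).1 → ¬ B d := fun i hi d h => by
      have := K.unmarked i hi d.2
      rwa [← h] at this
    have b1 : ∀ d : V × Fin 3, d.1 = (R 0).1 → ¬ B d := hb 0 (by omega)
    have b2 : ∀ d : V × Fin 3, d.1 = (R 1).1 → ¬ B d := hb 1 (by omega)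
    have c1 : B (L 0) ↔ B (R 1) := iff_of_false (b1 _ v0) (b2 _ rfl)
    have c2 : B P ↔ B Q := iff_of_false (b1 _ hP.e2) (b2 _ (hQ.e2.trans v1))
    by_cases hC' : Cubic (S \ {(R 0).1, (L 1).1}) (fr ε (L 0) P (R 1) Q)
    · have hcard : (S \ {(R 0).1, (L 1).1}).card ≤ S.card :=
        Finset.card_le_card Finset.sdiff_subset
      obtain ⟨m, c, hm, hma, i, hi, hmi⟩ := ih (frink_chain (N := 2 * k + 1) K hP hQ)
        (hs.mono hcard) hC' (F.flags hC hB c1 c2)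
      obtain ⟨m', c', h', ho, -⟩ := F.lift hC hB hm (Or.inr (by
        rw [hu, K.ua, hma]
        exact fun h => K.une (Prod.ext K.ua h.symm))) c1 c2 (Or.inr ⟨b1 _ v0, b1 _ F.tp.e2⟩)
      refine ⟨m', c', h', ?_, i + 2, by omega, ?_⟩
      · rw [ho _ (K.na 0 (by omega)).symm (v1 ▸ (K.na 1 (by omega)).symm), hma]
      · rw [ho, hmi]
        · intro h; have := K.inj _ (by omega) _ (by omega) h; omega
        · rw [v1]; intro h; have := K.inj _ (by omega) _ (by omega) h; omega
    · obtain ⟨X, hX, h1, h2, h3, h4, h5, h6, h7⟩ := F.bridging hC hC'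
      obtain ⟨f, hf⟩ := Finset.card_eq_one.1 h1
      obtain ⟨m, c, hm, hma, hor⟩ := F.split (a := a) hs hC hB hX hf h2 h3 h4 h5 h6 h7
        (fun i => b1 _ rfl) (fun i => b2 _ v1) (by rwa [hu, K.ua] at h4) (by rw [hu, K.ua])
        (by rw [hu]; exact K.une)
      refine ⟨m, c, hm, hma, ?_⟩
      rcases hor with h | h
      · exact ⟨0, by omega, h⟩
      · exact ⟨1, by omega, by rw [← h, v1]⟩

end Chain

/-- The prescribed dart `a` and a path `u`, `e` from its end to a marked circuit. -/
structure Root (S : Finset V) (ε : V × Fin 3 → V × Fin 3) (B : V × Fin 3 → Prop)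
    (a u e f : V × Fin 3) (R L : ℕ → V × Fin 3) (n : ℕ) : Prop where
  irred : Irred S ε
  two : 2 < S.card
  four : S.card ≠ 4
  flags : Flags S ε B
  aS : a.1 ∈ S
  ua : u.1 = a.1
  une : u ≠ a
  tri : Tri (ε u).1 (ε u) e f
  afree : ∀ d : V × Fin 3, d.1 = a.1 → ¬ B d
  ufree : ∀ d : V × Fin 3, d.1 = (ε u).1 → ¬ B d
  circ : Circ S ε B R L n
  root : (R 0).1 = (ε e).1

namespace Root

variable {a u e f : V × Fin 3} {R L : ℕ → V × Fin 3} {n : ℕ}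

theorem uS (K : Root S ε B a u e f R L n) : u.1 ∈ S := K.ua ▸ K.aS

theorem bS (K : Root S ε B a u e f R L n) : (ε u).1 ∈ S := K.irred.live u K.uS

theorem rev_u (K : Root S ε B a u e f R L n) : ε (ε u) = u := K.irred.invol u K.uS

theorem eS (K : Root S ε B a u e f R L n) : e.1 ∈ S := K.tri.e1 ▸ K.bS

theorem fS (K : Root S ε B a u e f R L n) : f.1 ∈ S := K.tri.e2 ▸ K.bS

theorem unmarked_rev (K : Root S ε B a u e f R L n) : ¬ B (ε e) ∧ ¬ B (ε f) := by
  rw [K.flags.symm _ K.eS, K.flags.symm _ K.fS]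
  exact ⟨K.ufree e K.tri.e1, K.ufree f K.tri.e2⟩

theorem vert_ne (K : Root S ε B a u e f R L n) (i : ℕ) :
    (R i).1 ≠ a.1 ∧ (R i).1 ≠ (ε u).1 :=
  ⟨fun h => K.afree _ h (K.circ.markR i), fun h => K.ufree _ h (K.circ.markR i)⟩

theorem inj (K : Root S ε B a u e f R L n) {i j : ℕ} (hi : i < n) (hj : j < n)
    (h : (R i).1 = (R j).1) : i = j := by
  have := K.circ.inj i j h
  rwa [Nat.ModEq, Nat.mod_eq_of_lt hi, Nat.mod_eq_of_lt hj] at this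

theorem ends_ne (K : Root S ε B a u e f R L n) : (ε e).1 ≠ (ε f).1 := fun h =>
  K.tri.n12 (K.irred.simple K.two K.eS (K.tri.e1.trans K.tri.e2.symm) h)

theorem frink (K : Root S ε B a u e f R L n) :
    Frink S ε (ε u).1 (ε e).1 e (ε u) f (ε e) (R 0) (L 0) := by
  have hv := K.circ.vertex 0
  refine ⟨⟨K.tri.e1, K.tri.e0, K.tri.e2, K.tri.n01.symm, K.tri.n12, K.tri.n02⟩,
    ⟨rfl, K.root, hv.trans K.root, fun h => K.unmarked_rev.1 (h ▸ K.circ.markR 0),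
      fun h => K.unmarked_rev.1 (h ▸ K.circ.markL 0), (K.circ.ne 0).symm⟩, rfl, K.bS,
    fun h => ?_, fun h => K.unmarked_rev.2 (h ▸ K.circ.markR 0)⟩
  rw [K.rev_u] at h
  exact K.afree u K.ua (h ▸ K.circ.markL 0)

theorem cubic (K : Root S ε B a u e f R L n) :
    Cubic (S \ {(ε u).1, (ε e).1}) (fr ε (ε u) f (R 0) (L 0)) :=
  (K.frink.cubic_or_card K.irred).resolve_right K.four

theorem card_lt (K : Root S ε B a u e f R L n) : (S \ {(ε u).1, (ε e).1}).card < S.card :=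
  Finset.card_lt_card ⟨Finset.sdiff_subset, fun h => by simpa using h K.bS⟩

theorem a_mem (K : Root S ε B a u e f R L n) : a.1 ∈ S \ {(ε u).1, (ε e).1} := by
  have h1 := K.irred.no_loop K.uS
  have h2 := (K.vert_ne 0).1
  rw [K.root] at h2
  rw [K.ua] at h1
  simp [K.aS, h1.symm, h2.symm]

theorem vert_mem (K : Root S ε B a u e f R L n) {i : ℕ} (h0 : 0 < i) (hi : i < n) :
    (R i).1 ∈ S \ {(ε u).1, (ε e).1} := by
  have h1 : (R i).1 ≠ (ε e).1 := fun h => by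
    have := K.inj hi K.circ.pos (h.trans K.root.symm)
    omega
  simp [K.circ.live i, (K.vert_ne i).2, h1]

theorem fr_of_vertex (K : Root S ε B a u e f R L n) {d : V × Fin 3} (h1 : (ε d).1 ≠ (ε u).1)
    (h2 : (ε d).1 ≠ (ε e).1) : fr ε (ε u) f (R 0) (L 0) d = ε d :=
  fr_of_ne (fun h => h1 (h ▸ rfl)) (fun h => h2 (h ▸ K.root)) (fun h => h1 (h ▸ K.tri.e2))
    (fun h => h2 (h ▸ (K.circ.vertex 0).trans K.root))

theorem fr_u (K : Root S ε B a u e f R L n) : fr ε (ε u) f (R 0) (L 0) u = L 1 := by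
  simp [fr, K.circ.step]

theorem fr_step (K : Root S ε B a u e f R L n) {i : ℕ} (hi : i + 1 < n) :
    fr ε (ε u) f (R 0) (L 0) (R i) = L (i + 1) := by
  have := K.vert_mem (Nat.succ_pos i) hi
  simp only [Nat.succ_eq_add_one, Finset.mem_sdiff, Finset.mem_insert, Finset.mem_singleton,
    not_or] at this
  rw [K.fr_of_vertex, K.circ.step] <;> rw [K.circ.step, K.circ.vertex]
  exacts [this.2.1, this.2.2]

theorem fr_last (K : Root S ε B a u e f R L n) :
    fr ε (ε u) f (R 0) (L 0) (R (n - 1)) = ε f := by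
  have hp := K.circ.pos
  have h : ε (R (n - 1)) = L 0 := by
    rw [K.circ.step, show n - 1 + 1 = 0 + n by omega, K.circ.perL K.flags]
  have h1 : L 0 ≠ ε u := fun h => K.ufree _ rfl (h ▸ K.circ.markL 0)
  have h2 : L 0 ≠ f := fun h => K.ufree _ K.tri.e2 (h ▸ K.circ.markL 0)
  simp [fr, h, h1, h2, K.circ.ne 0]

theorem flags_fr (K : Root S ε B a u e f R L n) :
    Flags (S \ {(ε u).1, (ε e).1}) (fr ε (ε u) f (R 0) (L 0))
      (fun d => B d ∧ d.1 ∉ Circ.verts R n) := by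
  have h1 : (R 0).1 ∈ Circ.verts R n := K.circ.mem_verts.2 ⟨0, rfl⟩
  have h2 : (L 0).1 ∈ Circ.verts R n := K.circ.mem_verts.2 ⟨0, (K.circ.vertex 0).symm⟩
  refine K.frink.flags K.irred.toCubic (K.circ.erase K.irred.toRev K.flags) ?_ ?_
  · simp [h1, K.ufree (ε u) rfl]
  · simp [h2, K.ufree f K.tri.e2]

/-- A solution of the reduced graph meeting the circuit can be extended. -/
theorem finish (K : Root S ε B a u e f R L n)
    (h : Sol (S \ {(ε u).1, (ε e).1}) (fr ε (ε u) f (R 0) (L 0))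
      (fun d => B d ∧ d.1 ∉ Circ.verts R n) m c) (hm : m a.1 = a.2)
    (hit : ∃ i, 0 < i ∧ i < n ∧ m (R i).1 = (R i).2) :
    ∃ m c, Sol S ε B m c ∧ m a.1 = a.2 := by
  have h1 : (R 0).1 ∈ Circ.verts R n := K.circ.mem_verts.2 ⟨0, rfl⟩
  have h2 : (L 0).1 ∈ Circ.verts R n := K.circ.mem_verts.2 ⟨0, (K.circ.vertex 0).symm⟩
  have n1 := K.ufree (ε u) rfl
  have n2 := K.ufree f K.tri.e2
  obtain ⟨m', c', h', ho, -⟩ := K.frink.lift K.irred.toCubic (K.circ.erase K.irred.toRev K.flags) h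
    (Or.inr (by
      rw [K.rev_u, K.ua, hm]
      exact fun h => K.une (Prod.ext K.ua h.symm)))
    (by simp [h1, n1]) (by simp [h2, n2]) (Or.inr ⟨by simp [n1], by simp [n2]⟩)
  have hmem : ∀ v ∈ S \ {(ε u).1, (ε e).1}, m' v = m v := fun v hv => by
    simp only [Finset.mem_sdiff, Finset.mem_insert, Finset.mem_singleton, not_or] at hv
    exact ho v hv.2.1 hv.2.2
  obtain ⟨i, h0, hi, hmi⟩ := hit
  obtain ⟨c'', h''⟩ := K.circ.recolour K.irred.toRev K.flags h'
    (Or.inr ⟨i, by rw [hmem _ (K.vert_mem h0 hi), hmi]⟩)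
  exact ⟨m', c'', h'', by rw [hmem _ K.a_mem, hm]⟩

theorem solve_even (K : Root S ε B a u e f R L n) (hs : Solvable V S.card) (hn : Even n) :
    ∃ m c, Sol S ε B m c ∧ m a.1 = a.2 := by
  obtain ⟨m, c, h, hm⟩ := hs.of_edge K.irred (K.circ.erase K.irred.toRev K.flags) K.two K.four
    K.aS K.ua K.une K.tri.e1 K.tri.n01.symm (Or.inr (by
      rintro d (hd | hd) ⟨hb, hv⟩
      · exact K.ufree d hd hb
      · exact hv (K.circ.mem_verts.2 ⟨0, by rw [hd, K.root]⟩)))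
  obtain ⟨c', h'⟩ := K.circ.recolour K.irred.toRev K.flags h (Or.inl hn)
  exact ⟨m, c', h', hm⟩

theorem solve_same (K : Root S ε B a u e f R L n) (hs : Solvable V S.card) {j : ℕ} (h0 : 0 < j)
    (hj : j < n) (hodd : Odd (n - j)) (hf : (R j).1 = (ε f).1) :
    ∃ m c, Sol S ε B m c ∧ m a.1 = a.2 := by
  let ε' := fr ε (ε u) f (R 0) (L 0)
  let Y := S \ {(ε u).1, (ε e).1}
  let A : V × Fin 3 → Prop := fun d =>
    (∃ i, j ≤ i ∧ i < n ∧ d = R i) ∨ (∃ i, j < i ∧ i < n ∧ d = L i) ∨ d = ε f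
  let B' : V × Fin 3 → Prop := fun d => (B d ∧ d.1 ∉ Circ.verts R n) ∨ A d
  have hinv : ∀ d : V × Fin 3, d.1 ∈ Y → ε' (ε' d) = d := K.cubic.invol
  have hstep : ∀ i, i + 1 < n → ε' (R i) = L (i + 1) := fun i => K.fr_step
  have hlast : ε' (R (n - 1)) = ε f := K.fr_last
  have hf' := K.unmarked_rev.2
  have hlive : ∀ i, 0 < i → i < n → (R i).1 ∈ Y := fun i => K.vert_mem
  have hA : ∀ d : V × Fin 3, A d → A (ε' d) := by
    rintro d (⟨i, h1, h2, rfl⟩ | ⟨i, h1, h2, rfl⟩ | rfl)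
    · by_cases hi : i + 1 < n
      · exact Or.inr (Or.inl ⟨i + 1, by omega, hi, hstep i hi⟩)
      · obtain rfl : i = n - 1 := by omega
        exact Or.inr (Or.inr hlast)
    · obtain ⟨k, rfl⟩ : ∃ k, i = k + 1 := ⟨i - 1, by omega⟩
      refine Or.inl ⟨k, by omega, by omega, ?_⟩
      rw [← hstep k h2, hinv _ (hlive k (by omega) (by omega))]
    · refine Or.inl ⟨n - 1, by omega, by omega, ?_⟩
      rw [← hlast, hinv _ (hlive (n - 1) (by omega) (by omega))]
  have hAv : ∀ d : V × Fin 3, A d → ∃ i, j ≤ i ∧ i < n ∧ d.1 = (R i).1 := by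
    rintro d (⟨i, h1, h2, rfl⟩ | ⟨i, h1, h2, rfl⟩ | rfl)
    · exact ⟨i, h1, h2, rfl⟩
    · exact ⟨i, h1.le, h2, K.circ.vertex i⟩
    · exact ⟨j, le_rfl, hj, hf.symm⟩
  have hfl := K.flags_fr
  have hB' : Flags Y ε' B' := by
    refine ⟨fun d hd => or_congr (hfl.symm d hd) ⟨fun h => ?_, hA d⟩, fun v hv => ?_⟩
    · rw [← hinv d hd]; exact hA _ h
    by_cases hvA : ∃ i, j ≤ i ∧ i < n ∧ v = (R i).1
    · obtain ⟨i, h1, h2, rfl⟩ := hvA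
      have hiv : (R i).1 ∈ Circ.verts R n := K.circ.mem_verts.2 ⟨i, rfl⟩
      have hBA : ∀ d : V × Fin 3, d.1 = (R i).1 → (B' d ↔ A d) := fun d hd => by
        simp [B', hd, hiv]
      have hR : A (R i) := Or.inl ⟨i, h1, h2, rfl⟩
      have hAi : ∀ d : V × Fin 3, d.1 = (R i).1 → A d →
          d = R i ∨ (j < i ∧ d = L i) ∨ (i = j ∧ d = ε f) := by
        rintro d hd (⟨k, h3, h4, rfl⟩ | ⟨k, h3, h4, rfl⟩ | rfl)
        · obtain rfl := K.inj h4 h2 hd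
          exact Or.inl rfl
        · obtain rfl := K.inj h4 h2 ((K.circ.vertex k).symm.trans hd)
          exact Or.inr (Or.inl ⟨h3, rfl⟩)
        · exact Or.inr (Or.inr ⟨(K.inj hj h2 (hf.trans hd)).symm, rfl⟩)
      obtain ⟨x, y, ht, hx, hy⟩ : ∃ x y, Tri (R i).1 (R i) x y ∧ A x ∧ ¬ A y := by
        by_cases hij : i = j
        · subst hij
          have hne : R i ≠ ε f := fun h => hf' (h ▸ K.circ.markR i)
          obtain ⟨y, ht⟩ := Tri.exists_of_ne hf hne
          refine ⟨_, y, ht, Or.inr (Or.inr rfl), fun h => ?_⟩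
          rcases hAi y ht.e2 h with h | h | h
          · exact ht.n02 h.symm
          · exact absurd h.1 (lt_irrefl i)
          · exact ht.n12 h.2.symm
        · obtain ⟨y, ht⟩ := Tri.exists_of_ne (K.circ.vertex i).symm (K.circ.ne i).symm
          refine ⟨_, y, ht, Or.inr (Or.inl ⟨i, by omega, h2, rfl⟩), fun h => ?_⟩
          rcases hAi y ht.e2 h with h | h | h
          · exact ht.n02 h.symm
          · exact ht.n12 h.2.symm
          · exact hij h.1
      have hsum := ht.sum_eq (fun d => if B' d then (1 : ZMod 2) else 0)
      rw [if_pos ((hBA _ ht.e0).2 hR), if_pos ((hBA _ ht.e1).2 hx),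
        if_neg (fun h => hy ((hBA _ ht.e2).1 h))] at hsum
      exact Eq.trans (by congr!) (hsum.trans (by decide))
    · have : ∀ i, B' (v, i) ↔ B (v, i) ∧ v ∉ Circ.verts R n := fun i => by
        refine or_iff_left fun h => hvA ?_
        exact hAv _ h
      refine Eq.trans ?_ (hfl.even v hv)
      refine Finset.sum_congr rfl fun i _ => by simp only [this i]; congr
  obtain ⟨m, c, h, hm⟩ := hs Y ε' B' K.card_lt K.cubic hB' a K.a_mem
  refine K.finish (h.anti fun d _ hd => Or.inl hd) hm ?_
  by_contra! hcon
  have hc : ∀ i, j ≤ i → i < n → c (R i).1 ≠ c (ε' (R i)).1 := fun i h1 h2 =>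
    (h (R i) (hlive i (by omega) h2) (K.cubic.live _ (hlive i (by omega) h2))).2
      (Or.inr (Or.inl ⟨i, h1, h2, rfl⟩)) (hcon i (by omega) h2)
  have hpar : ∀ t, j + t < n → (c (R (j + t)).1 = c (R j).1 ↔ Even t) := fun t => by
    induction t with
    | zero => simp
    | succ t ih =>
      intro ht
      have h1 := ih (by omega)
      have h2 := hc (j + t) (by omega) (by omega)
      rw [hstep (j + t) ht, K.circ.vertex, add_assoc] at h2
      rw [Nat.even_add_one, ← h1]
      revert h2
      generalize c (R (j + t)).1 = x, c (R (j + (t + 1))).1 = y, c (R j).1 = z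
      revert x y z; decide
  have h1 := hc (n - 1) (by omega) (by omega)
  rw [hlast, ← hf] at h1
  have h2 := hpar (n - 1 - j) (by omega)
  rw [show j + (n - 1 - j) = n - 1 by omega] at h2
  refine h1 (h2.2 ?_)
  rw [show n - 1 - j = n - j - 1 by omega]
  exact Nat.Odd.sub_odd hodd odd_one

/-- If no solution exists, then a narrow cut separates the prescribed dart from the circuit. -/
theorem narrow (K : Root S ε B a u e f R L n) (hs : Solvable V S.card)
    (hno : ¬ ∃ m c, Sol S ε B m c ∧ m a.1 = a.2) :
    (ε f).1 ∉ Circ.verts R n ∧ ∃ X ⊆ S, a.1 ∈ X ∧ (ε u).1 ∉ X ∧ (ε f).1 ∉ X ∧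
      (∀ v ∈ Circ.verts R n, v ∉ X) ∧ (base ε X (insert (ε u).1 (Circ.verts R n))).card ≤ 1 := by
  have hodd : Odd n := by
    by_contra h
    exact hno (K.solve_even hs (Nat.not_odd_iff_even.1 h))
  have hfv : (ε f).1 ∉ Circ.verts R n := by
    intro h
    obtain ⟨j, hj⟩ := K.circ.mem_verts.1 h
    rw [← K.circ.vertex_mod] at hj
    have hlt := Nat.mod_lt j K.circ.pos
    revert hj hlt
    generalize j % n = j
    intro hj hlt
    have h0 : 0 < j := by
      rcases Nat.eq_zero_or_pos j with rfl | h
      · exact absurd (K.root.symm.trans hj) K.ends_ne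
      · exact h
    by_cases hn : Odd (n - j)
    · exact hno (K.solve_same hs h0 hlt hn hj)
    · have K' : Root S ε B a u f e (fun i => R (i + j)) (fun i => L (i + j)) n :=
        ⟨K.irred, K.two, K.four, K.flags, K.aS, K.ua, K.une, K.tri.swap, K.afree, K.ufree,
          K.circ.shift j, by simpa using hj⟩
      refine hno (K'.solve_same hs (j := n - j) (by omega) (by omega) ?_ ?_)
      · grind
      · rw [Nat.sub_add_cancel hlt.le, ← K.root, show n = 0 + n by omega, K.circ.per]
  refine ⟨hfv, ?_⟩
  by_contra! hcon
  have hn1 : n ≠ 1 := by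
    rintro rfl
    have h1 := K.irred.no_loop (K.circ.live 0)
    have h2 := K.circ.per 0
    rw [K.circ.step, K.circ.vertex] at h1
    exact h1 (congrArg Prod.fst h2)
  obtain ⟨k, rfl⟩ : ∃ k, n = 2 * k + 2 + 1 := by
    obtain ⟨k, rfl⟩ := hodd
    exact ⟨k - 1, by omega⟩
  have hmv : ∀ i, (R i).1 ∈ Circ.verts R (2 * k + 2 + 1) := fun i => K.circ.mem_verts.2 ⟨i, rfl⟩
  have hch : Chain (S \ {(ε u).1, (ε e).1}) (fr ε (ε u) f (R 0) (L 0))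
      (fun d => B d ∧ d.1 ∉ Circ.verts R (2 * k + 2 + 1)) a u (fun i => R (i + 1))
      (fun i => L (i + 1)) (2 * k + 2) := by
    have hl : fr ε (ε u) f (R 0) (L 0) (R (2 * k + 2 - 1 + 1)) = ε f := by
      rw [Nat.sub_add_cancel (by omega)]; exact K.fr_last
    refine ⟨K.a_mem, K.ua, K.une, fun i hi => K.vert_mem (by omega) (by omega),
      fun i hi => K.circ.vertex _, fun i hi => K.circ.ne _, fun i hi j => ?_, fun i hi j hj h => ?_,
      fun i hi => (K.vert_ne _).1, K.fr_u, fun i hi => K.fr_step (by omega), fun i hi h => ?_,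
      fun X hX h1 h2 h3 => ?_⟩
    · simp [hmv]
    · have := K.inj (by omega) (by omega) h
      omega
    · rw [hl] at h
      exact hfv (h ▸ hmv _)
    · rw [hl] at h2
      have hX' : ∀ v ∈ X, v ∈ S ∧ v ≠ (ε u).1 ∧ v ≠ (ε e).1 := fun v hv => by simpa using hX hv
      have hXv : ∀ v ∈ Circ.verts R (2 * k + 2 + 1), v ∉ X := by
        intro v hv hvX
        simp only [Circ.verts, Finset.mem_image, Finset.mem_range] at hv
        obtain ⟨i, hi, rfl⟩ := hv
        match i with
        | 0 => exact (hX' _ hvX).2.2 K.root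
        | i + 1 => exact h3 i (by omega) hvX
      refine (hcon X (hX.trans Finset.sdiff_subset) h1 (fun h => (hX' _ h).2.1 rfl) h2 hXv).trans_le
        (Finset.card_le_card fun d hd => ?_)
      rw [mem_base, Finset.mem_insert, not_or] at hd
      have h0 := hmv 0
      rw [mem_base_verts, K.fr_of_vertex hd.2.2.1 fun h => hd.2.2.2 (by rw [h, ← K.root]; exact h0)]
      exact ⟨hd.1, hd.2.1, fun i hi h => hd.2.2.2 (h ▸ hmv _)⟩
  obtain ⟨m, c, h, hm, i, hi, hmi⟩ := hch.hit (hs.mono K.card_lt.le) K.cubic K.flags_fr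
  exact hno (K.finish h hm ⟨i + 1, by omega, by omega, hmi⟩)

end Root

/-- The set `X` contains `w` and is nearly separated by `b` and a marked circuit `C` from the rest,
where `y` and `z` are the further neighbours of `b`. -/
structure Trap (S : Finset V) (ε : V × Fin 3 → V × Fin 3) (B : V × Fin 3 → Prop)
    (w b y z : V) (C X : Finset V) : Prop where
  sub : X ⊆ S
  mem : w ∈ X
  root : b ∉ X
  first : y ∈ C
  second : z ∉ X
  away : z ∉ C
  card : (base ε X (insert b C)).card ≤ 1
  covered : ∀ v ∈ C, ∃ d : V × Fin 3, d.1 = v ∧ B d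
  closedC : ∀ d : V × Fin 3, d.1 ∈ C → B d → (ε d).1 ∈ C
  closedX : ∀ d : V × Fin 3, d.1 ∈ X → B d → (ε d).1 ∈ X
  conn : ∀ Y : Finset V, (∀ d : V × Fin 3, d.1 ∈ Y → B d → (ε d).1 ∈ Y) →
    ∀ v ∈ C, v ∈ Y → ∀ v' ∈ C, v' ∈ Y

namespace Circ

variable {R L : ℕ → V × Fin 3} {n : ℕ}

theorem conn (K : Circ S ε B R L n) {Y : Finset V}
    (hY : ∀ d : V × Fin 3, d.1 ∈ Y → B d → (ε d).1 ∈ Y) {v : V} (hv : v ∈ verts R n)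
    (hvY : v ∈ Y) : ∀ v' ∈ verts R n, v' ∈ Y := by
  intro v' hv'
  obtain ⟨i, rfl⟩ := K.mem_verts.1 hv
  obtain ⟨j, rfl⟩ := K.mem_verts.1 hv'
  have hstep : ∀ k, (R (i + k)).1 ∈ Y := fun k => by
    induction k with
    | zero => exact hvY
    | succ k ih =>
      have := hY _ ih (K.markR _)
      rwa [K.step, K.vertex, add_assoc] at this
  have hn := K.pos
  have h : j + n * i = i + (j + n * i - i) := by
    have := Nat.le_mul_of_pos_left i hn
    omega
  rw [← K.vertex_mod, ← Nat.add_mul_mod_self_left j n i, K.vertex_mod, h]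
  exact hstep _

end Circ

theorem Root.trap {a u e f : V × Fin 3} {R L : ℕ → V × Fin 3} {n : ℕ}
    (K : Root S ε B a u e f R L n) (hs : Solvable V S.card)
    (hno : ¬ ∃ m c, Sol S ε B m c ∧ m a.1 = a.2) :
    ∃ C X, Trap S ε B a.1 (ε u).1 (ε e).1 (ε f).1 C X := by
  obtain ⟨hz, X, hXS, hw, hb, hfX, hCX, hcard⟩ := K.narrow hs hno
  have hC := K.irred.toRev
  refine ⟨Circ.verts R n, X, hXS, hw, hb, K.circ.mem_verts.2 ⟨0, K.root⟩, hfX, hz, hcard,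
    fun v hv => ?_, fun d hd h => K.circ.closed hC K.flags h hd, fun d hd h => ?_,
    fun Y hY v hv hvY => K.circ.conn hY hv hvY⟩
  · obtain ⟨i, rfl⟩ := K.circ.mem_verts.1 hv
    exact ⟨_, rfl, K.circ.markR i⟩
  · by_contra hdX
    have hmem : ∀ d' ∈ cut ε X, B d' → d' ∈ base ε X (insert (ε u).1 (Circ.verts R n)) := by
      intro d' hd' hB'
      rw [mem_cut] at hd'
      rw [mem_base, Finset.mem_insert, not_or]
      refine ⟨hd'.1, hd'.2, fun h' => ?_, fun h' => ?_⟩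
      · exact K.ufree _ h' ((K.flags.symm _ (hXS hd'.1)).2 hB')
      · exact hCX _ ((K.circ.closed_iff hC K.flags (hXS hd'.1) hB').1 h') hd'.1
    have hdc : d ∈ cut ε X := mem_cut.2 ⟨hd, hdX⟩
    have hsum := hC.parity K.flags hXS
    rw [Finset.sum_eq_single_of_mem d hdc, if_pos h] at hsum
    · exact one_ne_zero hsum
    · intro d' hd' hne
      exact if_neg fun h' => hne (Finset.card_le_one.1 hcard _ (hmem d' hd' h') _ (hmem d hdc h))

namespace Trap

variable {a u v e f g h : V × Fin 3} {w b z y y' z' : V} {C C' X' : Finset V}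

theorem eq_of_mem (T : Trap S ε B w b y z C X) {d d' : V × Fin 3}
    (hd : d ∈ base ε X (insert b C)) (hd' : d' ∈ base ε X (insert b C)) : d = d' :=
  Finset.card_le_one.1 T.card _ hd _ hd'

/-- A dart leaving `X` other than the exceptional one ends in `b` or `C`. -/
theorem leaves (T : Trap S ε B w b y z C X) {d d' : V × Fin 3}
    (hd : d ∈ base ε X (insert b C)) (hd' : d'.1 ∈ X) (hne : d' ≠ d) :
    (ε d').1 ∈ X ∨ (ε d').1 = b ∨ (ε d').1 ∈ C := by
  by_contra! hcon
  exact hne (T.eq_of_mem (mem_base.2 ⟨hd', hcon.1, by simp [hcon.2]⟩) hd)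

theorem disjoint_left (T : Trap S ε B w b y z C X) (T' : Trap S ε B w b z y C' X') :
    (∀ x ∈ C', x ∉ X) ∧ ∀ x ∈ C', x ∉ C :=
  ⟨fun x hx h => T.second (T'.conn _ T.closedX x hx h _ T'.first),
    fun x hx h => T.away (T'.conn _ T.closedC x hx h _ T'.first)⟩

theorem pair (hI : Irred S ε) (ta : Tri w a u v) (tb : Tri b (ε u) e f) (hS : w ∈ S)
    (T : Trap S ε B w b (ε e).1 (ε f).1 C X) (T' : Trap S ε B w b (ε f).1 (ε e).1 C' X') :
    (∀ x ∈ X, x ∈ X' → x = w) ∧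
      ((a ∈ base ε X (insert b C) ∧ v ∈ base ε X' (insert b C')) ∨
        (v ∈ base ε X (insert b C) ∧ a ∈ base ε X' (insert b C'))) := by
  have huS : u.1 ∈ S := ta.e1 ▸ hS
  have hbS : b ∈ S := tb.e0 ▸ hI.live u huS
  have heS : e.1 ∈ S := tb.e1 ▸ hbS
  have h1 := T.disjoint_left T'
  have h2 := T'.disjoint_left T
  have hYS : X ∩ X' ⊆ S := Finset.inter_subset_left.trans T.sub
  have hto : ∀ d : V × Fin 3, d.1 ∈ X → d.1 ∈ X' → (ε d).1 = b → d = u := by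
    intro d hd hd' h
    have hdS := T.sub hd
    rcases tb.cases h with h | h | h
    · exact hI.inj hdS huS h
    · exact absurd hd' (by rw [← hI.invol d hdS, h]; exact T'.second)
    · exact absurd hd (by rw [← hI.invol d hdS, h]; exact T.second)
  have hcut : ∀ d ∈ cut ε (X ∩ X'), d ≠ u →
      d ∈ base ε X (insert b C) ∨ d ∈ base ε X' (insert b C') := by
    intro d hd hdu
    rw [mem_cut, Finset.mem_inter, Finset.mem_inter] at hd
    have hb : (ε d).1 ≠ b := fun h => hdu (hto d hd.1.1 hd.1.2 h)
    simp only [mem_base, Finset.mem_insert, not_or]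
    have h3 := h1.1 (ε d).1
    have h4 := h1.2 (ε d).1
    have h5 := h2.1 (ε d).1
    clear * - hd hb h3 h4 h5
    tauto
  have hle : (cut ε (X ∩ X')).card ≤ 3 := by
    have hsub : cut ε (X ∩ X') ⊆
        insert u (base ε X (insert b C) ∪ base ε X' (insert b C')) := by
      intro d hd
      rw [Finset.mem_insert, Finset.mem_union]
      exact or_iff_not_imp_left.2 (hcut d hd)
    refine (Finset.card_le_card hsub).trans ((Finset.card_insert_le _ _).trans ?_)
    have := Finset.card_union_le (base ε X (insert b C)) (base ε X' (insert b C'))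
    have := T.card
    have := T'.card
    omega
  have hwY : w ∈ X ∩ X' := Finset.mem_inter.2 ⟨T.mem, T'.mem⟩
  have hbY : b ∈ S \ (X ∩ X') := by simp [hbS, T.root]
  have hyY : (ε e).1 ∈ S \ (X ∩ X') := by simp [hI.live e heS, T'.second]
  have hge := hI.three_le (X ∩ X') hYS ⟨w, hwY⟩ ⟨b, hbY⟩
  have hone : (X ∩ X').card ≤ 1 := by
    refine (hI.three _ hYS (le_antisymm hle hge)).resolve_right fun h => ?_
    refine hI.no_loop heS ?_
    rw [tb.e1]
    exact Finset.card_le_one.1 h _ hyY _ hbY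
  have heq : ∀ x ∈ X, x ∈ X' → x = w := fun x hx hx' =>
    Finset.card_le_one.1 hone _ (Finset.mem_inter.2 ⟨hx, hx'⟩) _ hwY
  refine ⟨heq, ?_⟩
  have hmem : ∀ d : V × Fin 3, d.1 = w → d ∈ cut ε (X ∩ X') := by
    intro d hd
    rw [mem_cut, hd]
    refine ⟨hwY, fun h => hI.no_loop (d := d) (by rwa [hd]) ?_⟩
    rw [Finset.mem_inter] at h
    rw [heq _ h.1 h.2, hd]
  rcases hcut a (hmem a ta.e0) ta.n01 with h3 | h3 <;>
    rcases hcut v (hmem v ta.e2) ta.n12.symm with h4 | h4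
  · exact absurd (T.eq_of_mem h3 h4) ta.n02
  · exact Or.inl ⟨h3, h4⟩
  · exact Or.inr ⟨h4, h3⟩
  · exact absurd (T'.eq_of_mem h3 h4) ta.n02

theorem false_of_exceptional {c : V} {D Z : Finset V} (hI : Irred S ε) (h2 : 2 < S.card)
    (hS : w ∈ S) (ta : Tri w a u v) (tb : Tri b (ε u) e f) (tc : Tri c (ε v) g h)
    (hw : ∀ d : V × Fin 3, d.1 = w → ¬ B d) (hb : ∀ d : V × Fin 3, d.1 = b → ¬ B d)
    (hc : ∀ d : V × Fin 3, d.1 = c → ¬ B d)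
    (T : Trap S ε B w b (ε e).1 (ε f).1 C X) (T' : Trap S ε B w b (ε f).1 (ε e).1 C' X')
    (U : Trap S ε B w c (ε g).1 (ε h).1 D Z) (hX : ∀ x ∈ X, x ∈ X' → x = w)
    (hT : a ∈ base ε X (insert b C)) (hT' : v ∈ base ε X' (insert b C'))
    (hU : a ∈ base ε Z (insert c D)) : False := by
  have huS : u.1 ∈ S := ta.e1 ▸ hS
  have hvS : v.1 ∈ S := ta.e2 ▸ hS
  have hbS : b ∈ S := tb.e0 ▸ hI.live u huS
  have hcS : c ∈ S := tc.e0 ▸ hI.live v hvS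
  have hwb : b ≠ w := fun h => hI.no_loop huS (by rw [tb.e0, h, ta.e1])
  have hwc : c ≠ w := fun h => hI.no_loop hvS (by rw [tc.e0, h, ta.e2])
  have hbc : b ≠ c := fun h => ta.n12
    (hI.simple h2 huS (ta.e1.trans ta.e2.symm) (by rw [tb.e0, tc.e0, h]))
  have unc : ∀ {w b y z C X x}, Trap S ε B w b y z C X → (∀ d : V × Fin 3, d.1 = x → ¬ B d) →
      x ∉ C := fun T hx hxC => by
    obtain ⟨d, hd, h⟩ := T.covered _ hxC
    exact hx d hd h
  have hCC := T.disjoint_left T'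
  have hcX : c ∈ X := by
    rcases T.leaves hT (d' := v) (by rw [ta.e2]; exact T.mem) ta.n02.symm with h | h | h
    · rwa [tc.e0] at h
    · exact absurd (tb.e0.symm.trans (by rw [tb.e0, ← h, tc.e0])) hbc
    · exact absurd h (unc T (by rwa [tc.e0]))
  have hDC : ∀ x ∈ D, x ∉ C' := by
    intro x hx hxC
    have hga : g ≠ a := fun h => hwc (by rw [← tc.e1, h, ta.e0])
    rcases T.leaves hT (d' := g) (by rwa [tc.e1]) hga with h | h | h
    · exact hCC.1 x hxC (U.conn _ T.closedX _ U.first h x hx)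
    · exact unc U (by rwa [h]) U.first
    · exact hCC.2 x hxC (U.conn _ T.closedC _ U.first h x hx)
  have hbZ : b ∈ Z := by
    rcases U.leaves hU (d' := u) (by rw [ta.e1]; exact U.mem) ta.n01.symm with h | h | h
    · rwa [tb.e0] at h
    · exact absurd (tb.e0.symm.trans h) hbc
    · exact absurd h (unc U (by rwa [tb.e0]))
  have hCZ : ∀ x ∈ C', x ∈ Z := by
    have hfa : f ≠ a := fun h => hwb (by rw [← tb.e2, h, ta.e0])
    refine T'.conn _ U.closedX _ T'.first ?_
    rcases U.leaves hU (d' := f) (by rwa [tb.e2]) hfa with h | h | h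
    · exact h
    · exact absurd T'.first (unc T' (by rwa [h]))
    · exact absurd T'.first (hDC _ h)
  have haZ := (mem_base.1 hU).2.1
  have haX' : (ε a).1 ∈ X' := by
    rcases T'.leaves hT' (d' := a) (by rw [ta.e0]; exact T'.mem) ta.n02 with h | h | h
    · exact h
    · exact absurd (hI.simple h2 (d := a) (by rwa [ta.e0]) (ta.e0.trans ta.e1.symm)
        (by rw [h, tb.e0])) ta.n01
    · exact absurd (hCZ _ h) haZ
  have hcX' : c ∉ X' := fun h => hwc (hX c hcX h)
  have hDX' : ∀ x ∈ D, x ∉ X' := by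
    intro x hx hxX
    have hg := U.conn _ T'.closedX x hx hxX _ U.first
    have hgg := hI.invol g (by rwa [tc.e1])
    have hne : ε g ≠ v := fun h => unc U hw (by rw [← ta.e2, ← h]; exact U.first)
    rcases T'.leaves hT' hg hne with h | h | h <;> rw [hgg, tc.e1] at h
    · exact hcX' h
    · exact hbc h.symm
    · exact unc T' hc h
  refine hI.bridgeless (X' \ Z) (Finset.sdiff_subset.trans T'.sub) ?_
  rw [Finset.card_eq_one]
  refine ⟨ε a, ?_⟩
  ext d
  rw [mem_cut, Finset.mem_sdiff, Finset.mem_sdiff, Finset.mem_singleton]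
  have haS : a.1 ∈ S := by rwa [ta.e0]
  constructor
  · rintro ⟨⟨hdX, hdZ⟩, hd⟩
    have hdS := T'.sub hdX
    have hrev := hI.invol d hdS
    by_cases hZ : (ε d).1 ∈ Z
    · by_contra hne
      have hne' : ε d ≠ a := fun h => hne (by rw [← h, hrev])
      rcases U.leaves hU hZ hne' with h | h | h <;> rw [hrev] at h
      · exact hdZ h
      · exact hcX' (h ▸ hdX)
      · exact hDX' _ h hdX
    · have hdv : d ≠ v := fun h => hdZ (by rw [h, ta.e2]; exact U.mem)
      rcases T'.leaves hT' hdX hdv with h | h | h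
      · exact absurd ⟨h, hZ⟩ hd
      · exact absurd (h ▸ hbZ) hZ
      · exact absurd (hCZ _ h) hZ
  · rintro rfl
    rw [hI.invol a haS, ta.e0]
    exact ⟨⟨haX', haZ⟩, fun h => h.2 U.mem⟩

end Trap

/-- A dart of the second neighbour of `a.1` lies in a marked circuit when `a` cannot be
prescribed. -/
theorem Irred.second_covered (hs : Solvable V S.card) (hI : Irred S ε) (hB : Flags S ε B)
    (h2 : 2 < S.card) (h4 : S.card ≠ 4) {a u e : V × Fin 3} (ha : a.1 ∈ S) (hu : u.1 = a.1)
    (hua : u ≠ a) (he : e.1 = (ε u).1) (heu : e ≠ ε u)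
    (hno : ¬ ∃ m c, Sol S ε B m c ∧ m a.1 = a.2) :
    (∀ d : V × Fin 3, d.1 = (ε u).1 → ¬ B d) ∧ ∃ d : V × Fin 3, d.1 = (ε e).1 ∧ B d := by
  have hfree : ∀ d : V × Fin 3, d.1 = (ε u).1 → ¬ B d := by
    have hne : ∀ d : V × Fin 3, d.1 = (ε u).1 → d ≠ ε u → ¬ B d := fun d hd hdu h =>
      hno (hs.of_edge hI hB h2 h4 ha hu hua hd hdu (Or.inl h))
    intro d hd h
    obtain ⟨d', h1, h2, h3⟩ := hB.exists_other (by rw [hd]; exact hI.live u (hu ▸ ha)) h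
    by_cases hdu : d = ε u
    · exact hne d' (h1.trans hd) (hdu ▸ h2) h3
    · exact hne d hd hdu h
  refine ⟨hfree, ?_⟩
  by_contra! hcon
  refine hno (hs.of_edge hI hB h2 h4 ha hu hua he heu (Or.inr ?_))
  rintro d (hd | hd)
  · exact hfree d hd
  · exact hcon d hd

theorem Irred.solve (hs : Solvable V S.card) (hI : Irred S ε) (hB : Flags S ε B)
    {a : V × Fin 3} (ha : a.1 ∈ S) : ∃ m c, Sol S ε B m c ∧ m a.1 = a.2 := by
  by_cases h2' : S.card = 2
  · exact hI.toCubic.solve_two h2' ha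
  by_cases h4 : S.card = 4
  · exact hI.solve_four h4 ha
  have h2 : 2 < S.card := by
    have : 1 < S.card := Finset.one_lt_card.2 ⟨_, hI.live a ha, _, ha, hI.no_loop ha⟩
    omega
  by_contra hno
  obtain ⟨u, v, ta⟩ := Tri.exists_left a
  have sec := fun {x e : V × Fin 3} (hx : x.1 = a.1) (hxa : x ≠ a) (he : e.1 = (ε x).1)
    (hex : e ≠ ε x) => hI.second_covered hs hB h2 h4 ha hx hxa he hex hno
  have free : ∀ x : V × Fin 3, x.1 = a.1 → x ≠ a → ∀ d : V × Fin 3, d.1 = (ε x).1 → ¬ B d := by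
    intro x hx hxa
    obtain ⟨e, f, ht⟩ := Tri.exists_left (ε x)
    exact (sec hx hxa ht.e1 ht.n01.symm).1
  have wfree : ∀ d : V × Fin 3, d.1 = a.1 → ¬ B d := by
    have hne : ∀ x : V × Fin 3, x.1 = a.1 → x ≠ a → ¬ B x := fun x hx hxa h =>
      free x hx hxa _ rfl ((hB.symm x (hx ▸ ha)).2 h)
    intro d hd h
    by_cases hda : d = a
    · obtain ⟨d', h1, h2, h3⟩ := hB.exists_other (by rwa [hd]) h
      exact hne d' (h1.trans hd) (hda ▸ h2) h3
    · exact hne d hd hda h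
  have trap : ∀ x e f : V × Fin 3, x.1 = a.1 → x ≠ a → Tri (ε x).1 (ε x) e f →
      ∃ C X, Trap S ε B a.1 (ε x).1 (ε e).1 (ε f).1 C X := by
    intro x e f hx hxa ht
    obtain ⟨d, hd, hBd⟩ := (sec hx hxa ht.e1 ht.n01.symm).2
    have hdS : d.1 ∈ S := by
      rw [hd]
      exact hI.live e (by rw [ht.e1]; exact hI.live x (hx ▸ ha))
    obtain ⟨R, L, n, K, hR⟩ := hB.exists_circ hI.toRev hdS hBd
    exact Root.trap ⟨hI, h2, h4, hB, ha, hx, hxa, ht, wfree, free x hx hxa, K, hR ▸ hd⟩ hs hno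
  have pairs : ∀ x y : V × Fin 3, Tri a.1 a x y → ∃ e f C C' X X',
      Tri (ε x).1 (ε x) e f ∧ Trap S ε B a.1 (ε x).1 (ε e).1 (ε f).1 C X ∧
      Trap S ε B a.1 (ε x).1 (ε f).1 (ε e).1 C' X' ∧ (∀ t ∈ X, t ∈ X' → t = a.1) ∧
      a ∈ base ε X (insert (ε x).1 C) ∧ y ∈ base ε X' (insert (ε x).1 C') := by
    intro x y ht
    obtain ⟨e, f, hx⟩ := Tri.exists_left (ε x)
    obtain ⟨C, X, T⟩ := trap x e f ht.e1 ht.n01.symm hx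
    obtain ⟨C', X', T'⟩ := trap x f e ht.e1 ht.n01.symm hx.swap
    obtain ⟨h, h' | h'⟩ := Trap.pair hI ht hx ha T T'
    · exact ⟨e, f, C, C', X, X', hx, T, T', h, h'⟩
    · exact ⟨f, e, C', C, X', X, hx.swap, T', T, fun t h1 h2 => h t h2 h1, h'.2, h'.1⟩
  obtain ⟨e, f, C, C', X, X', tb, T, T', hX, hT, hT'⟩ := pairs u v ta
  obtain ⟨g, h, D, D', Z, Z', tc, U, U', hZ, hU, hU'⟩ := pairs v u ta.swap
  exact Trap.false_of_exceptional hI h2 ha ta tb tc wfree (free u ta.e1 ta.n01.symm)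
    (free v ta.e2 ta.n02.symm) T T' U hX hT hT' hU

theorem solvable (n : ℕ) : Solvable V n := by
  induction n with
  | zero => exact fun S ε B h => absurd h (Nat.not_lt_zero _)
  | succ n ih =>
    intro S ε B hn hC hB a ha
    have hs : Solvable V S.card := ih.mono (Nat.lt_succ_iff.1 hn)
    exact hs.of_irred hC hB ha fun hI => hI.solve hs hB ha

end CubicDart

namespace SimpleGraph

open CubicDart

variable {V : Type*} {G : SimpleGraph V}

/-- The dart reversal of a cubic graph whose neighbourhoods are labelled by `Fin 3`. -/
noncomputable def dartRev (e : ∀ v, G.neighborSet v ≃ Fin 3) (d : V × Fin 3) : V × Fin 3 :=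
  (((e d.1).symm d.2 : V), e _ ⟨d.1, ((e d.1).symm d.2).2.symm⟩)

variable (e : ∀ v, G.neighborSet v ≃ Fin 3)

theorem dartRev_label {v w : V} (h : G.Adj v w) :
    dartRev e (v, e v ⟨w, h⟩) = (w, e w ⟨v, h.symm⟩) := by
  have key : ∀ x : G.neighborSet v, x = ⟨w, h⟩ →
      ((x : V), e x ⟨v, x.2.symm⟩) = (w, e w ⟨v, h.symm⟩) := by
    rintro _ rfl; rfl
  exact key _ ((e v).symm_apply_apply _)

theorem exists_label (d : V × Fin 3) : ∃ w, ∃ h : G.Adj d.1 w, d = (d.1, e d.1 ⟨w, h⟩) :=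
  ⟨_, ((e d.1).symm d.2).2, by simp⟩

theorem dartRev_rev [Fintype V] : Rev Finset.univ (dartRev e) := by
  refine ⟨fun _ _ => Finset.mem_univ _, fun d _ => ?_, fun d _ => ?_⟩ <;>
    obtain ⟨w, h, hd⟩ := exists_label e d <;> rw [hd, dartRev_label]
  · rw [dartRev_label]
  · exact fun h' => h.ne (congrArg Prod.fst h').symm

theorem dartRev_cubic [Fintype V] (hG : ∀ s : Sym2 V, ¬ G.IsBridge s) :
    Cubic Finset.univ (dartRev e) := by
  refine ⟨dartRev_rev e, fun X _ hX => ?_⟩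
  obtain ⟨d, hd⟩ := Finset.card_eq_one.1 hX
  have hmem : d ∈ cut (dartRev e) X := by rw [hd]; exact Finset.mem_singleton_self d
  obtain ⟨w, h, hdw⟩ := exists_label e d
  have hdX := mem_cut.1 hmem
  rw [hdw, dartRev_label] at hdX
  have hstay : ∀ x y, (G.deleteEdges {s(d.1, w)}).Adj x y → x ∈ X → y ∈ X := by
    intro x y hxy hx
    rw [deleteEdges_adj] at hxy
    by_contra hy
    have hm : (x, e x ⟨y, hxy.1⟩) ∈ cut (dartRev e) X := mem_cut.2 ⟨hx, by rwa [dartRev_label]⟩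
    rw [hd, Finset.mem_singleton] at hm
    have h1 : x = d.1 := congrArg Prod.fst hm
    subst h1
    have h2 : (⟨y, hxy.1⟩ : G.neighborSet d.1) = ⟨w, h⟩ :=
      (e d.1).injective (congrArg Prod.snd (hm.trans hdw))
    have h3 : y = w := congrArg Subtype.val h2
    exact hxy.2 (by rw [h3]; rfl)
  refine hG s(d.1, w) (isBridge_iff.2 fun hr => ?_)
  obtain ⟨p⟩ := hr
  have : ∀ {x y} (p : (G.deleteEdges {s(d.1, w)}).Walk x y), x ∈ X → y ∈ X := by
    intro x y p
    induction p with
    | nil => exact id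
    | cons hxy _ ih => exact fun hx => ih (hstay _ _ hxy hx)
  exact hdX.2 (this p hdX.1)

theorem dartRev_flags [Fintype V] {N : G.Subgraph} (hN : N.IsPerfectMatching) :
    Flags Finset.univ (dartRev e) fun d => ¬ N.Adj d.1 (dartRev e d).1 := by
  refine Flags.of_tri (fun d _ => ?_) fun v _ => ?_
  · rw [(dartRev_rev e).invol d (Finset.mem_univ _), N.adj_comm]
  · obtain ⟨w, hw, huniq⟩ := hN.1 (hN.2 v)
    obtain ⟨Q, R, ht⟩ := Tri.exists_left (v, e v ⟨w, hw.adj_sub⟩)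
    have hne : ∀ d : V × Fin 3, d.1 = v → (v, e v ⟨w, hw.adj_sub⟩) ≠ d →
        ¬ N.Adj d.1 (dartRev e d).1 := by
      rintro ⟨x, i⟩ rfl hne hadj
      obtain ⟨y, hy, hd⟩ := exists_label e (x, i)
      rw [hd, dartRev_label] at hadj
      obtain rfl := huniq y hadj
      exact hne hd.symm
    refine ⟨_, _, _, ht, Or.inr ⟨?_, iff_of_true (hne _ ht.e1 ht.n01) (hne _ ht.e2 ht.n02)⟩⟩
    rw [dartRev_label]
    exact not_not.2 hw

/-- The subgraph formed by the chosen darts. -/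
def selected {m : V → Fin 3} (h : ∀ d : V × Fin 3, m d.1 = d.2 →
    m (dartRev e d).1 = (dartRev e d).2) : G.Subgraph where
  verts := Set.univ
  Adj v w := ∃ hvw : G.Adj v w, m v = e v ⟨w, hvw⟩
  adj_sub h := h.1
  edge_vert _ := Set.mem_univ _
  symm := ⟨fun v w ⟨hvw, hm⟩ => ⟨hvw.symm, by
    have := h (v, e v ⟨w, hvw⟩) hm
    rwa [dartRev_label] at this⟩⟩

theorem selected_isPerfectMatching {m : V → Fin 3} (h : ∀ d : V × Fin 3, m d.1 = d.2 →
    m (dartRev e d).1 = (dartRev e d).2) : (selected e h).IsPerfectMatching := by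
  refine ⟨fun v _ => ?_, fun _ => Set.mem_univ _⟩
  obtain ⟨w, hvw, hd⟩ := exists_label e (v, m v)
  have hm : m v = e v ⟨w, hvw⟩ := congrArg Prod.snd hd
  refine ⟨w, ⟨hvw, hm⟩, ?_⟩
  rintro y ⟨hvy, hy⟩
  exact congrArg Subtype.val ((e v).injective (hy.symm.trans hm))

end SimpleGraph

/-- Every perfect matching `N` of a bridgeless cubic graph `G` extends to an `S₄`-pair:
there is a perfect matching `M` of `G` such that deleting the edges of `N` and `M`
leaves a bipartite graph. -/
theorem perfect_matching_extends_to_S4_pair {V : Type*} [Fintype V] (G : SimpleGraph V)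
    (hcubic : ∀ v : V, (G.neighborSet v).ncard = 3)
    (hbridgeless : ∀ e : Sym2 V, ¬ G.IsBridge e)
    (N : G.Subgraph) (hN : N.IsPerfectMatching) :
    ∃ M : G.Subgraph, M.IsPerfectMatching ∧
      (G.deleteEdges (N.edgeSet ∪ M.edgeSet)).Colorable 2 := by
  classical
  have e : ∀ v, G.neighborSet v ≃ Fin 3 := fun v =>
    Fintype.equivFinOfCardEq (by rw [← Nat.card_eq_fintype_card]; exact hcubic v)
  rcases isEmpty_or_nonempty V with hV | ⟨⟨a⟩⟩
  · exact ⟨N, hN, ⟨SimpleGraph.Coloring.mk (fun v => (hV.false v).elim)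
      fun {v} => (hV.false v).elim⟩⟩
  obtain ⟨m, c, h, -⟩ := CubicDart.solvable (V := V) (Fintype.card V + 1) Finset.univ _ _
    (Nat.lt_succ_self _) (SimpleGraph.dartRev_cubic e hbridgeless) (SimpleGraph.dartRev_flags e hN)
    (a, 0) (Finset.mem_univ _)
  have h' := fun d => h d (Finset.mem_univ _) (Finset.mem_univ _)
  refine ⟨_, SimpleGraph.selected_isPerfectMatching e fun d => (h' d).1, ?_⟩
  have hcol : ∀ {v w}, (G.deleteEdges (N.edgeSet ∪
      (SimpleGraph.selected e fun d => (h' d).1).edgeSet)).Adj v w → c v ≠ c w := by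
    intro v w hvw
    rw [SimpleGraph.deleteEdges_adj, Set.mem_union, not_or, SimpleGraph.Subgraph.mem_edgeSet,
      SimpleGraph.Subgraph.mem_edgeSet] at hvw
    obtain ⟨hadj, hNvw, hM⟩ := hvw
    have := (h' (v, e v ⟨w, hadj⟩)).2
    simp only [SimpleGraph.dartRev_label] at this
    exact this hNvw fun hm => hM ⟨hadj, hm⟩
  simpa using (SimpleGraph.Coloring.mk c hcol).colorable
end

section
/- The following two statements are equivalent for the class of bridgeless cubic graphs: (1) for every bridgeless cubic graph G and every perfect matching N of G, there is a perfect matching M with G \ (N ∪ M) bipartite; (2) for every bridgeless cubic graph G and every collection 𝒪 of pairwise disjoint odd circuits of G, there is a perfect matching M of G intersecting the edge set of every circuit in 𝒪. -/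
namespace SimpleGraph

variable {V : Type*} {G : SimpleGraph V}

/-! ### Odd cycles and two-colourability -/

/-- A path closed up by an edge is a cycle, provided its total length is odd. -/
lemma Walk.IsPath.cons_isCycle_of_odd {u v : V} {p : G.Walk v u} (hp : p.IsPath)
    (h : G.Adj u v) (hodd : Odd (p.length + 1)) : (Walk.cons h p).IsCycle := by
  rw [Walk.cons_isCycle_iff]
  refine ⟨hp, fun he => ?_⟩
  cases p with
  | nil => exact h.ne rfl
  | cons h' q =>
    rw [Walk.cons_isPath_iff] at hp
    rw [Walk.edges_cons, List.mem_cons] at he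
    rcases he with he | he
    · rcases Sym2.eq_iff.mp he with ⟨h₁, -⟩ | ⟨h₁, -⟩
      · exact h.ne h₁
      · subst h₁
        obtain rfl := (Walk.isPath_iff_nil.mp hp.1).eq_nil
        simp only [Walk.length_cons, Walk.length_nil] at hodd
        exact absurd hodd (by decide)
    · exact hp.2 (q.snd_mem_support_of_mem_edges he)

/-- In a graph whose cycles are all even, shortcutting a walk to a path keeps its parity. -/
lemma Walk.even_length_bypass_iff [DecidableEq V]
    (hG : ∀ (u : V) (c : G.Walk u u), c.IsCycle → Even c.length) {u v : V} (p : G.Walk u v) :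
    Even p.bypass.length ↔ Even p.length := by
  induction p with
  | nil => simp [Walk.bypass]
  | cons h p ih =>
    rw [Walk.bypass]
    split_ifs with hs
    · have hlen := congrArg Walk.length (p.bypass.take_spec hs)
      rw [Walk.length_append] at hlen
      have hpath : (p.bypass.takeUntil _ hs).IsPath := p.bypass_isPath.takeUntil hs
      have heven : Even ((p.bypass.takeUntil _ hs).length + 1) := by
        by_contra hne
        have hodd := Nat.not_even_iff_odd.mp hne
        exact hne (by simpa using hG _ _ (hpath.cons_isCycle_of_odd h hodd))
      rw [Walk.length_cons]
      grind
    · rw [Walk.length_cons, Walk.length_cons, Nat.even_add_one, Nat.even_add_one, ih]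

/-- A graph all of whose cycles are even is two-colourable. -/
lemma colorable_two_of_forall_isCycle_even
    (hG : ∀ (u : V) (c : G.Walk u u), c.IsCycle → Even c.length) : G.Colorable 2 := by
  classical
  rw [two_colorable_iff_forall_loop_even]
  intro u w
  rw [← Walk.even_length_bypass_iff hG, (Walk.isPath_iff_nil.mp w.bypass_isPath).eq_nil]
  simp

/-- The edge set of the subgraph of a trail has as many elements as the trail is long. -/
lemma Walk.IsTrail.ncard_edgeSet_toSubgraph {u v : V} {p : G.Walk u v} (hp : p.IsTrail) :
    p.toSubgraph.edgeSet.ncard = p.length := by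
  classical
  rw [Walk.edgeSet_toSubgraph, ← Walk.length_edges, ← List.toFinset_card_of_nodup hp.edges_nodup,
    ← Set.ncard_coe_finset]
  congr 1
  ext e
  simp

/-- A two-colourable graph in which every vertex has an even number of neighbours has an
even number of edges. -/
lemma Colorable.even_ncard_edgeSet [Finite V] (hG : G.Colorable 2)
    (hdeg : ∀ v, Even (G.neighborSet v).ncard) : Even G.edgeSet.ncard := by
  classical
  have := Fintype.ofFinite V
  obtain ⟨s, t, hst⟩ := IsBipartite.exists_isBipartiteWith hG
  have hst' : G.IsBipartiteWith (s.toFinset : Set V) (t.toFinset : Set V) := by simpa using hst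
  have hsum := isBipartiteWith_sum_degrees_eq_card_edges hst'
  rw [← coe_edgeFinset, Set.ncard_coe_finset, ← hsum]
  refine Finset.even_sum _ fun v _ => ?_
  have := hdeg v
  rwa [← coe_neighborFinset, Set.ncard_coe_finset, card_neighborFinset_eq_degree] at this

/-! ### Two-regular connected subgraphs -/

/-- A connected subgraph contains every nonempty vertex set closed under its adjacency. -/
lemma Subgraph.Connected.forall_verts {C : G.Subgraph} (hC : C.Connected) {P : V → Prop} {v : V}
    (hv : v ∈ C.verts) (hPv : P v) (hP : ∀ x y, C.Adj x y → P x → P y) :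
    ∀ w ∈ C.verts, P w := by
  intro w hw
  obtain ⟨p⟩ := hC.coe.preconnected ⟨v, hv⟩ ⟨w, hw⟩
  suffices h : ∀ (x y : C.verts) (_ : C.coe.Walk x y), P x → P y from h _ _ p hPv
  intro x y q
  induction q with
  | nil => exact id
  | cons h q ih => exact fun hx => ih (hP _ _ h hx)

/-- In a graph where every vertex has two neighbours, two connected subgraphs in which every
vertex has two neighbours coincide as soon as they share a vertex. -/
lemma Subgraph.eq_of_mem_verts_of_ncard_neighborSet [Finite V] {R : SimpleGraph V}
    (hR : ∀ v, (R.neighborSet v).ncard = 2) {C D : G.Subgraph}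
    (hC : C.Connected) (hD : D.Connected)
    (hC₂ : ∀ v ∈ C.verts, (C.neighborSet v).ncard = 2)
    (hD₂ : ∀ v ∈ D.verts, (D.neighborSet v).ncard = 2)
    (hCR : ∀ x y, C.Adj x y → R.Adj x y) (hDR : ∀ x y, D.Adj x y → R.Adj x y)
    {v : V} (hvC : v ∈ C.verts) (hvD : v ∈ D.verts) : C = D := by
  have hCn : ∀ x ∈ C.verts, ∀ y, C.Adj x y ↔ R.Adj x y := fun x hx y =>
    Set.ext_iff.mp (Set.eq_of_subset_of_ncard_le (s := C.neighborSet x) (t := R.neighborSet x)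
      (fun y hy => hCR x y hy) (by rw [hR, hC₂ x hx])) y
  have hDn : ∀ x ∈ D.verts, ∀ y, D.Adj x y ↔ R.Adj x y := fun x hx y =>
    Set.ext_iff.mp (Set.eq_of_subset_of_ncard_le (s := D.neighborSet x) (t := R.neighborSet x)
      (fun y hy => hDR x y hy) (by rw [hR, hD₂ x hx])) y
  have hCD : ∀ w ∈ C.verts, w ∈ D.verts := hC.forall_verts hvC hvD fun x y hxy hx =>
    ((hDn x hx y).mpr (hCR x y hxy)).snd_mem
  have hDC : ∀ w ∈ D.verts, w ∈ C.verts := hD.forall_verts hvD hvC fun x y hxy hx =>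
    ((hCn x hx y).mpr (hDR x y hxy)).snd_mem
  refine Subgraph.ext (Set.Subset.antisymm hCD hDC) ?_
  funext x y
  refine propext ⟨fun h => ?_, fun h => ?_⟩
  · exact (hDn x (hCD x h.fst_mem) y).mpr (hCR x y h)
  · exact (hCn x (hDC x h.fst_mem) y).mpr (hDR x y h)

/-- Deleting a perfect matching from a cubic graph leaves two neighbours at every vertex. -/
lemma Subgraph.IsPerfectMatching.ncard_neighborSet_deleteEdges [Finite V]
    (hG : ∀ v, (G.neighborSet v).ncard = 3) {N : G.Subgraph} (hN : N.IsPerfectMatching) (v : V) :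
    ((G.deleteEdges N.edgeSet).neighborSet v).ncard = 2 := by
  obtain ⟨w, hw, huniq⟩ := Subgraph.isPerfectMatching_iff.mp hN v
  have : (G.deleteEdges N.edgeSet).neighborSet v = G.neighborSet v \ {w} := by
    ext x
    simp only [SimpleGraph.mem_neighborSet, SimpleGraph.deleteEdges_adj, Subgraph.mem_edgeSet, Set.mem_sdiff,
      Set.mem_singleton_iff]
    exact and_congr_right fun _ => not_congr ⟨huniq x, fun h => h ▸ hw⟩
  rw [this, Set.ncard_sdiff_singleton_of_mem (show w ∈ G.neighborSet v from hw.adj_sub), hG]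

/-- If a perfect matching `M` hits every odd circuit avoiding a perfect matching `N`, then
deleting `N ∪ M` leaves a bipartite graph. -/
lemma colorable_two_deleteEdges_of_forall_nonempty {N M : G.Subgraph}
    (hM : ∀ C : G.Subgraph, C.Connected → (∀ v ∈ C.verts, (C.neighborSet v).ncard = 2) →
      Odd C.edgeSet.ncard → Disjoint C.edgeSet N.edgeSet → (M.edgeSet ∩ C.edgeSet).Nonempty) :
    (G.deleteEdges (N.edgeSet ∪ M.edgeSet)).Colorable 2 := by
  refine colorable_two_of_forall_isCycle_even fun u c hc => ?_
  by_contra hne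
  have hle : G.deleteEdges (N.edgeSet ∪ M.edgeSet) ≤ G := deleteEdges_le _
  have hc' : (c.mapLe hle).IsCycle := hc.mapLe hle
  have hmem : ∀ e ∈ (c.mapLe hle).toSubgraph.edgeSet, e ∉ N.edgeSet ∪ M.edgeSet := by
    intro e he
    rw [Walk.mem_edges_toSubgraph, Walk.edges_mapLe_eq_edges] at he
    have := c.edges_subset_edgeSet he
    rw [edgeSet_deleteEdges] at this
    exact this.2
  obtain ⟨e, heM, heC⟩ := hM (c.mapLe hle).toSubgraph (Walk.toSubgraph_connected _)
    (fun v hv => hc'.ncard_neighborSet_toSubgraph_eq_two ((Walk.mem_verts_toSubgraph _).mp hv))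
    (by
      rw [hc'.isTrail.ncard_edgeSet_toSubgraph]
      simpa using hne)
    (Set.disjoint_left.mpr fun e he heN => hmem e he (Or.inl heN))
  exact hmem e heC (Or.inr heM)

/-! ### Expanding vertices into triangles -/

/-- The vertices of the graph obtained from `G` by expanding each vertex outside `U`: a vertex
`v ∈ U` is kept as `(v, v)`, and `v ∉ U` is replaced by the pairs `(v, w)` with `w` adjacent
to `v`. -/
abbrev ExpansionVertex (G : SimpleGraph V) (U : Set V) : Type _ :=
  {p : V × V // (p.1 ∈ U ∧ p.2 = p.1) ∨ (p.1 ∉ U ∧ G.Adj p.1 p.2)}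

/-- The graph obtained from `G` by expanding each vertex outside `U` into a clique on its
neighbours; in a cubic graph these cliques are triangles. -/
def expansion (G : SimpleGraph V) (U : Set V) : SimpleGraph (G.ExpansionVertex U) where
  Adj p q := (p.1.1 = q.1.1 ∧ p.1.2 ≠ q.1.2) ∨
    (G.Adj p.1.1 q.1.1 ∧ (p.1.2 = p.1.1 ∨ p.1.2 = q.1.1) ∧ (q.1.2 = q.1.1 ∨ q.1.2 = p.1.1))
  symm := ⟨fun p q h => by
    rcases h with ⟨h₁, h₂⟩ | ⟨h₁, h₂, h₃⟩
    · exact Or.inl ⟨h₁.symm, h₂.symm⟩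
    · exact Or.inr ⟨h₁.symm, h₃, h₂⟩⟩
  loopless := ⟨fun p h => by
    rcases h with ⟨-, h⟩ | ⟨h, -⟩
    · exact h rfl
    · exact h.ne rfl⟩

variable {U : Set V}

lemma expansion_adj {p q : G.ExpansionVertex U} :
    (G.expansion U).Adj p q ↔ (p.1.1 = q.1.1 ∧ p.1.2 ≠ q.1.2) ∨
      (G.Adj p.1.1 q.1.1 ∧ (p.1.2 = p.1.1 ∨ p.1.2 = q.1.1) ∧
        (q.1.2 = q.1.1 ∨ q.1.2 = p.1.1)) :=
  Iff.rfl

/-- Every edge `vw` of `G` has an end in the fibre of `v` that points towards `w`. -/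
lemma exists_expansionVertex (U : Set V) {v w : V} (h : G.Adj v w) :
    ∃ p : G.ExpansionVertex U, p.1.1 = v ∧ (p.1.2 = v ∨ p.1.2 = w) := by
  by_cases hv : v ∈ U
  · exact ⟨⟨(v, v), Or.inl ⟨hv, rfl⟩⟩, rfl, Or.inl rfl⟩
  · exact ⟨⟨(v, w), Or.inr ⟨hv, h⟩⟩, rfl, Or.inr rfl⟩

/-- Two vertices of an expansion joined to the same vertex of another fibre coincide when they
lie in the same fibre and point to the same vertex. -/
lemma ExpansionVertex.eq_of_fst_eq {p q : G.ExpansionVertex U} {v : V} (h : p.1.1 = q.1.1)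
    (hp : p.1.2 = p.1.1 ∨ p.1.2 = v) (hq : q.1.2 = q.1.1 ∨ q.1.2 = v) : p = q := by
  obtain ⟨⟨p₁, p₂⟩, hp'⟩ := p
  obtain ⟨⟨q₁, q₂⟩, hq'⟩ := q
  dsimp only at *
  subst h
  have : p₂ = q₂ := by
    rcases hp' with ⟨h₁, h₂⟩ | ⟨h₁, h₂⟩ <;> rcases hq' with ⟨h₃, h₄⟩ | ⟨h₃, h₄⟩
    · exact h₂.trans h₄.symm
    · exact absurd h₁ h₃
    · exact absurd h₃ h₁
    · rcases hp with hp | hp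
      · exact absurd hp.symm h₂.ne
      · rcases hq with hq | hq
        · exact absurd hq.symm h₄.ne
        · rw [hp, hq]
  subst this
  rfl

/-- A vertex of the expansion has as many neighbours as the vertex of `G` it comes from. -/
lemma ncard_neighborSet_expansion (p : G.ExpansionVertex U) :
    ((G.expansion U).neighborSet p).ncard = (G.neighborSet p.1.1).ncard := by
  classical
  let f : G.ExpansionVertex U → V := fun q => if q.1.1 = p.1.1 then q.1.2 else q.1.1
  have hinj : Set.InjOn f ((G.expansion U).neighborSet p) := by
    intro q hq r hr hqr
    rw [mem_neighborSet, expansion_adj] at hq hr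
    obtain ⟨⟨p₁, p₂⟩, hp⟩ := p
    obtain ⟨⟨q₁, q₂⟩, hq'⟩ := q
    obtain ⟨⟨r₁, r₂⟩, hr'⟩ := r
    have := fun x y => G.ne_of_adj (a := x) (b := y)
    simp only [f, Subtype.mk.injEq, Prod.mk.injEq] at *
    grind
  have himage : f '' (G.expansion U).neighborSet p = G.neighborSet p.1.1 := by
    ext w
    constructor
    · rintro ⟨q, hq, rfl⟩
      rw [mem_neighborSet, expansion_adj] at hq
      obtain ⟨⟨p₁, p₂⟩, hp⟩ := p
      obtain ⟨⟨q₁, q₂⟩, hq'⟩ := q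
      simp only [f, mem_neighborSet] at *
      have := G.ne_of_adj (a := p₁) (b := q₁)
      grind
    · intro hw
      rw [mem_neighborSet] at hw
      by_cases hpw : p.1.2 = p.1.1 ∨ p.1.2 = w
      · obtain ⟨q, hq₁, hq₂⟩ := exists_expansionVertex U hw.symm
        refine ⟨q, expansion_adj.mpr (Or.inr ⟨hq₁ ▸ hw, hq₁ ▸ hpw, ?_⟩), ?_⟩
        · rwa [hq₁]
        · simp only [f]
          rw [if_neg (hq₁ ▸ hw.ne'), hq₁]
      · push Not at hpw
        have hpU : p.1.1 ∉ U := by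
          rcases p.2 with h | h
          · exact absurd h.2 hpw.1
          · exact h.1
        exact ⟨⟨(p.1.1, w), Or.inr ⟨hpU, hw⟩⟩, expansion_adj.mpr (Or.inl ⟨rfl, hpw.2⟩),
          by simp [f]⟩
  rw [← himage, hinj.ncard_image]

/-- Expanding vertices of a cubic graph keeps it free of bridges. -/
lemma not_isBridge_expansion (hG : ∀ v, (G.neighborSet v).ncard = 3)
    (hb : ∀ e, ¬ G.IsBridge e) (e : Sym2 (G.ExpansionVertex U)) :
    ¬ (G.expansion U).IsBridge e := by
  induction e with | _ p q
  rw [isBridge_iff, not_not]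
  by_cases hpq : p.1.1 = q.1.1
  · by_cases heq : p = q
    · exact heq ▸ Reachable.refl _
    have hne : p.1.2 ≠ q.1.2 := fun h => heq (Subtype.ext (Prod.ext hpq h))
    have hpU : p.1.1 ∉ U := by
      intro h
      rcases p.2 with hp | hp
      · rcases q.2 with hq | hq
        · exact hne (by rw [hp.2, hq.2, hpq])
        · exact hq.1 (hpq ▸ h)
      · exact hp.1 h
    obtain ⟨x, hx, hxp⟩ : ∃ x ∈ G.neighborSet p.1.1, x ∉ ({p.1.2, q.1.2} : Set V) := by
      apply Set.exists_mem_notMem_of_ncard_lt_ncard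
      · rw [hG, Set.ncard_pair hne]
        decide
      · exact Set.toFinite _
    simp only [Set.mem_insert_iff, Set.mem_singleton_iff, not_or] at hxp
    let r : G.ExpansionVertex U := ⟨(p.1.1, x), Or.inr ⟨hpU, hx⟩⟩
    have hrp : r ≠ p := fun h => hxp.1 (congrArg (fun s => s.1.2) h)
    have hrq : r ≠ q := fun h => hxp.2 (congrArg (fun s => s.1.2) h)
    have h₁ : ((G.expansion U).deleteEdges {s(p, q)}).Adj p r := by
      rw [deleteEdges_adj]
      refine ⟨expansion_adj.mpr (Or.inl ⟨rfl, fun h => hxp.1 h.symm⟩), ?_⟩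
      simp only [Set.mem_singleton_iff, Sym2.eq_iff]
      grind
    have h₂ : ((G.expansion U).deleteEdges {s(p, q)}).Adj r q := by
      rw [deleteEdges_adj]
      refine ⟨expansion_adj.mpr (Or.inl ⟨hpq, hxp.2⟩), ?_⟩
      simp only [Set.mem_singleton_iff, Sym2.eq_iff]
      grind
    exact h₁.reachable.trans h₂.reachable
  · have hfib : ∀ r s : G.ExpansionVertex U, r.1.1 = s.1.1 →
        ((G.expansion U).deleteEdges {s(p, q)}).Reachable r s := by
      intro r s hrs
      by_cases heq : r = s
      · exact heq ▸ Reachable.refl _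
      refine Adj.reachable ?_
      rw [deleteEdges_adj]
      refine ⟨expansion_adj.mpr (Or.inl ⟨hrs, fun h => heq (Subtype.ext (Prod.ext hrs h))⟩), ?_⟩
      simp only [Set.mem_singleton_iff, Sym2.eq_iff]
      grind
    have hwalk : ∀ (v w : V) (_ : (G.deleteEdges {s(p.1.1, q.1.1)}).Walk v w)
        (r s : G.ExpansionVertex U), r.1.1 = v → s.1.1 = w →
        ((G.expansion U).deleteEdges {s(p, q)}).Reachable r s := by
      intro v w c
      induction c with
      | nil => exact fun r s hr hs => hfib r s (hr.trans hs.symm)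
      | @cons v x w h c ih =>
        intro r s hr hs
        rw [deleteEdges_adj] at h
        obtain ⟨a, ha₁, ha₂⟩ := exists_expansionVertex U h.1
        obtain ⟨b, hb₁, hb₂⟩ := exists_expansionVertex U h.1.symm
        have hab : ((G.expansion U).deleteEdges {s(p, q)}).Adj a b := by
          rw [deleteEdges_adj]
          refine ⟨expansion_adj.mpr (Or.inr ?_), ?_⟩
          · rw [ha₁, hb₁]
            exact ⟨h.1, ha₂, hb₂⟩
          · intro hmem
            refine h.2 ?_
            have := congrArg (Sym2.map fun s : G.ExpansionVertex U => s.1.1) hmem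
            simpa [ha₁, hb₁] using this
        exact (hfib r a (hr.trans ha₁.symm)).trans (hab.reachable.trans (ih b s hb₁ hs))
    have := hb s(p.1.1, q.1.1)
    rw [isBridge_iff, not_not] at this
    obtain ⟨c⟩ := this
    exact hwalk _ _ c p q rfl rfl

/-- The edges of the expansion of the vertices isolated in `F` that come from edges of `G`
outside `F`. -/
def expansionMatching (G F : SimpleGraph V) : (G.expansion F.support).Subgraph where
  verts := Set.univ
  Adj p q := (G.expansion F.support).Adj p q ∧ p.1.1 ≠ q.1.1 ∧ ¬ F.Adj p.1.1 q.1.1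
  adj_sub h := h.1
  edge_vert _ := Set.mem_univ _
  symm := ⟨fun _ _ h => ⟨h.1.symm, h.2.1.symm, fun h' => h.2.2 h'.symm⟩⟩

lemma isPerfectMatching_expansionMatching [Finite V] {F : SimpleGraph V}
    (hG : ∀ v, (G.neighborSet v).ncard = 3) (hFG : F ≤ G)
    (hF : ∀ v ∈ F.support, (F.neighborSet v).ncard = 2) :
    (G.expansionMatching F).IsPerfectMatching := by
  rw [Subgraph.isPerfectMatching_iff]
  intro p
  obtain ⟨w, hw, hpw, hwF, huniq⟩ : ∃ w, G.Adj p.1.1 w ∧ (p.1.2 = p.1.1 ∨ p.1.2 = w) ∧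
      ¬ F.Adj p.1.1 w ∧
      ∀ x, G.Adj p.1.1 x → (p.1.2 = p.1.1 ∨ p.1.2 = x) → ¬ F.Adj p.1.1 x → x = w := by
    rcases p.2 with ⟨hpU, hp⟩ | ⟨hpU, hp⟩
    · have hcard : (G.neighborSet p.1.1 \ F.neighborSet p.1.1).ncard = 1 := by
        rw [Set.ncard_sdiff (show F.neighborSet p.1.1 ⊆ G.neighborSet p.1.1 from fun x hx => hFG hx), hG, hF _ hpU]
      obtain ⟨w, hw⟩ := Set.ncard_eq_one.mp hcard
      have hw' : w ∈ G.neighborSet p.1.1 \ F.neighborSet p.1.1 := hw ▸ rfl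
      refine ⟨w, hw'.1, Or.inl hp, hw'.2, fun x hx _ hxF => ?_⟩
      have : x ∈ G.neighborSet p.1.1 \ F.neighborSet p.1.1 := ⟨hx, hxF⟩
      rwa [hw] at this
    · refine ⟨p.1.2, hp, Or.inr rfl, fun h => hpU ⟨_, h⟩, fun x _ h _ => ?_⟩
      exact (h.resolve_left hp.ne').symm
  obtain ⟨q, hq₁, hq₂⟩ := exists_expansionVertex F.support hw.symm
  refine ⟨q, ⟨expansion_adj.mpr (Or.inr ?_), ?_, ?_⟩, ?_⟩
  · rw [hq₁]
    exact ⟨hw, hpw, hq₂⟩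
  · rw [hq₁]
    exact hw.ne
  · rwa [hq₁]
  · rintro r ⟨hr₁, hr₂, hr₃⟩
    rcases expansion_adj.mp hr₁ with h | ⟨h₁, h₂, h₃⟩
    · exact absurd h.1 hr₂
    · have hrw := huniq _ h₁ h₂ hr₃
      refine ExpansionVertex.eq_of_fst_eq (hrw.trans hq₁.symm) h₃ ?_
      rwa [hq₁]

/-- The image in `G` of a subgraph of an expansion under contracting the fibres. -/
def Subgraph.contract (M : (G.expansion U).Subgraph) : G.Subgraph where
  verts := Set.univ
  Adj v w := v ≠ w ∧ ∃ p q, M.Adj p q ∧ p.1.1 = v ∧ q.1.1 = w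
  adj_sub := by
    rintro v w ⟨hne, p, q, h, rfl, rfl⟩
    rcases expansion_adj.mp h.adj_sub with h | h
    · exact absurd h.1 hne
    · exact h.1
  edge_vert _ := Set.mem_univ _
  symm := ⟨by
    rintro v w ⟨hne, p, q, h, hp, hq⟩
    exact ⟨hne.symm, q, p, h.symm, hq, hp⟩⟩

/-- A perfect matching of an expansion contracts to a perfect matching when each expanded
vertex has all but one vertex of its fibre matched inside the fibre. -/
lemma Subgraph.IsPerfectMatching.contract {M : (G.expansion U).Subgraph}
    (hM : M.IsPerfectMatching)
    (hfib : ∀ v, ∃ p : G.ExpansionVertex U, p.1.1 = v ∧ (∀ q, M.Adj p q → q.1.1 ≠ v) ∧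
      ∀ r : G.ExpansionVertex U, r.1.1 = v → r ≠ p → ∃ s, M.Adj r s ∧ s.1.1 = v) :
    M.contract.IsPerfectMatching := by
  rw [Subgraph.isPerfectMatching_iff] at hM ⊢
  intro v
  obtain ⟨p, hp, hpout, hrest⟩ := hfib v
  obtain ⟨q, hq, hquniq⟩ := hM p
  refine ⟨q.1.1, ⟨(hpout q hq).symm, p, q, hq, hp, rfl⟩, ?_⟩
  rintro w ⟨hne, r, s, hrs, hr, rfl⟩
  by_cases hrp : r = p
  · subst hrp
    rw [hquniq s hrs]
  · obtain ⟨t, ht, htv⟩ := hrest r hr hrp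
    exact absurd (htv.symm.trans (congrArg (fun x => x.1.1) ((hM r).unique ht hrs))) hne

/-- If a perfect matching of a cubic expansion has an edge in every triangle replacing a vertex,
then it contracts to a perfect matching. -/
lemma Subgraph.IsPerfectMatching.contract_of_forall_exists [Finite V]
    (hG : ∀ v, (G.neighborSet v).ncard = 3) {M : (G.expansion U).Subgraph}
    (hM : M.IsPerfectMatching)
    (hhit : ∀ v ∉ U, ∃ p q : G.ExpansionVertex U, M.Adj p q ∧ p.1.1 = v ∧ q.1.1 = v) :
    M.contract.IsPerfectMatching := by
  refine hM.contract fun v => ?_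
  rw [Subgraph.isPerfectMatching_iff] at hM
  by_cases hv : v ∈ U
  · have hsub : ∀ r : G.ExpansionVertex U, r.1.1 = v → r = ⟨(v, v), Or.inl ⟨hv, rfl⟩⟩ := by
      rintro r rfl
      rcases r.2 with h | h
      · exact Subtype.ext (Prod.ext rfl h.2)
      · exact absurd hv h.1
    refine ⟨⟨(v, v), Or.inl ⟨hv, rfl⟩⟩, rfl, fun q hq hqv => ?_, fun r hr hne =>
      absurd (hsub r hr) hne⟩
    exact hq.adj_sub.ne (hsub q hqv).symm
  · obtain ⟨p, q, hpq, hp, hq⟩ := hhit v hv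
    have hpq₂ : p.1.2 ≠ q.1.2 := fun h =>
      hpq.adj_sub.ne (Subtype.ext (Prod.ext (hp.trans hq.symm) h))
    have hadj : ∀ r : G.ExpansionVertex U, r.1.1 = v → G.Adj v r.1.2 := by
      rintro r rfl
      rcases r.2 with h | h
      · exact absurd h.1 hv
      · exact h.2
    have hcard : (G.neighborSet v \ {p.1.2, q.1.2}).ncard = 1 := by
      rw [Set.ncard_sdiff, hG, Set.ncard_pair hpq₂]
      rintro x (rfl | rfl)
      · exact hadj p hp
      · exact hadj q hq
    obtain ⟨x, hx⟩ := Set.ncard_eq_one.mp hcard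
    have hx' : x ∈ G.neighborSet v \ {p.1.2, q.1.2} := hx ▸ rfl
    have hxpq := hx'.2
    simp only [Set.mem_insert_iff, Set.mem_singleton_iff, not_or] at hxpq
    have hfibre : ∀ r : G.ExpansionVertex U, r.1.1 = v →
        r = p ∨ r = q ∨ r = ⟨(v, x), Or.inr ⟨hv, hx'.1⟩⟩ := by
      intro r hr
      by_cases h₁ : r.1.2 = p.1.2
      · exact Or.inl (Subtype.ext (Prod.ext (hr.trans hp.symm) h₁))
      by_cases h₂ : r.1.2 = q.1.2
      · exact Or.inr (Or.inl (Subtype.ext (Prod.ext (hr.trans hq.symm) h₂)))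
      have : r.1.2 ∈ G.neighborSet v \ {p.1.2, q.1.2} := ⟨hadj r hr, by simp [h₁, h₂]⟩
      rw [hx] at this
      exact Or.inr (Or.inr (Subtype.ext (Prod.ext hr this)))
    refine ⟨⟨(v, x), Or.inr ⟨hv, hx'.1⟩⟩, rfl, fun r hr hrv => ?_, fun r hr hne => ?_⟩
    · rcases hfibre r hrv with rfl | rfl | rfl
      · exact hxpq.2 (congrArg (fun s => s.1.2) ((hM r).unique hr.symm hpq))
      · exact hxpq.1 (congrArg (fun s => s.1.2) ((hM r).unique hr.symm hpq.symm))
      · exact hr.adj_sub.ne rfl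
    · rcases hfibre r hr with rfl | rfl | h
      · exact ⟨q, hpq, hq⟩
      · exact ⟨p, hpq.symm, hp⟩
      · exact absurd h hne

/-- A perfect matching of the expansion whose removal, together with the edges of `G` outside
`F`, leaves a bipartite graph has an edge in every triangle replacing a vertex. -/
lemma exists_adj_fibre_of_colorable_two {F : SimpleGraph V}
    (hG : ∀ v, (G.neighborSet v).ncard = 3) {M : (G.expansion F.support).Subgraph}
    (hcol : ((G.expansion F.support).deleteEdges
      ((G.expansionMatching F).edgeSet ∪ M.edgeSet)).Colorable 2) {v : V} (hv : v ∉ F.support) :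
    ∃ p q : G.ExpansionVertex F.support, M.Adj p q ∧ p.1.1 = v ∧ q.1.1 = v := by
  obtain ⟨c⟩ := hcol
  by_contra! hno
  obtain ⟨a, b, d, hab, had, hbd, habd⟩ := Set.ncard_eq_three.mp (hG v)
  have hmem : ∀ x ∈ ({a, b, d} : Set V), G.Adj v x := fun x hx => by
    rw [← habd] at hx
    exact hx
  have hne : ∀ (x y : V) (hx : G.Adj v x) (hy : G.Adj v y), x ≠ y →
      c ⟨(v, x), Or.inr ⟨hv, hx⟩⟩ ≠ c ⟨(v, y), Or.inr ⟨hv, hy⟩⟩ := by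
    intro x y hx hy hxy
    refine c.valid ?_
    rw [deleteEdges_adj]
    refine ⟨expansion_adj.mpr (Or.inl ⟨rfl, hxy⟩), ?_⟩
    rintro (h | h)
    · exact h.2.1 rfl
    · exact hno _ _ h rfl rfl
  have h₁ := hne a b (hmem a (by simp)) (hmem b (by simp)) hab
  have h₂ := hne a d (hmem a (by simp)) (hmem d (by simp)) had
  have h₃ := hne b d (hmem b (by simp)) (hmem d (by simp)) hbd
  omega

/-- Contracting a matching `M` as in `exists_adj_fibre_of_colorable_two` leaves `F` bipartite
after removing the contracted matching. -/
lemma colorable_two_deleteEdges_contract {F : SimpleGraph V} (hFG : F ≤ G)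
    {M : (G.expansion F.support).Subgraph}
    (hcol : ((G.expansion F.support).deleteEdges
      ((G.expansionMatching F).edgeSet ∪ M.edgeSet)).Colorable 2) :
    (F.deleteEdges M.contract.edgeSet).Colorable 2 := by
  classical
  obtain ⟨c⟩ := hcol
  refine ⟨Coloring.mk
    (fun v => if hv : v ∈ F.support then c ⟨(v, v), Or.inl ⟨hv, rfl⟩⟩ else 0) ?_⟩
  intro v w hvw
  rw [deleteEdges_adj] at hvw
  have hv : v ∈ F.support := ⟨w, hvw.1⟩
  have hw : w ∈ F.support := ⟨v, hvw.1.symm⟩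
  rw [dif_pos hv, dif_pos hw]
  refine c.valid ?_
  rw [deleteEdges_adj]
  refine ⟨expansion_adj.mpr (Or.inr ⟨hFG hvw.1, Or.inl rfl, Or.inl rfl⟩), ?_⟩
  rintro (h | h)
  · exact h.2.2 hvw.1
  · exact hvw.2 ⟨hvw.1.ne, _, _, h, rfl, rfl⟩

/-- A circuit that becomes bipartite after removing the edges of `M`, although it has an odd
number of edges, shares an edge with `M`. -/
lemma Subgraph.nonempty_inter_edgeSet_of_colorable_two [Finite V] {F : SimpleGraph V}
    {M C : G.Subgraph} (hcol : (F.deleteEdges M.edgeSet).Colorable 2)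
    (hCF : ∀ v w, C.Adj v w → F.Adj v w)
    (hC : ∀ v ∈ C.verts, (C.neighborSet v).ncard = 2) (hodd : Odd C.edgeSet.ncard) :
    (M.edgeSet ∩ C.edgeSet).Nonempty := by
  by_contra hemp
  have hle : C.spanningCoe ≤ F.deleteEdges M.edgeSet := by
    intro v w hvw
    rw [SimpleGraph.deleteEdges_adj]
    exact ⟨hCF v w hvw, fun h => hemp ⟨s(v, w), h, hvw⟩⟩
  have heven := (hcol.mono_left hle).even_ncard_edgeSet fun v => by
    change Even (C.neighborSet v).ncard
    by_cases hv : v ∈ C.verts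
    · rw [hC v hv]
      exact even_two
    · have : C.neighborSet v = ∅ := Set.eq_empty_of_forall_notMem fun w hw => hv hw.fst_mem
      simp [this]
  rw [Subgraph.edgeSet_spanningCoe] at heven
  exact Nat.not_even_iff_odd.mpr hodd heven

/-- The union of pairwise disjoint circuits has two neighbours at every vertex it covers. -/
lemma Subgraph.ncard_neighborSet_sSup_spanningCoe {𝒪 : Set G.Subgraph}
    (h𝒪 : ∀ C ∈ 𝒪, ∀ v ∈ C.verts, (C.neighborSet v).ncard = 2)
    (hdisj : ∀ C ∈ 𝒪, ∀ D ∈ 𝒪, C ≠ D → Disjoint C.verts D.verts) {v : V}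
    (hv : v ∈ (sSup 𝒪).spanningCoe.support) :
    ((sSup 𝒪).spanningCoe.neighborSet v).ncard = 2 := by
  obtain ⟨w, hw⟩ := (SimpleGraph.mem_support _).mp hv
  rw [Subgraph.spanningCoe_adj, Subgraph.sSup_adj] at hw
  obtain ⟨C, hC, hCw⟩ := hw
  rw [← h𝒪 C hC v hCw.fst_mem]
  congr 1
  ext x
  rw [SimpleGraph.mem_neighborSet, Subgraph.spanningCoe_adj, Subgraph.sSup_adj, Subgraph.mem_neighborSet]
  refine ⟨?_, fun h => ⟨C, hC, h⟩⟩
  rintro ⟨D, hD, hDx⟩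
  by_cases hCD : C = D
  · exact hCD ▸ hDx
  · exact absurd hDx.fst_mem (Set.disjoint_left.mp (hdisj C hC D hD hCD) hCw.fst_mem)

end SimpleGraph



/-- The following are equivalent for the class of bridgeless cubic graphs:
(1) every perfect matching `N` of a bridgeless cubic graph extends to a perfect matching
`M` such that deleting `N ∪ M` leaves a bipartite graph (an `S₄`-pair through `N`);
(2) for every collection of pairwise vertex-disjoint odd circuits of a bridgeless cubic
graph there is a perfect matching intersecting the edge set of each circuit. -/
theorem extend_pm_to_S4_iff_hit_odd_circuits :
    (∀ (V : Type) (_ : Fintype V) (G : SimpleGraph V),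
      (∀ v : V, (G.neighborSet v).ncard = 3) →
      (∀ e : Sym2 V, ¬ G.IsBridge e) →
      ∀ N : G.Subgraph, N.IsPerfectMatching →
        ∃ M : G.Subgraph, M.IsPerfectMatching ∧
          (G.deleteEdges (N.edgeSet ∪ M.edgeSet)).Colorable 2) ↔
    (∀ (V : Type) (_ : Fintype V) (G : SimpleGraph V),
      (∀ v : V, (G.neighborSet v).ncard = 3) →
      (∀ e : Sym2 V, ¬ G.IsBridge e) →
      ∀ 𝒪 : Set G.Subgraph,
        (∀ C ∈ 𝒪, C.Connected ∧ (∀ v ∈ C.verts, (C.neighborSet v).ncard = 2) ∧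
          Odd C.edgeSet.ncard) →
        (∀ C ∈ 𝒪, ∀ D ∈ 𝒪, C ≠ D → Disjoint C.verts D.verts) →
        ∃ M : G.Subgraph, M.IsPerfectMatching ∧
          ∀ C ∈ 𝒪, (M.edgeSet ∩ C.edgeSet).Nonempty) := by
  constructor
  · intro h V _ G hG hb 𝒪 h𝒪 hdisj
    classical
    let F : SimpleGraph V := (sSup 𝒪).spanningCoe
    have hFG : F ≤ G := (sSup 𝒪).spanningCoe_le
    have hF : ∀ v ∈ F.support, (F.neighborSet v).ncard = 2 := fun v hv =>
      SimpleGraph.Subgraph.ncard_neighborSet_sSup_spanningCoe (fun C hC => (h𝒪 C hC).2.1) hdisj hv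
    obtain ⟨M, hM, hcol⟩ := h (G.ExpansionVertex F.support) (Fintype.ofFinite _)
      (G.expansion F.support)
      (fun p => (SimpleGraph.ncard_neighborSet_expansion p).trans (hG _))
      (SimpleGraph.not_isBridge_expansion hG hb) (G.expansionMatching F)
      (SimpleGraph.isPerfectMatching_expansionMatching hG hFG hF)
    refine ⟨M.contract, hM.contract_of_forall_exists hG fun v hv =>
      SimpleGraph.exists_adj_fibre_of_colorable_two hG hcol hv, fun C hC => ?_⟩
    exact SimpleGraph.Subgraph.nonempty_inter_edgeSet_of_colorable_two
      (SimpleGraph.colorable_two_deleteEdges_contract hFG hcol)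
      (fun v w hvw => SimpleGraph.Subgraph.sSup_adj.mpr ⟨C, hC, hvw⟩) (h𝒪 C hC).2.1 (h𝒪 C hC).2.2
  · intro h V _ G hG hb N hN
    have hsub : ∀ C : G.Subgraph, Disjoint C.edgeSet N.edgeSet →
        ∀ x y, C.Adj x y → (G.deleteEdges N.edgeSet).Adj x y := fun C hC x y hxy => by
      rw [SimpleGraph.deleteEdges_adj]
      exact ⟨hxy.adj_sub, Set.disjoint_left.mp hC hxy⟩
    obtain ⟨M, hM, hhit⟩ := h V inferInstance G hG hb
      {C | (C.Connected ∧ (∀ v ∈ C.verts, (C.neighborSet v).ncard = 2) ∧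
        Odd C.edgeSet.ncard) ∧ Disjoint C.edgeSet N.edgeSet}
      (fun C hC => hC.1)
      (fun C hC D hD hCD => Set.disjoint_left.mpr fun v hvC hvD => hCD <|
        SimpleGraph.Subgraph.eq_of_mem_verts_of_ncard_neighborSet
          (hN.ncard_neighborSet_deleteEdges hG) hC.1.1 hD.1.1 hC.1.2.1 hD.1.2.1
          (hsub C hC.2) (hsub D hD.2) hvC hvD)
    exact ⟨M, hM, SimpleGraph.colorable_two_deleteEdges_of_forall_nonempty
      fun C h₁ h₂ h₃ h₄ => hhit C ⟨⟨h₁, h₂, h₃⟩, h₄⟩⟩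
end
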